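/- arXiv:0710.3267 — 6 statements merged into one kernel-verified Lean document; each statement's English description precedes it below -/
import Mathlib

section
/- For the alternating group A₅ (of order 60), P(A₅) = 1/3, and this value is attained exactly for s of order 5. Precisely: (i) for every s ∈ A₅ of order 5 and every nonidentity g ∈ A₅, the number of h ∈ A₅ with ⟨h⁻¹sh, g⟩ ≠ A₅ is at most 20 = |A₅|/3, and there is a nonidentity g for which this number equals 20; (ii) for every nonidentity s ∈ A₅ of order different from 5, there exists a nonidentity g ∈ A₅ such that the number of h ∈ A₅ with ⟨h⁻¹sh, g⟩ ≠ A₅ is strictly greater than 20. -/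
/-- `A₅` viewed as a group in its own right. -/
abbrev A5 : Type := alternatingGroup (Fin 5)

namespace S9

/-- `g` centralizes or inverts `x`. -/
def Bad (x g : A5) : Prop := g * x = x * g ∨ g * x = x⁻¹ * g

instance (x g : A5) : Decidable (Bad x g) := by unfold Bad; infer_instance

def c5 : A5 := ⟨finRotate 5, Equiv.Perm.mem_alternatingGroup.mpr (by decide)⟩
def d2 : A5 := ⟨Equiv.swap 0 1 * Equiv.swap 2 3, Equiv.Perm.mem_alternatingGroup.mpr (by decide)⟩
def d3 : A5 := ⟨Equiv.swap 0 1 * Equiv.swap 1 2, Equiv.Perm.mem_alternatingGroup.mpr (by decide)⟩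

set_option maxRecDepth 100000

theorem orders : ∀ s : A5, s ≠ 1 → s ^ 2 = 1 ∨ s ^ 3 = 1 ∨ s ^ 5 = 1 := by decide +kernel
theorem cls2 : ∀ s : A5, s ^ 2 = 1 → s ≠ 1 → ∃ k : A5, d2 * k = k * s := by decide +kernel
theorem cls3 : ∀ s : A5, s ^ 3 = 1 → s ≠ 1 → ∃ k : A5, d3 * k = k * s := by decide +kernel
theorem cls5 : ∀ s : A5, s ^ 5 = 1 → s ≠ 1 →
    ∃ k : A5, c5 * k = k * s ∨ c5 ^ 2 * k = k * s := by decide +kernel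

theorem conj_of_eq {r k s : A5} (h : r * k = k * s) : k⁻¹ * r * k = s := by
  rw [mul_assoc, h, inv_mul_cancel_left]

theorem conj5 (s : A5) (h5 : s ^ 5 = 1) (h1 : s ≠ 1) :
    ∃ k : A5, k⁻¹ * c5 * k = s ∨ k⁻¹ * c5 ^ 2 * k = s := by
  obtain ⟨k, hk⟩ := cls5 s h5 h1
  exact ⟨k, hk.imp conj_of_eq conj_of_eq⟩

/-- Every nonidentity element is conjugate to one of four representatives. -/
theorem classes (s : A5) (h1 : s ≠ 1) :
    ∃ k r : A5, (r = d2 ∨ r = d3 ∨ r = c5 ∨ r = c5 ^ 2) ∧ k⁻¹ * r * k = s := by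
  rcases orders s h1 with h | h | h
  · obtain ⟨k, hk⟩ := cls2 s h h1
    exact ⟨k, d2, by simp, conj_of_eq hk⟩
  · obtain ⟨k, hk⟩ := cls3 s h h1
    exact ⟨k, d3, by simp, conj_of_eq hk⟩
  · obtain ⟨k, hk | hk⟩ := conj5 s h h1
    · exact ⟨k, c5, by simp, hk⟩
    · exact ⟨k, c5 ^ 2, by simp, hk⟩

theorem fix2 : 20 < (Finset.univ.filter fun h : A5 =>
    ∃ p : Fin 5, (h⁻¹ * d2 * h).1 p = p ∧ d3.1 p = p).card := by decide +kernel
theorem fix3 : 20 < (Finset.univ.filter fun h : A5 =>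
    ∃ p : Fin 5, (h⁻¹ * d3 * h).1 p = p ∧ d2.1 p = p).card := by decide +kernel

theorem cnt1_d3 : (Finset.univ.filter fun h : A5 => Bad (h⁻¹ * c5 * h) d3).card ≤ 20 := by
  decide +kernel
theorem cnt1_c : (Finset.univ.filter fun h : A5 => Bad (h⁻¹ * c5 * h) c5).card ≤ 20 := by
  decide +kernel
theorem cnt1_cc : (Finset.univ.filter fun h : A5 => Bad (h⁻¹ * c5 * h) (c5 ^ 2)).card ≤ 20 := by
  decide +kernel
theorem cnt2_d3 : (Finset.univ.filter fun h : A5 => Bad (h⁻¹ * c5 ^ 2 * h) d3).card ≤ 20 := by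
  decide +kernel
theorem cnt2_c : (Finset.univ.filter fun h : A5 => Bad (h⁻¹ * c5 ^ 2 * h) c5).card ≤ 20 := by
  decide +kernel
theorem cnt2_cc :
    (Finset.univ.filter fun h : A5 => Bad (h⁻¹ * c5 ^ 2 * h) (c5 ^ 2)).card ≤ 20 := by
  decide +kernel
theorem cnt1e : (Finset.univ.filter fun h : A5 => Bad (h⁻¹ * c5 * h) d2).card = 20 := by
  decide +kernel
theorem cnt2e : (Finset.univ.filter fun h : A5 => Bad (h⁻¹ * c5 ^ 2 * h) d2).card = 20 := by
  decide +kernel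
theorem nrm : ∀ g : A5, ∀ k : Fin 5,
    (g * c5 * g⁻¹ = c5 ^ k.1 → Bad c5 g) ∧
    (g * c5 ^ 2 * g⁻¹ = (c5 ^ 2) ^ k.1 → Bad (c5 ^ 2) g) := by decide +kernel
theorem moves : ∀ p : Fin 5, ∃ g : A5, g.1 p ≠ p := by decide +kernel
theorem d2_ne : d2 ≠ 1 := by decide +kernel
theorem d3_ne : d3 ≠ 1 := by decide +kernel

theorem card_A5 : Nat.card A5 = 60 := by
  rw [Nat.card_eq_fintype_card]; decide +kernel

theorem bad_conj (k x g : A5) : Bad (k⁻¹ * x * k) g ↔ Bad x (k * g * k⁻¹) := by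
  unfold Bad
  constructor <;> rintro (h | h)
  · left
    have := congrArg (fun y => k * y * k⁻¹) h
    simpa [mul_assoc] using this
  · right
    have := congrArg (fun y => k * y * k⁻¹) h
    simpa [mul_assoc] using this
  · left
    have := congrArg (fun y => k⁻¹ * y * k) h
    simpa [mul_assoc] using this
  · right
    have := congrArg (fun y => k⁻¹ * y * k) h
    simpa [mul_assoc] using this

/-- An element normalizing the group generated by an element of order 5 centralizes or inverts it. -/
theorem bad_of_mem {x g : A5} (h5 : orderOf x = 5) (h : g * x * g⁻¹ ∈ Subgroup.zpowers x) :
    Bad x g := by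
  have hx1 : x ≠ 1 := by rintro rfl; simp at h5
  have hx5 : x ^ 5 = 1 := orderOf_dvd_iff_pow_eq_one.mp h5.dvd
  have hex : ∃ k : Fin 5, g * x * g⁻¹ = x ^ k.1 := by
    obtain ⟨n, hn⟩ := (mem_powers_iff_mem_zpowers (x := x)).mpr h
    refine ⟨⟨n % 5, Nat.mod_lt _ (by norm_num)⟩, ?_⟩
    rw [← hn]
    simp only
    have hp := pow_mod_orderOf x n
    rw [h5] at hp
    exact hp.symm
  obtain ⟨j, hj⟩ := hex
  obtain ⟨k, hk | hk⟩ := conj5 x hx5 hx1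
  · rw [← hk, bad_conj]
    refine (nrm (k * g * k⁻¹) j).1 ?_
    have hc : c5 = k * x * k⁻¹ := by rw [← hk]; group
    rw [hc, conj_pow, ← hj]; group
  · rw [← hk, bad_conj]
    refine (nrm (k * g * k⁻¹) j).2 ?_
    have hc : c5 ^ 2 = k * x * k⁻¹ := by rw [← hk]; group
    rw [hc, conj_pow, ← hj]; group

theorem top_of_card {H : Subgroup A5} (h25 : 25 ≤ Nat.card H) :
    H = ⊤ := by
  have hm := H.card_mul_index
  rw [card_A5] at hm
  have hi : H.index = 1 ∨ H.index = 2 := by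
    have h2 : H.index ≤ 2 := by
      by_contra hc
      have := Nat.mul_le_mul h25 (show 3 ≤ H.index by omega)
      omega
    have h0 : H.index ≠ 0 := by intro h; rw [h] at hm; omega
    omega
  rcases hi with hi | hi
  · exact Subgroup.index_eq_one.mp hi
  · have hn : H.Normal := Subgroup.normal_of_index_eq_two hi
    rcases hn.eq_bot_or_eq_top with h | h
    · rw [h] at h25; simp at h25
    · exact h

theorem gen_iff {x g : A5} (h5 : orderOf x = 5) :
    Subgroup.closure {x, g} ≠ ⊤ ↔ Bad x g := by
  have hcx : Nat.card (Subgroup.zpowers x) = 5 := by rw [Nat.card_zpowers, h5]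
  constructor
  · intro hne
    by_contra hb
    apply hne
    have hxm : x ∈ Subgroup.closure {x, g} := Subgroup.subset_closure (by simp)
    have hgm : g ∈ Subgroup.closure {x, g} := Subgroup.subset_closure (by simp)
    set H := Subgroup.closure {x, g} with hH
    set y := g * x * g⁻¹ with hy
    have hym : y ∈ H := H.mul_mem (H.mul_mem hgm hxm) (H.inv_mem hgm)
    have hoy : orderOf y = 5 := ((MulAut.conj g).orderOf_eq x).trans h5
    have hcy : Nat.card (Subgroup.zpowers y) = 5 := by rw [Nat.card_zpowers, hoy]
    have hyx : y ∉ Subgroup.zpowers x := fun h => hb (bad_of_mem h5 h)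
    have hdis : Disjoint (Subgroup.zpowers x) (Subgroup.zpowers y) := by
      rw [disjoint_iff]
      have hd : Nat.card (Subgroup.zpowers x ⊓ Subgroup.zpowers y : Subgroup A5) ∣ 5 :=
        (Subgroup.card_dvd_of_le inf_le_right).trans hcy.dvd
      rcases (Nat.dvd_prime Nat.prime_five).mp hd with h | h
      · exact Subgroup.card_eq_one.mp h
      · exfalso
        have he := Subgroup.eq_of_le_of_card_ge
          (inf_le_right : Subgroup.zpowers x ⊓ Subgroup.zpowers y ≤ Subgroup.zpowers y)
          (by rw [h, hcy])
        apply hyx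
        have : y ∈ Subgroup.zpowers x ⊓ Subgroup.zpowers y := by
          rw [he]; exact Subgroup.mem_zpowers y
        exact this.1
    have hinj := Subgroup.mul_injective_of_disjoint hdis
    have hxH : Subgroup.zpowers x ≤ H := by simpa using hxm
    have hyH : Subgroup.zpowers y ≤ H := by simpa using hym
    apply top_of_card
    · have := Nat.card_le_card_of_injective
        (fun p : Subgroup.zpowers x × Subgroup.zpowers y =>
          (⟨p.1.1 * p.2.1, H.mul_mem (hxH p.1.2) (hyH p.2.2)⟩ : H))
        (fun p q hpq => hinj (congrArg Subtype.val hpq))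
      rw [Nat.card_prod, hcx, hcy] at this
      exact this
  · intro hb ht
    have hle : Subgroup.closure {x, g} ≤ Subgroup.normalizer (Subgroup.zpowers x) := by
      rw [Subgroup.closure_le]
      rintro z (rfl | rfl)
      · exact Subgroup.le_normalizer (Subgroup.mem_zpowers z)
      · have hz : ((MulAut.conj z).toMonoidHom x = x ∨ (MulAut.conj z).toMonoidHom x = x⁻¹) := by
          rcases hb with h | h
          · left; simp [h]
          · right; simp [h]
        have hmap : (Subgroup.zpowers x).map (MulAut.conj z).toMonoidHom = Subgroup.zpowers x := by
          rw [MonoidHom.map_zpowers]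
          rcases hz with h | h
          · rw [h]
          · rw [h, Subgroup.zpowers_inv]
        rw [SetLike.mem_coe, Subgroup.mem_normalizer_iff]
        intro w
        constructor
        · intro hw
          rw [← hmap]
          exact ⟨w, hw, by simp⟩
        · intro hw
          rw [← hmap] at hw
          obtain ⟨v, hv, hvw⟩ := hw
          have : v = w := by simpa using hvw
          rwa [← this]
    rw [ht, top_le_iff, Subgroup.normalizer_eq_top_iff] at hle
    rcases hle.eq_bot_or_eq_top with h | h
    · rw [h] at hcx; simp at hcx
    · rw [h, Subgroup.card_top, card_A5] at hcx; omega

theorem not_gen_of_fix {x g : A5} (p : Fin 5) (hx : x.1 p = p) (hg : g.1 p = p) :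
    Subgroup.closure {x, g} ≠ ⊤ := by
  intro ht
  have hle : Subgroup.closure {x, g} ≤ MulAction.stabilizer A5 p := by
    rw [Subgroup.closure_le]
    rintro z (rfl | rfl)
    · exact hx
    · exact hg
  obtain ⟨k, hk⟩ := moves p
  rw [ht] at hle
  exact hk (hle (Subgroup.mem_top k))

theorem card_eq (s g : A5) (hs : orderOf s = 5) :
    Nat.card {h : A5 // Subgroup.closure {h⁻¹ * s * h, g} ≠ ⊤} =
      (Finset.univ.filter fun h : A5 => Bad (h⁻¹ * s * h) g).card := by
  rw [← Fintype.card_subtype, ← Nat.card_eq_fintype_card]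
  refine Nat.card_congr (Equiv.subtypeEquivRight fun h => gen_iff ?_)
  have ho : orderOf (h⁻¹ * s * h) = orderOf s := by
    simpa using (MulAut.conj h⁻¹).orderOf_eq s
  exact ho.trans hs

theorem card_conj (k s g : A5) :
    (Finset.univ.filter fun h : A5 => Bad (h⁻¹ * (k⁻¹ * s * k) * h) g).card =
      (Finset.univ.filter fun h : A5 => Bad (h⁻¹ * s * h) g).card := by
  rw [← Fintype.card_subtype, ← Fintype.card_subtype]
  refine Fintype.card_congr (Equiv.subtypeEquiv (Equiv.mulLeft k) fun h => ?_)
  have : h⁻¹ * (k⁻¹ * s * k) * h = (Equiv.mulLeft k h)⁻¹ * s * (Equiv.mulLeft k h) := by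
    simp [mul_assoc]
  rw [this]

theorem card_conj_right (k s g : A5) :
    (Finset.univ.filter fun h : A5 => Bad (h⁻¹ * s * h) (k⁻¹ * g * k)).card =
      (Finset.univ.filter fun h : A5 => Bad (h⁻¹ * s * h) g).card := by
  rw [← Fintype.card_subtype, ← Fintype.card_subtype]
  refine Fintype.card_congr (Equiv.subtypeEquiv (Equiv.mulRight k⁻¹) fun h => ?_)
  have e : (Equiv.mulRight k⁻¹ h)⁻¹ * s * (Equiv.mulRight k⁻¹ h) =
      k⁻¹⁻¹ * (h⁻¹ * s * h) * k⁻¹ := by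
    simp [mul_assoc]
  rw [e, bad_conj k⁻¹ (h⁻¹ * s * h) g, inv_inv]

theorem cnt1 (g : A5) (hg : g ≠ 1) :
    (Finset.univ.filter fun h : A5 => Bad (h⁻¹ * c5 * h) g).card ≤ 20 := by
  obtain ⟨k, r, hr, rfl⟩ := classes g hg
  rw [card_conj_right]
  rcases hr with rfl | rfl | rfl | rfl
  exacts [cnt1e.le, cnt1_d3, cnt1_c, cnt1_cc]

theorem cnt2 (g : A5) (hg : g ≠ 1) :
    (Finset.univ.filter fun h : A5 => Bad (h⁻¹ * c5 ^ 2 * h) g).card ≤ 20 := by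
  obtain ⟨k, r, hr, rfl⟩ := classes g hg
  rw [card_conj_right]
  rcases hr with rfl | rfl | rfl | rfl
  exacts [cnt2e.le, cnt2_d3, cnt2_c, cnt2_cc]

theorem card_conj' (k s g : A5) :
    Nat.card {h : A5 // Subgroup.closure {h⁻¹ * (k⁻¹ * s * k) * h, g} ≠ ⊤} =
      Nat.card {h : A5 // Subgroup.closure {h⁻¹ * s * h, g} ≠ ⊤} := by
  refine Nat.card_congr (Equiv.subtypeEquiv (Equiv.mulLeft k) fun h => ?_)
  have : h⁻¹ * (k⁻¹ * s * k) * h = (Equiv.mulLeft k h)⁻¹ * s * (Equiv.mulLeft k h) := by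
    simp [mul_assoc]
  rw [this]

theorem many (s g : A5)
    (h : 20 < (Finset.univ.filter fun h : A5 =>
      ∃ p : Fin 5, (h⁻¹ * s * h).1 p = p ∧ g.1 p = p).card) :
    20 < Nat.card {h : A5 // Subgroup.closure {h⁻¹ * s * h, g} ≠ ⊤} := by
  refine lt_of_lt_of_le h ?_
  rw [← Fintype.card_subtype, ← Nat.card_eq_fintype_card]
  refine Nat.card_le_card_of_injective
    (Subtype.map id ?_) (Subtype.map_injective _ Function.injective_id)
  rintro a ⟨p, hp, hg⟩
  exact not_gen_of_fix p hp hg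

end S9

/-- `P(A₅) = 1/3` (`= 20/60`), attained exactly for `s` of order 5:
(i) for every `s` of order 5 and nonidentity `g`, at most `20 = |A₅|/3` elements
`h ∈ A₅` satisfy `⟨h⁻¹sh, g⟩ ≠ A₅`, with equality for some nonidentity `g`;
(ii) for every nonidentity `s` of order different from 5, some nonidentity `g`
gives strictly more than `20` such elements `h`. -/
theorem stmt_9 :
    (∀ s : A5, orderOf s = 5 →
      (∀ g : A5, g ≠ 1 →
        Nat.card {h : A5 // Subgroup.closure {h⁻¹ * s * h, g} ≠ ⊤} ≤ 20) ∧
      (∃ g : A5, g ≠ 1 ∧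
        Nat.card {h : A5 // Subgroup.closure {h⁻¹ * s * h, g} ≠ ⊤} = 20)) ∧
    (∀ s : A5, s ≠ 1 → orderOf s ≠ 5 →
      ∃ g : A5, g ≠ 1 ∧
        20 < Nat.card {h : A5 // Subgroup.closure {h⁻¹ * s * h, g} ≠ ⊤}) := by
  refine ⟨fun s hs => ?_, fun s hs1 hs => ?_⟩
  · have hx1 : s ≠ 1 := by rintro rfl; simp at hs
    have hx5 : s ^ 5 = 1 := orderOf_dvd_iff_pow_eq_one.mp hs.dvd
    obtain ⟨k, hk | hk⟩ := S9.conj5 s hx5 hx1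
    · refine ⟨fun g hg => ?_, S9.d2, S9.d2_ne, ?_⟩
      · rw [S9.card_eq s g hs, ← hk, S9.card_conj]; exact S9.cnt1 g hg
      · rw [S9.card_eq s _ hs, ← hk, S9.card_conj]; exact S9.cnt1e
    · refine ⟨fun g hg => ?_, S9.d2, S9.d2_ne, ?_⟩
      · rw [S9.card_eq s g hs, ← hk, S9.card_conj]; exact S9.cnt2 g hg
      · rw [S9.card_eq s _ hs, ← hk, S9.card_conj]; exact S9.cnt2e
  · have h5 : s ^ 5 ≠ 1 := fun h =>
      hs (haveI : Fact (Nat.Prime 5) := ⟨Nat.prime_five⟩; orderOf_eq_prime h hs1)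
    rcases S9.orders s hs1 with h | h | h
    · obtain ⟨k, hk⟩ := S9.cls2 s h hs1
      refine ⟨S9.d3, S9.d3_ne, ?_⟩
      rw [← S9.conj_of_eq hk, S9.card_conj']
      exact S9.many _ _ S9.fix2
    · obtain ⟨k, hk⟩ := S9.cls3 s h hs1
      refine ⟨S9.d2, S9.d2_ne, ?_⟩
      rw [← S9.conj_of_eq hk, S9.card_conj']
      exact S9.many _ _ S9.fix3
    · exact absurd h h5
end

section
/- Both the spread and the uniform spread of the alternating group A₆ equal two, with s of order 4. Precisely: (i) for all nonidentity elements x, y ∈ A₆ there exists s ∈ A₆ of order 4 such that ⟨x, s⟩ = A₆ and ⟨y, s⟩ = A₆; (ii) there exist nonidentity elements x₁, x₂, x₃ ∈ A₆ such that for every s ∈ A₆ there is some i with ⟨x_i, s⟩ ≠ A₆. -/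
/-- `A₆` viewed as a group in its own right. -/
abbrev A6 : Type := alternatingGroup (Fin 6)

namespace Spread

/-- The `i`-th octal digit. -/
def dig (n i : ℕ) : ℕ := Nat.mod (Nat.div n (Nat.pow 8 i)) 8

theorem dig_eq (n i : ℕ) : dig n i = n / 8 ^ i % 8 := rfl

def enc (a b c d e f : ℕ) : ℕ :=
  Nat.add a (Nat.mul 8 (Nat.add b (Nat.mul 8 (Nat.add c (Nat.mul 8 (Nat.add d
    (Nat.mul 8 (Nat.add e (Nat.mul 8 f)))))))))

theorem enc_eq (a b c d e f : ℕ) :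
    enc a b c d e f = a + 8 * (b + 8 * (c + 8 * (d + 8 * (e + 8 * f)))) := rfl

/-- Call by value, for kernel evaluation. -/
def force {α : Type} (n : ℕ) (f : ℕ → α) : α :=
  Nat.rec (f 0) (fun k _ => f (Nat.succ k)) n

theorem force_eq {α : Type} (n : ℕ) (f : ℕ → α) : force n f = f n := by
  cases n <;> rfl

/-- A permutation as an octal number. -/
def code (p : Equiv.Perm (Fin 6)) : ℕ :=
  enc (p 0) (p 1) (p 2) (p 3) (p 4) (p 5)

/-- Composition of codes. -/
def comp (m n : ℕ) : ℕ :=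
  enc (dig m (dig n 0)) (dig m (dig n 1)) (dig m (dig n 2)) (dig m (dig n 3))
    (dig m (dig n 4)) (dig m (dig n 5))

theorem dig_code (p : Equiv.Perm (Fin 6)) (i : Fin 6) : dig (code p) i = p i := by
  have h0 := (p 0).2
  have h1 := (p 1).2
  have h2 := (p 2).2
  have h3 := (p 3).2
  have h4 := (p 4).2
  have h5 := (p 5).2
  fin_cases i <;> simp [dig_eq, code, enc_eq] <;> omega

theorem code_inj {p q : Equiv.Perm (Fin 6)} (h : code p = code q) : p = q := by
  ext i
  rw [← dig_code, ← dig_code, h]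

theorem code_mul (p q : Equiv.Perm (Fin 6)) : code (p * q) = comp (code p) (code q) := by
  have h (i : Fin 6) : dig (code p) (dig (code q) i) = (p (q i) : ℕ) := by
    rw [dig_code, dig_code]
  have h0 := h 0
  have h1 := h 1
  have h2 := h 2
  have h3 := h 3
  have h4 := h 4
  have h5 := h 5
  simp only [Fin.val_zero, Fin.val_one, Fin.val_two] at h0 h1 h2
  change _ = _ at h3
  unfold comp
  rw [h0, h1, h2, show dig (code p) (dig (code q) 3) = (p (q 3) : ℕ) from h3,
    show dig (code p) (dig (code q) 4) = (p (q 4) : ℕ) from h4,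
    show dig (code p) (dig (code q) 5) = (p (q 5) : ℕ) from h5]
  rfl

/-- Evaluate a word, encoded in binary, on codes `x` and `s`. -/
def evalW (x s : ℕ) : ℕ → ℕ → ℕ
  | 0, _ => 181896
  | k + 1, n => cond (Nat.ble n 1) 181896
      (force (evalW x s k (Nat.div n 2)) fun r =>
        comp (cond (Nat.beq (Nat.mod n 2) 1) x s) r)

/-- Does the permutation with code `c` preserve the colouring `f`? -/
def pres (f c : ℕ) : Bool :=
  [0, 1, 2, 3, 4, 5].all fun i => [0, 1, 2, 3, 4, 5].all fun j =>
    cond (Nat.beq (dig f i) (dig f j)) (Nat.beq (dig f (dig c i)) (dig f (dig c j)))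
      (!Nat.beq (dig f (dig c i)) (dig f (dig c j)))

/-- Decides (by a perfect hash) whether the even permutation with code `c` lies in none
of the four maximal subgroups above `s0`. -/
def good (c : ℕ) : Bool :=
  Nat.beq (Nat.land (Nat.shiftRight
    441350996368987283632538611020717753359799372898542239821846832902585146801005888115994035933573001350296257151574547501759084570816469871211840780213243958996366587751502600500960758689494560141235390114844241306748725825764912395786342481965081251746771502968457755961692349415348878890697318777716406189835856386831411600478468204930927012515540736194289815004303571642583272593877130033176624466676614460771730808211051109493089535032444799082083646854161737769303741557292151396446274877389824373095390372632880847921429704224373099449258547746024989367126692315859243025792560851210388952115945065859342038126212297958717231440351573024083937778849300744953969597906809226377513596321754366319575562215459275779610114398216088811485153094958998054055749475216482003912680015143124019080243481394622256403172785850690150649436237707028405286620516818354240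
    (Nat.mod c 2881)) 1) 0

/-- Words (in binary) giving coset representatives of a stabiliser chain. -/
def cosetWords : List (List ℕ) := [[30, 3, 7, 15, 2, 1], [62, 5, 55, 21, 1], [155, 4, 847, 1], [205, 605, 1]]

/-- The values of these words on `x0`, `s0`. -/
def reps1 : List ℕ := [13609, 55504, 72472, 107360, 151761, 181896]
def reps2 : List ℕ := [165537, 168218, 173580, 177220, 181896]
def reps3 : List ℕ := [180426, 180762, 181336, 181896]
def reps4 : List ℕ := [181777, 181826, 181896]

def midCodes : List ℕ := [21771, 137859, 119904, 144488, 132945, 86220, 87620, 143529, 137936, 118945, 22289, 55504,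
    139469, 140869, 55427, 132427]

def words1 : List ℕ := [3, 1939, 1831, 980, 1960, 1837, 245, 237, 1617, 1577]

def words2 : List ℕ := [3, 25, 31, 40, 36, 52, 34, 37, 116, 108, 90, 86, 1948, 2012, 1980, 1502]

/-- Words for the conjugating elements. -/
def conjWords : List ℕ := [37, 919, 118, 211, 45, 724, 1105, 439, 237, 407, 54, 951, 52, 167, 367, 15, 229, 21, 593,
    119, 312, 338, 470, 198, 19]

/-- Conjugating elements with their inverses. -/
def conjCodes : List (ℕ × ℕ) := [(120968, 146056), (146056, 120968), (152776, 152776), (109320, 109320), (116040, 84680),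
    (80200, 80200), (178256, 178256), (119568, 141912), (169744, 173664), (119904, 137936),
    (173664, 169744), (80480, 104784), (54944, 136872), (105120, 105120), (43744, 103720),
    (107360, 72472), (71520, 71520), (177220, 166097), (119428, 133785), (54468, 132329),
    (72388, 99681), (78660, 67929), (103748, 68321), (42820, 67369), (71212, 34658)]

/-- The maximal bad sets, as bit masks. -/
def masks : List ℕ := [274887, 409480, 614611, 1244235, 1864112, 3213817, 3383261, 4058491, 4850644, 5617556,
    6028025, 6267479, 7242337, 7711552, 8650427, 8755892, 9305582, 10474703, 10669189,
    11290661, 12147014, 13309514, 13755536, 15007463, 15367751, 15628695, 15933290, 16167915,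
    16565433, 16649981, 16683161, 16738804, 17213715, 17368302, 17398307, 18710578, 18990876,
    19397565, 19481599, 20082399, 20122944, 20806593, 20895293, 20941159, 20981247, 21903340,
    22015850, 22702656, 22768882, 23002889, 23094012, 26156590, 26647039, 26672594, 26859446,
    27032375, 27417118, 29633836, 31830400, 31952165, 32178466, 32229313, 32355059, 32364254,
    32436124, 32603999, 32632300, 32748827, 32893500, 33182590, 33290287, 33371579, 33528786]

/-- Colourings of the six points. -/
def cols : List ℕ := [1, 8, 64, 512, 4096, 32768, 37376, 36928, 33344, 4672, 36872, 584, 74304, 70720, 42048,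
    74248, 73800, 33928, 5256]

def s0c : ℕ := 151761
def x0c : ℕ := 55504

/-- The codes of all even permutations. -/
def evens : List ℕ :=
  reps1.flatMap fun a => reps2.flatMap fun b => reps3.flatMap fun c => reps4.map fun d =>
    comp (comp (comp a b) c) d

/-- Is `y` the code of an even permutation? (Sifting through the stabiliser chain.) -/
def sift (y : ℕ) : Bool :=
  reps1.any fun a => Nat.beq (dig a 5) (dig y 5) && reps2.any fun b =>
    Nat.beq (dig a (dig b 4)) (dig y 4) && force (comp a b) fun ab => reps3.any fun c =>
      Nat.beq (dig ab (dig c 3)) (dig y 3) && force (comp ab c) fun abc => reps4.any fun d =>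
        Nat.beq (comp abc d) y

/-- Binary number with given digits. -/
def encB : List Bool → ℕ
  | [] => 0
  | b :: l => Nat.add (cond b 1 0) (Nat.mul 2 (encB l))

/-- The set of conjugates of `s0` which fail for `x`. -/
def row (x : ℕ) : List Bool :=
  conjCodes.map fun g => !good (comp g.1 (comp x g.2))

/-- Code of the inverse. -/
def invCode (c : ℕ) : ℕ :=
  8 ^ dig c 1 + 8 ^ dig c 2 * 2 + 8 ^ dig c 3 * 3 + 8 ^ dig c 4 * 4 + 8 ^ dig c 5 * 5

theorem check_sift : ∀ p : Equiv.Perm (Fin 6), Equiv.Perm.sign p = 1 → force (code p) sift = true := by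
  decide +kernel

theorem check_reps :
    [reps1, reps2, reps3, reps4] = cosetWords.map (fun l => l.map (evalW x0c s0c 12)) := by
  decide +kernel

theorem check_conj : conjCodes.map Prod.fst = conjWords.map (evalW x0c s0c 12) := by
  decide +kernel

theorem check_conj_inv : (conjCodes.all fun g => Nat.beq (invCode g.1) g.2) = true := by
  decide +kernel

theorem check_words1 : (evens.all fun x => force x fun x => !good x ||
    words1.any fun w => force (evalW x s0c 12 w) fun c => midCodes.any (Nat.beq c)) = true := by
  decide +kernel

theorem check_words2 : (midCodes.all fun x =>
    words2.any fun w => Nat.beq (evalW x s0c 12 w) x0c) = true := by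
  decide +kernel

theorem check_rows : (evens.all fun x => force x fun x => Nat.beq x 181896 ||
    force (encB (row x)) fun r => masks.any fun m => Nat.beq (Nat.lor m r) m) = true := by
  decide +kernel

theorem check_masks : (masks.all fun m => masks.all fun n => !Nat.beq (Nat.lor m n) 33554431) = true := by
  decide +kernel

theorem check_cols : (evens.all fun s => force s fun s => cols.any fun f => pres f s &&
    (pres f 181441 || pres f 152776 || pres f 153217)) = true := by
  decide +kernel

/-! ### Soundness -/

theorem code_one : code 1 = 181896 := by rfl

def s0 : A6 := ⟨⟨![1, 2, 3, 0, 5, 4], ![3, 0, 1, 2, 5, 4], by decide, by decide⟩,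
  Equiv.Perm.mem_alternatingGroup.2 (by decide)⟩

def x0 : A6 := ⟨⟨![0, 2, 3, 4, 5, 1], ![0, 5, 1, 2, 3, 4], by decide, by decide⟩,
  Equiv.Perm.mem_alternatingGroup.2 (by decide)⟩

theorem code_s0 : code s0.1 = s0c := by decide

theorem code_x0 : code x0.1 = x0c := by decide

/-- `c` is the code of an element of `H`. -/
def InH (H : Subgroup A6) (c : ℕ) : Prop := ∃ h ∈ H, code h.1 = c

theorem InH.comp {H : Subgroup A6} {a b : ℕ} (ha : InH H a) (hb : InH H b) :
    InH H (comp a b) := by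
  obtain ⟨g, hg, rfl⟩ := ha
  obtain ⟨h, hh, rfl⟩ := hb
  exact ⟨g * h, H.mul_mem hg hh, code_mul _ _⟩

theorem InH.evalW {H : Subgroup A6} {x s : ℕ} (hx : InH H x) (hs : InH H s) (k n : ℕ) :
    InH H (evalW x s k n) := by
  induction k generalizing n with
  | zero => exact ⟨1, H.one_mem, code_one⟩
  | succ k ih =>
    rw [Spread.evalW, force_eq]
    cases Nat.ble n 1 with
    | true => exact ⟨1, H.one_mem, code_one⟩
    | false =>
      refine InH.comp ?_ (ih _)
      cases Nat.beq (Nat.mod n 2) 1 with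
      | true => exact hx
      | false => exact hs

theorem sift_mem {y : ℕ} (h : sift y = true) : ∃ a ∈ reps1, ∃ b ∈ reps2, ∃ c ∈ reps3,
    ∃ d ∈ reps4, comp (comp (comp a b) c) d = y := by
  simp only [sift, force_eq, List.any_eq_true, Bool.and_eq_true, Nat.beq_eq] at h
  obtain ⟨a, ha, -, b, hb, -, c, hc, -, d, hd, e⟩ := h
  exact ⟨a, ha, b, hb, c, hc, d, hd, e⟩

theorem code_sift (y : A6) : sift (code y.1) = true := by
  have := check_sift y.1 y.2
  rwa [force_eq] at this

theorem code_mem (y : A6) : code y.1 ∈ evens := by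
  obtain ⟨a, ha, b, hb, c, hc, d, hd, e⟩ := sift_mem (code_sift y)
  simp only [evens, List.mem_flatMap, List.mem_map]
  exact ⟨a, ha, b, hb, c, hc, d, hd, e⟩

theorem InH.top {H : Subgroup A6} (hx : InH H x0c) (hs : InH H s0c) : H = ⊤ := by
  have key : ∀ l ∈ [reps1, reps2, reps3, reps4], ∀ a ∈ l, InH H a := by
    rw [check_reps]
    intro l hl a ha
    obtain ⟨l', -, rfl⟩ := List.mem_map.1 hl
    obtain ⟨w, -, rfl⟩ := List.mem_map.1 ha
    exact hx.evalW hs _ _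
  rw [Subgroup.eq_top_iff']
  intro y
  obtain ⟨a, ha, b, hb, c, hc, d, hd, e⟩ := sift_mem (code_sift y)
  have : InH H (code y.1) := by
    rw [← e]
    exact (((key _ (by simp) _ ha).comp (key _ (by simp) _ hb)).comp
      (key _ (by simp) _ hc)).comp (key _ (by simp) _ hd)
  obtain ⟨h, hh, e⟩ := this
  rwa [← Subtype.ext (code_inj e)]

theorem good_top (x : A6) (hx : good (code x.1) = true) : Subgroup.closure {x, s0} = ⊤ := by
  have h1 := List.all_eq_true.1 check_words1 _ (code_mem x)
  simp only [force_eq, hx, Bool.not_true, Bool.false_or, List.any_eq_true, Nat.beq_eq] at h1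
  obtain ⟨w, -, m, hm, e⟩ := h1
  have h2 := List.all_eq_true.1 check_words2 _ hm
  simp only [List.any_eq_true, Nat.beq_eq] at h2
  obtain ⟨w', -, e'⟩ := h2
  have hs : InH (Subgroup.closure {x, s0}) s0c :=
    ⟨s0, Subgroup.subset_closure (by simp), code_s0⟩
  have hx' : InH (Subgroup.closure {x, s0}) (code x.1) :=
    ⟨x, Subgroup.subset_closure (by simp), rfl⟩
  refine InH.top ?_ hs
  rw [← e']
  refine InH.evalW ?_ hs _ _
  rw [← e]
  exact hx'.evalW hs _ _

theorem order_s0 : orderOf s0 = 4 := by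
  have : orderOf s0 = 2 ^ (1 + 1) := by
    apply orderOf_eq_prime_pow <;> decide
  simpa using this

theorem conj_top (g x : A6) (h : Subgroup.closure {g * x * g⁻¹, s0} = ⊤) :
    Subgroup.closure {x, g⁻¹ * s0 * g} = ⊤ := by
  have h2 := congrArg (Subgroup.map (MulAut.conj g⁻¹).toMonoidHom) h
  rw [MonoidHom.map_closure, Set.image_pair,
    Subgroup.map_top_of_surjective _ (MulAut.conj g⁻¹).surjective] at h2
  convert h2 using 3 <;> simp [mul_assoc]

theorem code_inv (p : Equiv.Perm (Fin 6)) : code p⁻¹ = invCode (code p) := by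
  have h (p : Equiv.Perm (Fin 6)) : code p = ∑ i : Fin 6, 8 ^ (i : ℕ) * (p i : ℕ) := by
    simp only [code, enc_eq, Fin.sum_univ_six]
    simp
    ring
  rw [h, ← Equiv.sum_comp p]
  have e (i : Fin 6) : p⁻¹ (p i) = i := by simp
  simp only [e, Fin.sum_univ_six, ← dig_code p]
  simp [invCode]

theorem conj_exists {g : ℕ × ℕ} (hg : g ∈ conjCodes) :
    ∃ h : A6, code h.1 = g.1 ∧ code (h⁻¹).1 = g.2 := by
  have top (c : ℕ) (hc : c ∈ conjCodes.map Prod.fst) : ∃ h : A6, code h.1 = c := by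
    rw [check_conj] at hc
    obtain ⟨w, -, rfl⟩ := List.mem_map.1 hc
    obtain ⟨h, -, e⟩ := InH.evalW (H := ⊤) ⟨x0, trivial, code_x0⟩ ⟨s0, trivial, code_s0⟩ 12 w
    exact ⟨h, e⟩
  obtain ⟨h, e⟩ := top g.1 (List.mem_map_of_mem hg)
  have hinv := List.all_eq_true.1 check_conj_inv _ hg
  refine ⟨h, e, ?_⟩
  change code (h.1)⁻¹ = g.2
  rw [code_inv, e]
  simpa using hinv

theorem encB_testBit (l : List Bool) (i : ℕ) : (encB l).testBit i = l.getD i false := by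
  induction l generalizing i with
  | nil => simp [encB]
  | cons b l ih =>
    have e : encB (b :: l) = Nat.bit b (encB l) := by
      cases b <;> simp [encB, Nat.bit, Nat.add_comm]
    rw [e]
    cases i with
    | zero => simp
    | succ i => simp [Nat.testBit_bit_succ, ih]

theorem row_mask (x : A6) (hx : x ≠ 1) : ∃ m ∈ masks, m ||| encB (row (code x.1)) = m := by
  have h := List.all_eq_true.1 check_rows _ (code_mem x)
  simp only [force_eq, Bool.or_eq_true, List.any_eq_true, Nat.beq_eq] at h
  rcases h with h | h
  · exact absurd (Subtype.ext (code_inj (h.trans code_one.symm))) hx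
  · exact h

theorem good_of_bit {x : A6} {m i : ℕ} (hi : i < conjCodes.length)
    (hm : m ||| encB (row (code x.1)) = m) (hb : m.testBit i = false) :
    good (comp conjCodes[i].1 (comp (code x.1) conjCodes[i].2)) = true := by
  rw [← hm, Nat.testBit_or, encB_testBit] at hb
  simp only [Bool.or_eq_false_iff] at hb
  have := hb.2
  rw [List.getD_eq_getElem _ _ (by simpa [row] using hi)] at this
  simpa [row] using this

theorem part1 (x y : A6) (hx : x ≠ 1) (hy : y ≠ 1) : ∃ s : A6, orderOf s = 4 ∧
    Subgroup.closure {x, s} = ⊤ ∧ Subgroup.closure {y, s} = ⊤ := by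
  obtain ⟨m, hm, em⟩ := row_mask x hx
  obtain ⟨n, hn, en⟩ := row_mask y hy
  have hmn := List.all_eq_true.1 (List.all_eq_true.1 check_masks _ hm) _ hn
  have hlt : ∀ k ∈ masks, k < 2 ^ 25 := by decide
  have hmn' : m ||| n ≠ 33554431 := by
    intro h
    change (!Nat.beq (m ||| n) 33554431) = true at hmn
    rw [h] at hmn
    exact absurd hmn (by decide)
  have : ∃ i < 25, (m ||| n).testBit i = false := by
    by_contra! hc
    apply hmn'
    apply Nat.eq_of_testBit_eq
    intro i
    rw [show (33554431 : ℕ) = 2 ^ 25 - 1 by norm_num, Nat.testBit_two_pow_sub_one]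
    by_cases hi : i < 25
    · simpa only [hi, decide_true, Bool.not_eq_false] using hc i hi
    · simp only [hi, decide_false]
      exact Nat.testBit_lt_two_pow (lt_of_lt_of_le (Nat.or_lt_two_pow (hlt m hm) (hlt n hn))
        (Nat.pow_le_pow_right (by norm_num) (by omega)))
  obtain ⟨i, hi, hb⟩ := this
  rw [Nat.testBit_or, Bool.or_eq_false_iff] at hb
  have hi' : i < conjCodes.length := hi
  obtain ⟨g, hg, hg'⟩ := conj_exists (List.getElem_mem hi')
  refine ⟨g⁻¹ * s0 * g, ?_, ?_, ?_⟩
  · rw [← order_s0]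
    simpa using orderOf_injective (MulAut.conj g⁻¹).toMonoidHom (MulAut.conj g⁻¹).injective s0
  · apply conj_top
    apply good_top
    have := good_of_bit hi' em hb.1
    rwa [← hg, ← hg', ← code_mul, ← code_mul, ← mul_assoc] at this
  · apply conj_top
    apply good_top
    have := good_of_bit hi' en hb.2
    rwa [← hg, ← hg', ← code_mul, ← code_mul, ← mul_assoc] at this

/-- The subgroup preserving the partition into colour classes. -/
def presGroup (f : ℕ) : Subgroup A6 where
  carrier := {p | ∀ i j : Fin 6, dig f (p.1 i) = dig f (p.1 j) ↔ dig f i = dig f j}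
  one_mem' := by simp
  mul_mem' := by
    intro a b ha hb i j
    exact (ha (b.1 i) (b.1 j)).trans (hb i j)
  inv_mem' := by
    intro a ha i j
    have := ha (a.1⁻¹ i) (a.1⁻¹ j)
    simpa using this.symm

theorem pres_iff (f : ℕ) (p : A6) : pres f (code p.1) = true ↔ p ∈ presGroup f := by
  have h1 : pres f (code p.1) = true ↔ ∀ i : Fin 6, ∀ j : Fin 6,
      (cond (Nat.beq (dig f i) (dig f j))
        (Nat.beq (dig f (dig (code p.1) i)) (dig f (dig (code p.1) j)))
        (!Nat.beq (dig f (dig (code p.1) i)) (dig f (dig (code p.1) j)))) = true := by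
    simp only [pres, Fin.forall_fin_succ, List.all_cons, List.all_nil, Bool.and_eq_true]
    simp
  rw [h1]
  change _ ↔ ∀ i j : Fin 6, dig f (p.1 i) = dig f (p.1 j) ↔ dig f i = dig f j
  refine forall_congr' fun i => forall_congr' fun j => ?_
  rw [dig_code, dig_code]
  by_cases h : dig f i = dig f j
  · simp [h]
  · have h' : Nat.beq (dig f i) (dig f j) = false := by
      rw [Bool.eq_false_iff]; simpa using h
    rw [h']
    simp [h, ← Bool.not_eq_true]

def x1 : A6 := ⟨⟨![1, 0, 3, 2, 4, 5], ![1, 0, 3, 2, 4, 5], by decide, by decide⟩,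
  Equiv.Perm.mem_alternatingGroup.2 (by decide)⟩
def x2 : A6 := ⟨⟨![0, 1, 3, 2, 5, 4], ![0, 1, 3, 2, 5, 4], by decide, by decide⟩,
  Equiv.Perm.mem_alternatingGroup.2 (by decide)⟩
def x3 : A6 := ⟨⟨![1, 0, 2, 3, 5, 4], ![1, 0, 2, 3, 5, 4], by decide, by decide⟩,
  Equiv.Perm.mem_alternatingGroup.2 (by decide)⟩

theorem check_proper : (cols.all fun f => !(pres f s0c && pres f x0c)) = true := by
  decide +kernel

theorem presGroup_ne_top {f : ℕ} (hf : f ∈ cols) : presGroup f ≠ ⊤ := by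
  intro h
  have h0 := List.all_eq_true.1 check_proper _ hf
  have h1 : pres f s0c = true := by rw [← code_s0, pres_iff, h]; trivial
  have h2 : pres f x0c = true := by rw [← code_x0, pres_iff, h]; trivial
  rw [h1, h2] at h0
  exact absurd h0 (by decide)

theorem closure_ne_top {f : ℕ} (hf : f ∈ cols) {x s : A6} (hx : pres f (code x.1) = true)
    (hs : pres f (code s.1) = true) : Subgroup.closure {x, s} ≠ ⊤ := by
  intro h
  apply presGroup_ne_top hf
  rw [eq_top_iff, ← h, Subgroup.closure_le]
  rintro y (rfl | rfl)
  · exact (pres_iff _ _).1 hx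
  · exact (pres_iff _ _).1 hs

theorem part2 (s : A6) : Subgroup.closure {x1, s} ≠ ⊤ ∨
    Subgroup.closure {x2, s} ≠ ⊤ ∨ Subgroup.closure {x3, s} ≠ ⊤ := by
  have h := List.all_eq_true.1 check_cols _ (code_mem s)
  simp only [force_eq, List.any_eq_true, Bool.and_eq_true, Bool.or_eq_true] at h
  obtain ⟨f, hf, hs, (hx | hx) | hx⟩ := h
  · exact Or.inl (closure_ne_top hf hx hs)
  · exact Or.inr (Or.inl (closure_ne_top hf hx hs))
  · exact Or.inr (Or.inr (closure_ne_top hf hx hs))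

end Spread

/-- Both the spread and the uniform spread of `A₆` equal two, with `s` of order 4:
(i) for all nonidentity `x, y ∈ A₆` there is `s` of order 4 generating `A₆` with each
of `x` and `y`; (ii) there are nonidentity `x₁, x₂, x₃ ∈ A₆` such that no `s ∈ A₆`
generates `A₆` with all three. -/
theorem stmt_11 :
    (∀ x y : A6, x ≠ 1 → y ≠ 1 →
      ∃ s : A6, orderOf s = 4 ∧
        Subgroup.closure {x, s} = ⊤ ∧ Subgroup.closure {y, s} = ⊤) ∧
    (∃ x₁ x₂ x₃ : A6, x₁ ≠ 1 ∧ x₂ ≠ 1 ∧ x₃ ≠ 1 ∧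
      ∀ s : A6, Subgroup.closure {x₁, s} ≠ ⊤ ∨
        Subgroup.closure {x₂, s} ≠ ⊤ ∨ Subgroup.closure {x₃, s} ≠ ⊤) := by
  exact ⟨Spread.part1, Spread.x1, Spread.x2, Spread.x3, by decide, by decide, by decide,
    Spread.part2⟩
end

section
/- For any two nonidentity elements x, y of the symmetric group S₆ on six points, there exists an element s ∈ S₆ such that the alternating group A₆ is contained in both ⟨x, s⟩ and ⟨y, s⟩. -/
namespace S6

open Equiv

/-- Digit `i` of a permutation code (base 8). -/
def ap (p i : ℕ) : ℕ := p / 8 ^ i % 8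

/-- Product of permutation codes. -/
def mu (p q : ℕ) : ℕ :=
  ap p (ap q 0) + 8 * ap p (ap q 1) + 64 * ap p (ap q 2) + 512 * ap p (ap q 3)
    + 4096 * ap p (ap q 4) + 32768 * ap p (ap q 5)

/-- Code of the identity. -/
def idc : ℕ := 181896

/-- Code of a permutation. -/
def enc (σ : Perm (Fin 6)) : ℕ :=
  (σ 0 : ℕ) + 8 * (σ 1 : ℕ) + 64 * (σ 2 : ℕ) + 512 * (σ 3 : ℕ)
    + 4096 * (σ 4 : ℕ) + 32768 * (σ 5 : ℕ)

lemma ap_enc (σ : Perm (Fin 6)) (i : Fin 6) : ap (enc σ) i = σ i := by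
  have h0 := (σ 0).2
  have h1 := (σ 1).2
  have h2 := (σ 2).2
  have h3 := (σ 3).2
  have h4 := (σ 4).2
  have h5 := (σ 5).2
  fin_cases i <;> simp [ap, enc] <;> omega

lemma enc_inj {σ τ : Perm (Fin 6)} (h : enc σ = enc τ) : σ = τ := by
  ext i
  rw [← ap_enc, h, ap_enc]

lemma mu_enc (σ τ : Perm (Fin 6)) : mu (enc σ) (enc τ) = enc (σ * τ) := by
  have h0 := ap_enc τ 0
  have h1 := ap_enc τ 1
  have h2 := ap_enc τ 2
  have h3 := ap_enc τ 3
  have h4 := ap_enc τ 4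
  have h5 := ap_enc τ 5
  simp only [Fin.val_zero, Fin.val_one] at h0 h1
  change ap (enc τ) 2 = _ at h2
  change ap (enc τ) 3 = _ at h3
  change ap (enc τ) 4 = _ at h4
  change ap (enc τ) 5 = _ at h5
  rw [mu, h0, h1, h2, h3, h4, h5]
  simp only [ap_enc]
  simp only [enc, Perm.mul_apply]

lemma enc_one : enc 1 = idc := by simp [enc, idc]

/-- `g` and `gi` are mutually inverse permutation codes. -/
def okPair (g gi : ℕ) : Prop :=
  (∀ i : Fin 6, ap g i < 6 ∧ ap gi i < 6 ∧ ap gi (ap g i) = i ∧ ap g (ap gi i) = i) ∧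
    mu g idc = g ∧ mu gi idc = gi

instance (g gi : ℕ) : Decidable (okPair g gi) := by unfold okPair; infer_instance

lemma okPair.exists {g gi : ℕ} (h : okPair g gi) :
    ∃ γ : Perm (Fin 6), enc γ = g ∧ enc γ⁻¹ = gi := by
  obtain ⟨h1, h2, h3⟩ := h
  refine ⟨⟨fun i => ⟨ap g i, (h1 i).1⟩, fun i => ⟨ap gi i, (h1 i).2.1⟩,
    fun i => Fin.ext (h1 i).2.2.1, fun i => Fin.ext (h1 i).2.2.2⟩, ?_, ?_⟩
  · exact Eq.trans rfl h2
  · exact Eq.trans rfl h3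

/-- Membership test. -/
def mem (n : ℕ) : List ℕ → Bool
  | [] => false
  | a :: l => Nat.beq n a || mem n l

lemma mem_iff (n : ℕ) (l : List ℕ) : mem n l = true ↔ n ∈ l := by
  induction l with
  | nil => simp [mem]
  | cons a l ih => simp [mem, ih]

/-- Check a list element by element, each against the previous ones. -/
def chain (f : List ℕ → ℕ → Bool) : List ℕ → List ℕ → Bool
  | _, [] => true
  | acc, x :: xs => f acc x && chain f (x :: acc) xs

lemma chain_sound (f : List ℕ → ℕ → Bool) (Q : ℕ → Prop)
    (hf : ∀ acc x, (∀ a ∈ acc, Q a) → f acc x = true → Q x) (xs : List ℕ) :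
    ∀ acc, (∀ a ∈ acc, Q a) → chain f acc xs = true → ∀ x ∈ xs, Q x := by
  induction xs with
  | nil => simp
  | cons x xs ih =>
    intro acc hacc hc y hy
    simp only [chain, Bool.and_eq_true] at hc
    have hx := hf acc x hacc hc.1
    rcases List.mem_cons.1 hy with rfl | hy
    · exact hx
    · refine ih (x :: acc) ?_ hc.2 y hy
      intro a ha
      rcases List.mem_cons.1 ha with rfl | ha
      · exact hx
      · exact hacc a ha

/-- Value of a word in two codes. -/
def ev (x s : ℕ) : List Bool → ℕ
  | [] => idc
  | b :: w => mu (bif b then x else s) (ev x s w)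

lemma ev_mem (x s : Perm (Fin 6)) (w : List Bool) :
    ∃ z ∈ Subgroup.closure {x, s}, enc z = ev (enc x) (enc s) w := by
  induction w with
  | nil => exact ⟨1, one_mem _, enc_one⟩
  | cons b w ih =>
    obtain ⟨z, hz, e⟩ := ih
    cases b
    · exact ⟨s * z, mul_mem (Subgroup.subset_closure (by simp)) hz, by
        simp [ev, ← e, mu_enc]⟩
    · exact ⟨x * z, mul_mem (Subgroup.subset_closure (by simp)) hz, by
        simp [ev, ← e, mu_enc]⟩

/-- Codes whose permutation generates a group containing `A₆` together with that of code `s`. -/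
def Good (s n : ℕ) : Prop :=
  ∀ x σ : Perm (Fin 6), enc x = n → enc σ = s →
    alternatingGroup (Fin 6) ≤ Subgroup.closure {x, σ}

def gtest (s : ℕ) (ws : List (List Bool)) (acc : List ℕ) (x : ℕ) : Bool :=
  ws.any fun w => mem (ev x s w) acc

lemma gtest_sound (s : ℕ) (ws : List (List Bool)) (acc : List ℕ) (x : ℕ)
    (hacc : ∀ a ∈ acc, Good s a) (h : gtest s ws acc x = true) : Good s x := by
  rintro y σ rfl rfl
  simp only [gtest, List.any_eq_true, mem_iff] at h
  obtain ⟨w, -, hw⟩ := h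
  obtain ⟨z, hz, e⟩ := ev_mem y σ w
  refine (hacc _ hw z σ e rfl).trans ?_
  rw [Subgroup.closure_le]
  rintro u (rfl | rfl)
  · exact hz
  · exact Subgroup.subset_closure (by simp)

/-- Enumeration of all permutation codes. -/
def digs : List ℕ := [0, 1, 2, 3, 4, 5]

def allCodes (f : ℕ → Bool) : Bool :=
  digs.all fun a => digs.all fun b => Nat.beq a b || digs.all fun c =>
    (Nat.beq a c || Nat.beq b c) || digs.all fun d =>
    (Nat.beq a d || Nat.beq b d || Nat.beq c d) || digs.all fun e =>
    (Nat.beq a e || Nat.beq b e || Nat.beq c e || Nat.beq d e) || digs.all fun g =>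
    (Nat.beq a g || Nat.beq b g || Nat.beq c g || Nat.beq d g || Nat.beq e g) ||
      f (a + 8 * b + 64 * c + 512 * d + 4096 * e + 32768 * g)

lemma mem_digs (i : Fin 6) : (i : ℕ) ∈ digs := by
  fin_cases i <;> simp [digs]

lemma allCodes_sound {f : ℕ → Bool} (h : allCodes f = true) (σ : Perm (Fin 6)) :
    f (enc σ) = true := by
  have ne : ∀ i j : Fin 6, i ≠ j → (σ i : ℕ) ≠ σ j := fun i j hij e =>
    hij (σ.injective (Fin.ext e))
  simp only [allCodes, List.all_eq_true, Bool.or_eq_true, Nat.beq_eq] at h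
  have h0 := h _ (mem_digs (σ 0)) _ (mem_digs (σ 1))
  have h1 := (h0.resolve_left (ne 0 1 (by decide))) _ (mem_digs (σ 2))
  have h2 := (h1.resolve_left (by
    simp [ne 0 2 (by decide), ne 1 2 (by decide)])) _ (mem_digs (σ 3))
  have h3 := (h2.resolve_left (by
    simp [ne 0 3 (by decide), ne 1 3 (by decide), ne 2 3 (by decide)])) _ (mem_digs (σ 4))
  have h4 := (h3.resolve_left (by
    simp [ne 0 4 (by decide), ne 1 4 (by decide), ne 2 4 (by decide),
      ne 3 4 (by decide)])) _ (mem_digs (σ 5))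
  exact h4.resolve_left (by
    simp [ne 0 5 (by decide), ne 1 5 (by decide), ne 2 5 (by decide),
      ne 3 5 (by decide), ne 4 5 (by decide)])

/-- Number of moved points. -/
def mv (n i : ℕ) : ℕ := bif Nat.beq (ap n i) i then 0 else 1

def cnt (n : ℕ) : ℕ := mv n 0 + mv n 1 + mv n 2 + mv n 3 + mv n 4 + mv n 5

lemma mv_enc (σ : Perm (Fin 6)) (i : Fin 6) : mv (enc σ) i = if σ i ≠ i then 1 else 0 := by
  rw [mv, ap_enc]
  by_cases h : σ i = i
  · simp [h]
  · have h' : ((σ i : ℕ)) ≠ i := fun e => h (Fin.ext e)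
    have : Nat.beq (σ i : ℕ) i = false := by
      rw [← Bool.not_eq_true, Nat.beq_eq]; exact h'
    simp [h, this]

lemma cnt_enc (σ : Perm (Fin 6)) : cnt (enc σ) = σ.support.card := by
  have : σ.support = Finset.univ.filter fun i => σ i ≠ i := by ext; simp
  rw [this, Finset.card_filter, Fin.sum_univ_six, ← mv_enc, ← mv_enc, ← mv_enc, ← mv_enc,
    ← mv_enc, ← mv_enc]
  rfl

/-- If a subgroup contains all codes in a list containing all 3-cycles, it contains `A₆`. -/
lemma alt_le (H : Subgroup (Perm (Fin 6))) (T : List ℕ)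
    (hT : allCodes (fun n => !(Nat.beq (cnt n) 3) || mem n T) = true)
    (h : ∀ n ∈ T, ∀ σ, enc σ = n → σ ∈ H) : alternatingGroup (Fin 6) ≤ H := by
  rw [← Perm.closure_three_cycles_eq_alternating, Subgroup.closure_le]
  intro σ hσ
  have h3 : σ.support.card = 3 := Perm.IsThreeCycle.card_support hσ
  have := allCodes_sound hT σ
  rw [cnt_enc, h3] at this
  replace this : mem (enc σ) T = true := by simpa using this
  rw [mem_iff] at this
  exact h _ this σ rfl

def ctest (c ci t ti : ℕ) (acc : List ℕ) (x : ℕ) : Bool :=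
  mem (mu (mu ci x) c) acc || mem (mu (mu ti x) t) acc

lemma base_good (s si t ti : ℕ) (T : List ℕ) (hs : okPair s si) (ht : okPair t ti)
    (hc : chain (ctest s si t ti) [t, ti] T = true)
    (hT : allCodes (fun n => !(Nat.beq (cnt n) 3) || mem n (t :: ti :: T)) = true) :
    Good s t := by
  rintro τ σ hτ hσ
  obtain ⟨τ', e1, e2⟩ := ht.exists
  obtain ⟨σ', e3, e4⟩ := hs.exists
  obtain rfl : τ' = τ := enc_inj (e1.trans hτ.symm)
  obtain rfl : σ' = σ := enc_inj (e3.trans hσ.symm)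
  set H := Subgroup.closure {τ', σ'} with hH
  have mt : τ' ∈ H := Subgroup.subset_closure (by simp)
  have ms : σ' ∈ H := Subgroup.subset_closure (by simp)
  have hacc : ∀ a ∈ [t, ti], ∀ ρ, enc ρ = a → ρ ∈ H := by
    intro a ha ρ hρ
    simp only [List.mem_cons, List.not_mem_nil, or_false] at ha
    rcases ha with rfl | rfl
    · rw [enc_inj (hρ.trans e1.symm)]; exact mt
    · rw [enc_inj (hρ.trans e2.symm)]; exact inv_mem mt
  have key := chain_sound (ctest s si t ti) (fun n => ∀ ρ, enc ρ = n → ρ ∈ H) (by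
    rintro acc x ha hx ρ rfl
    simp only [ctest, Bool.or_eq_true, mem_iff, ← e1, ← e2, ← e3, ← e4, mu_enc] at hx
    rcases hx with hx | hx
    · have h1 := ha _ hx _ rfl
      have h2 := mul_mem (mul_mem ms h1) (inv_mem ms)
      simpa [mul_assoc] using h2
    · have h1 := ha _ hx _ rfl
      have h2 := mul_mem (mul_mem mt h1) (inv_mem mt)
      simpa [mul_assoc] using h2) T [t, ti] hacc hc
  refine alt_le H _ hT ?_
  intro n hn
  rcases List.mem_cons.1 hn with rfl | hn
  · exact hacc _ (by simp)
  · rcases List.mem_cons.1 hn with rfl | hn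
    · exact hacc _ (by simp)
    · exact key n hn

/-- The property to prove. -/
def Pr (x y : Perm (Fin 6)) : Prop :=
  ∃ s : Perm (Fin 6), alternatingGroup (Fin 6) ≤ Subgroup.closure {x, s} ∧
    alternatingGroup (Fin 6) ≤ Subgroup.closure {y, s}

lemma alt_conj {x s g : Perm (Fin 6)}
    (h : alternatingGroup (Fin 6) ≤ Subgroup.closure {g * x * g⁻¹, s}) :
    alternatingGroup (Fin 6) ≤ Subgroup.closure {x, g⁻¹ * s * g} := by
  intro a ha
  have h1 : g * a * g⁻¹ ∈ Subgroup.closure {g * x * g⁻¹, s} :=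
    h ((inferInstance : (alternatingGroup (Fin 6)).Normal).conj_mem a ha g)
  have h2 : Subgroup.closure {g * x * g⁻¹, s} ≤
      (Subgroup.closure {x, g⁻¹ * s * g}).comap (MulAut.conj g⁻¹).toMonoidHom := by
    rw [Subgroup.closure_le]
    rintro u (rfl | rfl)
    · apply Subgroup.subset_closure
      simp [mul_assoc]
    · apply Subgroup.subset_closure
      simp
  have h3 := h2 h1
  simpa [mul_assoc] using h3

lemma Pr.conj {x y g : Perm (Fin 6)} (h : Pr (g * x * g⁻¹) (g * y * g⁻¹)) : Pr x y := by
  obtain ⟨s, h1, h2⟩ := h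
  exact ⟨_, alt_conj h1, alt_conj h2⟩

lemma closure_pow_le (x s : Perm (Fin 6)) (k : ℕ) :
    Subgroup.closure {x ^ k, s} ≤ Subgroup.closure {x, s} := by
  rw [Subgroup.closure_le]
  rintro u (rfl | rfl)
  · exact pow_mem (Subgroup.subset_closure (by simp)) _
  · exact Subgroup.subset_closure (by simp)

def gd0 : List ℕ :=
  [84680, 51024, 18089, 132749, 153224, 117384, 83784, 50856, 18061, 43352, 17130, 136725,
   118945, 68363, 108648, 82629, 54804, 15009, 132427, 137936, 115025, 67369, 34973, 22730,
   119568, 84505, 34658, 6315, 139469, 144208, 115753, 67173, 55427, 10956, 136536, 114794,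
   71429, 53404, 15114, 78632, 50205, 22114, 137859, 106828, 152776, 117328, 83777, 34476,
   14477, 141128, 115368, 83469, 54944, 19083, 80200, 50408, 18005, 153217, 101004, 88152,
   51906, 5972, 143529, 99597, 72472, 49498, 5930, 135325, 119050, 119904, 84547, 42820,
   12972, 144397, 107360, 82475, 42533, 21155, 141835, 109313, 66396, 47146, 5349, 151635,
   120849, 68321, 35155, 10473, 131797, 146056, 116040, 83560, 50821, 22156, 87816, 51864,
   18250, 136872, 114829, 55504, 19153, 132945, 100521, 67789, 86752, 51731, 10081, 131755,
   108557, 43744, 17235, 140841, 98981, 88075, 144488, 115781, 87620, 47748, 13644, 71912,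
   49365, 22289, 133785, 100682, 103720, 82013, 55042, 6812, 143690, 145986, 103748, 77932,
   46341, 21596, 47888, 17753, 132714, 104581, 86220, 141912, 115522, 71212, 45221, 21771,
   152216, 117258, 71520, 49323, 9997, 105120, 82251, 42792, 17053, 153098, 46432, 17515,
   140869, 119428, 80396, 86297, 35610, 6490, 135402, 102677, 140099, 107052, 78373, 54307,
   10851]

def wd0 : List (List Bool) :=
  [[false, true, false, false, false, false],
   [true, false, true, true, false, false, false, true, false],
   [true, false, false, false, true, false, false, false, false, true, false, true],
   [true, true, false, true, false, true],
   [true, true],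
   [true, false, false, true, false, false, false, true, false, false, false, true]]

def tc0 : List ℕ :=
  [132749, 22156, 18089, 19083, 50821, 114829, 51024, 180377, 54944, 176268, 83560, 180867,
   136872, 166027, 84680, 180944, 169744, 165537, 83469, 115368, 169604, 116040, 181336,
   173664, 18250, 51864, 177416, 174280, 180426, 181777, 181259, 141128, 170136, 181826,
   87816, 176800, 165642, 173580]

def sc0 : ℕ := 166097
def si0 : ℕ := 177220
def tz0 : ℕ := 120968
def ti0 : ℕ := 146056

def gd1 : List ℕ :=
  [174280, 180944, 181777, 18089, 22156, 84680, 169744, 180377, 18250, 54944, 166027, 87816,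
   170136, 180426, 51024, 165537, 19083, 137936, 176401, 17753, 22114, 55427, 67789, 88152,
   170178, 49365, 132945, 15009, 21771, 43352, 164578, 51731, 67369, 6812, 119050, 43744,
   164627, 84505, 5930, 53404, 100682, 139609, 13154, 54307, 67691, 72388, 102677, 99681,
   10851, 86787, 71709, 135402, 45396, 116040, 173664, 180867, 83469, 136872, 176268,
   141128, 176800, 181259, 83560, 169604, 114829, 117328, 173825, 17053, 153098, 47272,
   165068, 152216, 178186, 50408, 165460, 117377, 9997, 136536, 176226, 50499, 67173,
   137859, 78093, 80480, 169219, 82013, 137026, 45221, 132427, 108648, 172740, 115221,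
   140841, 12972, 119820, 140008, 176660, 115753, 9836, 119428, 108557, 78632, 168988,
   114794, 42820, 98981, 141835, 103720, 172124, 115522, 42533, 131755, 80396, 146056,
   177416, 181336, 181826, 50821, 132749, 55504, 166097, 19153, 22289, 22681, 22730, 104784,
   172257, 17235, 87585, 6315, 86220, 54552, 165978, 51906, 34581, 133785, 15114, 72472,
   168218, 49498, 34658, 35491, 68363, 119904, 174147, 82629, 136725, 143529, 13644, 86752,
   170003, 82153, 5972, 118945, 10571, 107360, 172579, 82475, 71212, 102572, 106828, 144488,
   177220, 115781, 140869, 144005, 144397, 153224, 178312, 181448, 181840, 181889, 18061,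
   80200, 169184, 180307, 83777, 5797, 151691, 47888, 165145, 19034, 55042, 34973, 133834,
   144208, 177185, 17515, 87620, 104581, 139469]

def wd1 : List (List Bool) :=
  [[false, true, false, false, false, false, false],
   [true, false, false, false, true, false, false, true, false, false, false, true, false, false],
   [true, false, false, false, false, true],
   [true, false, false, false, true, true, false, false, false, false, true, false],
   [true, false, false, true, false, false, false, true, false, true]]

def tc1 : List ℕ :=
  [22156, 132749, 18089, 114829, 50821, 19083, 181777, 180377, 169604, 166027, 181826,
   180867, 165537, 176268, 180944, 169744, 83560, 54944, 181336, 173664, 51024, 136872,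
   174280, 84680, 181259, 18250, 115368, 177416, 116040, 180426, 83469, 51864, 87816,
   176800, 173580, 170136, 141128, 165642]

def sc1 : ℕ := 22737
def si1 : ℕ := 144453
def tz1 : ℕ := 120968
def ti1 : ℕ := 146056

def gd2 : List ℕ :=
  [54944, 19083, 87816, 51864, 22156, 54552, 6812, 86220, 43744, 21155, 68363, 50408, 5797,
   82251, 42792, 17053, 67404, 115025, 140841, 115221, 132945, 115753, 136725, 116040,
   136872, 114829, 141128, 115368, 132749, 141912, 119428, 133834, 119904, 137859, 119050,
   82776, 34476, 17613, 71520, 49323, 9997, 43352, 12972, 67789, 46432, 6315, 78093, 139609,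
   107052, 131797, 99681, 136235, 102677, 51906, 22114, 84547, 55042, 19034, 87620, 49498,
   9836, 82629, 34658, 17515, 71429, 55504, 15009, 88075, 47888, 22681, 80396, 144208,
   100521, 144397, 104784, 143529, 108557, 88152, 47748, 22730, 80480, 55427, 15114, 72472,
   53404, 10956, 86752, 35491, 21771, 136536, 102572, 139469, 107360, 131755, 99597, 144488,
   104581, 143690, 108648, 144005, 100682, 140008, 98981, 132427, 103720, 135325, 106828,
   86297, 43548, 21204, 68321, 54307, 6931, 82153, 42533, 17235, 67369, 50205, 5972, 115522,
   132714, 115781, 137026, 114794, 140869, 152776, 105120, 151691, 109320, 152216, 101004,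
   71912, 45221, 10571, 78632, 34973, 13644, 152769, 104994, 151635, 109313, 152090, 100948,
   19153, 87585, 51731, 22289, 84505, 54804, 17753, 71212, 49365, 10081, 82475, 34581,
   10473, 78373, 35155, 13609, 71709, 45396, 35610, 21596, 72388, 53474, 10851, 86787, 6490,
   77932, 43205, 13154, 67691, 46341, 135402, 106597, 140099, 99114, 132189, 103748, 17130,
   67173, 50499, 5930, 82013, 42820, 137936, 118945, 141835, 119568, 133785, 119820]

def wd2 : List (List Bool) :=
  [[false, true, false, false, false, false, false],
   [true, false, true, true, false, true],
   [true, true, false, false, false, false, true, false, false, false, false, true, false, false],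
   [true, false, false, false, true, false, false, false],
   [true, false, false, false, false, true, false, false, false, true, false, false, false, false, false, true],
   [true, false]]

def tc2 : List ℕ :=
  [22156, 132749, 51864, 173580, 115368, 165642, 87816, 83560, 180377, 176268, 141128,
   51024, 180867, 166027, 19083, 174280, 18250, 180944, 169744, 18089, 170136, 114829,
   177416, 83469, 181336, 173664, 50821, 176800, 54944, 146056, 181259, 181777, 136872,
   120968, 180426, 181826, 165537, 169604]

def sc2 : ℕ := 178193
def si2 : ℕ := 178242
def tz2 : ℕ := 84680
def ti2 : ℕ := 116040

def rp : List ℕ :=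
  [153224, 152776, 152769, 120968, 120849, 55504]

def ch : List ℕ :=
  [18061, 181889, 50856, 181840, 181770, 181448, 180888, 178312, 173832, 180363, 117384,
   169632, 165516, 83784, 14477, 153217, 47272, 18005, 153098, 181441, 50730, 17053, 153168,
   178256, 180762, 173825, 49323, 17613, 178186, 172824, 180307, 117328, 169506, 178305,
   50408, 152216, 109320, 172299, 169184, 165068, 117258, 82776, 165460, 9997, 151691,
   101004, 105120, 80200, 164508, 82251, 117377, 42792, 5797, 34476, 67404, 168099, 83777,
   71520, 14421, 47146, 152090, 8989, 151635, 109313, 41259, 5349, 100948, 104994, 80193,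
   34028, 66396, 69987, 22156, 18089, 54944, 181777, 50821, 18250, 180944, 181826, 180377,
   51024, 174280, 180426, 181336, 169744, 180867, 170136, 177416, 181259, 84680, 165642,
   173664, 87816, 166027, 146056, 176800, 51864, 116040, 173580, 19083, 132749, 141128,
   176268, 115368, 165537, 136872, 114829, 169604, 83469, 83560, 21204, 120898, 10473,
   53474, 21596, 43205, 6490, 13609, 54307, 86297, 35155, 145937, 46341, 13154, 6931, 86787,
   131797, 145986, 139609, 45396, 68321, 35610, 10851, 135402, 132189, 102677, 140099,
   72388, 99681, 43548, 71709, 136235, 99114, 106597, 67691, 103748, 78373, 107052, 77932,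
   22730, 22681, 22289, 55427, 19153, 55042, 22114, 166097, 51906, 19034, 17753, 54804,
   170178, 165978, 165145, 51731, 176401, 50499, 17130, 88152, 54552, 170003, 47888, 169219,
   164578, 137936, 176898, 176226, 174105, 49365, 21771, 88075, 15114, 86752, 133834, 80480,
   43352, 168148, 67789, 141912, 136536, 176660, 119568, 174147, 15009, 21155, 133785,
   10571, 86220, 34973, 132427, 80396, 119050, 71912, 99597, 141835, 78093, 140008, 10956,
   119904, 132945, 47748, 10081, 53404, 34581, 137859, 118945, 6315, 45221, 131755, 6812,
   103720, 98981, 78632, 108557, 139469, 100521, 43744, 13644, 119820, 137026, 132714,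
   115025, 42820, 5930, 67173, 5972, 119428, 87585, 12972, 42533, 135325, 67369, 35491,
   102572, 108648, 104581, 100682, 143529, 46432, 82013, 50205, 136725, 115522, 114794,
   84505, 71212, 82153, 34658, 9836, 17235, 87620, 140841, 71429, 104784, 144005, 143690,
   82475, 17515, 82629, 172124, 168988, 115221, 164627, 84547, 49498, 115753, 172257,
   140869, 144208, 172579, 177185, 164963, 172740, 168218, 115781, 107360, 177220, 72472,
   106828, 144488, 68363, 144397]

def cd0 : List (ℕ × ℕ × ℕ) :=
  [(1, 181896, 181896), (0, 181448, 181448), (0, 88264, 144712), (0, 178312, 178312),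
   (1, 144712, 88264), (0, 153224, 153224), (1, 146000, 120912), (0, 120968, 146056)]

def cd1 : List (ℕ × ℕ × ℕ) :=
  [(1, 146056, 120968), (2, 153224, 153224), (0, 108872, 80648), (0, 174280, 177416),
   (0, 109320, 109320), (0, 152776, 152776)]

def cd2 : List (ℕ × ℕ × ℕ) :=
  [(2, 181896, 181896), (0, 141128, 87816), (0, 79976, 47440), (0, 84680, 116040),
   (2, 84680, 116040), (0, 178312, 178312), (0, 120968, 146056), (2, 181336, 180944),
   (2, 72472, 107360)]

def cd3 : List (ℕ × ℕ × ℕ) :=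
  [(1, 181896, 181896), (2, 181448, 181448), (0, 109320, 109320), (0, 153224, 153224),
   (0, 181448, 181448), (0, 152776, 152776), (1, 144712, 88264)]

def cd4 : List (ℕ × ℕ × ℕ) :=
  [(1, 152776, 152776), (2, 152776, 152776), (0, 144453, 22737), (0, 79976, 47440),
   (0, 109320, 109320), (2, 141128, 87816), (0, 120968, 146056)]

def cd5 : List (ℕ × ℕ × ℕ) :=
  [(1, 181896, 181896), (2, 181896, 181896), (0, 88264, 144712), (0, 144488, 55504),
   (0, 173832, 173832), (0, 142024, 120072), (0, 144712, 88264)]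

/-- Binary search trees. -/
inductive Tr : Type
  | lf : Tr
  | nd : Tr → ℕ → Tr → Tr

open Tr

def tr0 : Tr :=
  (nd (nd (nd (nd (nd (nd (nd (nd lf 5349 lf) 5930 lf) 5972 (nd (nd lf 6315 lf) 6490 lf)) 6812
  (nd (nd (nd lf 9997 lf) 10081 lf) 10473 (nd lf 10851 lf))) 10956 (nd (nd (nd (nd lf 12972 lf)
  13644 lf) 14477 (nd (nd lf 15009 lf) 15114 lf)) 17053 (nd (nd (nd lf 17130 lf) 17235 lf) 17515
  (nd lf 17753 lf)))) 18005 (nd (nd (nd (nd (nd lf 18061 lf) 18089 lf) 18250 (nd (nd lf 19083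
  lf) 19153 lf)) 21155 (nd (nd (nd lf 21596 lf) 21771 lf) 22114 (nd lf 22156 lf))) 22289 (nd (nd
  (nd (nd lf 22730 lf) 34476 lf) 34658 (nd lf 34973 lf)) 35155 (nd (nd (nd lf 35610 lf) 42533
  lf) 42792 (nd lf 42820 lf))))) 43352 (nd (nd (nd (nd (nd (nd lf 43744 lf) 45221 lf) 46341 (nd
  (nd lf 46432 lf) 47146 lf)) 47748 (nd (nd (nd lf 47888 lf) 49323 lf) 49365 (nd lf 49498 lf)))
  50205 (nd (nd (nd (nd lf 50408 lf) 50821 lf) 50856 (nd (nd lf 51024 lf) 51731 lf)) 51864 (nd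
  (nd (nd lf 51906 lf) 53404 lf) 54307 (nd lf 54804 lf)))) 54944 (nd (nd (nd (nd (nd lf 55042
  lf) 55427 lf) 55504 (nd (nd lf 66396 lf) 67173 lf)) 67369 (nd (nd (nd lf 67789 lf) 68321 lf)
  68363 (nd lf 71212 lf))) 71429 (nd (nd (nd (nd lf 71520 lf) 71912 lf) 72472 (nd lf 77932 lf))
  78373 (nd (nd (nd lf 78632 lf) 80200 lf) 80396 (nd lf 82013 lf)))))) 82251 (nd (nd (nd (nd (nd
  (nd (nd lf 82475 lf) 82629 lf) 83469 (nd (nd lf 83560 lf) 83777 lf)) 83784 (nd (nd (nd lf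
  84505 lf) 84547 lf) 84680 (nd lf 86220 lf))) 86297 (nd (nd (nd (nd lf 86752 lf) 87620 lf)
  87816 (nd (nd lf 88075 lf) 88152 lf)) 98981 (nd (nd (nd lf 99597 lf) 100521 lf) 100682 (nd lf
  101004 lf)))) 102677 (nd (nd (nd (nd (nd lf 103720 lf) 103748 lf) 104581 (nd (nd lf 105120 lf)
  106828 lf)) 107052 (nd (nd (nd lf 107360 lf) 108557 lf) 108648 (nd lf 109313 lf))) 114794 (nd
  (nd (nd (nd lf 114829 lf) 115025 lf) 115368 (nd lf 115522 lf)) 115753 (nd (nd (nd lf 115781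
  lf) 116040 lf) 117258 (nd lf 117328 lf))))) 117384 (nd (nd (nd (nd (nd (nd lf 118945 lf)
  119050 lf) 119428 (nd (nd lf 119568 lf) 119904 lf)) 120849 (nd (nd (nd lf 120968 lf) 131755
  lf) 131797 (nd lf 132427 lf))) 132714 (nd (nd (nd (nd lf 132749 lf) 132945 lf) 133785 (nd lf
  135325 lf)) 135402 (nd (nd (nd lf 136536 lf) 136725 lf) 136872 (nd lf 137859 lf)))) 137936 (nd
  (nd (nd (nd (nd lf 139469 lf) 140099 lf) 140841 (nd (nd lf 140869 lf) 141128 lf)) 141835 (nd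
  (nd (nd lf 141912 lf) 143529 lf) 143690 (nd lf 144208 lf))) 144397 (nd (nd (nd (nd lf 144488
  lf) 145986 lf) 146056 (nd lf 151635 lf)) 152216 (nd (nd (nd lf 152776 lf) 153098 lf) 153217
  (nd lf 153224 lf)))))))

def tr1 : Tr :=
  (nd (nd (nd (nd (nd (nd (nd (nd lf 5797 lf) 5930 (nd lf 5972 lf)) 6315 (nd (nd lf 6812 lf)
  9836 lf)) 9997 (nd (nd (nd lf 10571 lf) 10851 lf) 12972 (nd (nd lf 13154 lf) 13644 lf))) 15009
  (nd (nd (nd (nd lf 15114 lf) 17053 lf) 17235 (nd (nd lf 17515 lf) 17753 lf)) 18061 (nd (nd (nd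
  lf 18089 lf) 18250 lf) 19034 (nd (nd lf 19083 lf) 19153 lf)))) 21771 (nd (nd (nd (nd (nd lf
  22114 lf) 22156 lf) 22289 (nd (nd lf 22681 lf) 22730 lf)) 34581 (nd (nd (nd lf 34658 lf) 34973
  lf) 35491 (nd (nd lf 42533 lf) 42820 lf))) 43352 (nd (nd (nd (nd lf 43744 lf) 45221 lf) 45396
  (nd (nd lf 47272 lf) 47888 lf)) 49365 (nd (nd (nd lf 49498 lf) 50408 lf) 50499 (nd (nd lf
  50821 lf) 51024 lf))))) 51731 (nd (nd (nd (nd (nd (nd lf 51906 lf) 53404 lf) 54307 (nd (nd lf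
  54552 lf) 54944 lf)) 55042 (nd (nd (nd lf 55427 lf) 55504 lf) 67173 (nd (nd lf 67369 lf) 67691
  lf))) 67789 (nd (nd (nd (nd lf 68363 lf) 71212 lf) 71709 (nd (nd lf 72388 lf) 72472 lf)) 78093
  (nd (nd (nd lf 78632 lf) 80200 lf) 80396 (nd (nd lf 80480 lf) 82013 lf)))) 82153 (nd (nd (nd
  (nd (nd lf 82475 lf) 82629 lf) 83469 (nd (nd lf 83560 lf) 83777 lf)) 84505 (nd (nd (nd lf
  84680 lf) 86220 lf) 86752 (nd (nd lf 86787 lf) 87585 lf))) 87620 (nd (nd (nd (nd lf 87816 lf)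
  88152 lf) 98981 (nd (nd lf 99681 lf) 100682 lf)) 102572 (nd (nd (nd lf 102677 lf) 103720 lf)
  104581 (nd (nd lf 104784 lf) 106828 lf)))))) 107360 (nd (nd (nd (nd (nd (nd (nd lf 108557 lf)
  108648 lf) 114794 (nd (nd lf 114829 lf) 115221 lf)) 115522 (nd (nd (nd lf 115753 lf) 115781
  lf) 116040 (nd (nd lf 117328 lf) 117377 lf))) 118945 (nd (nd (nd (nd lf 119050 lf) 119428 lf)
  119820 (nd (nd lf 119904 lf) 120968 lf)) 131755 (nd (nd (nd lf 132427 lf) 132749 lf) 132945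
  (nd (nd lf 133785 lf) 133834 lf)))) 135402 (nd (nd (nd (nd (nd lf 136536 lf) 136725 lf) 136872
  (nd (nd lf 137026 lf) 137859 lf)) 137936 (nd (nd (nd lf 139469 lf) 139609 lf) 140008 (nd (nd
  lf 140841 lf) 140869 lf))) 141128 (nd (nd (nd (nd lf 141835 lf) 143529 lf) 144005 (nd (nd lf
  144208 lf) 144397 lf)) 144488 (nd (nd (nd lf 146056 lf) 151691 lf) 152216 (nd (nd lf 153098
  lf) 153224 lf))))) 164578 (nd (nd (nd (nd (nd (nd lf 164627 lf) 165068 lf) 165145 (nd (nd lf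
  165460 lf) 165537 lf)) 165978 (nd (nd (nd lf 166027 lf) 166097 lf) 168218 (nd (nd lf 168988
  lf) 169184 lf))) 169219 (nd (nd (nd (nd lf 169604 lf) 169744 lf) 170003 (nd (nd lf 170136 lf)
  170178 lf)) 172124 (nd (nd (nd lf 172257 lf) 172579 lf) 172740 (nd (nd lf 173664 lf) 173825
  lf)))) 174147 (nd (nd (nd (nd (nd lf 174280 lf) 176226 lf) 176268 (nd (nd lf 176401 lf) 176660
  lf)) 176800 (nd (nd (nd lf 177185 lf) 177220 lf) 177416 (nd (nd lf 178186 lf) 178312 lf)))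
  180307 (nd (nd (nd (nd lf 180377 lf) 180426 lf) 180867 (nd (nd lf 180944 lf) 181259 lf))
  181336 (nd (nd (nd lf 181448 lf) 181777 lf) 181826 (nd (nd lf 181840 lf) 181889 lf)))))))

def tr2 : Tr :=
  (nd (nd (nd (nd (nd (nd (nd (nd lf 5797 lf) 5930 (nd lf 5972 lf)) 6315 (nd (nd lf 6490 lf)
  6812 lf)) 6931 (nd (nd (nd lf 9836 lf) 9997 lf) 10081 (nd (nd lf 10473 lf) 10571 lf))) 10851
  (nd (nd (nd (nd lf 10956 lf) 12972 lf) 13154 (nd (nd lf 13609 lf) 13644 lf)) 15009 (nd (nd (nd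
  lf 15114 lf) 17053 lf) 17130 (nd (nd lf 17235 lf) 17515 lf)))) 17613 (nd (nd (nd (nd (nd lf
  17753 lf) 19034 lf) 19083 (nd (nd lf 19153 lf) 21155 lf)) 21204 (nd (nd (nd lf 21596 lf) 21771
  lf) 22114 (nd (nd lf 22156 lf) 22289 lf))) 22681 (nd (nd (nd (nd lf 22730 lf) 34476 lf) 34581
  (nd (nd lf 34658 lf) 34973 lf)) 35155 (nd (nd (nd lf 35491 lf) 35610 lf) 42533 (nd (nd lf
  42792 lf) 42820 lf))))) 43205 (nd (nd (nd (nd (nd (nd lf 43352 lf) 43548 lf) 43744 (nd (nd lf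
  45221 lf) 45396 lf)) 46341 (nd (nd (nd lf 46432 lf) 47748 lf) 47888 (nd (nd lf 49323 lf) 49365
  lf))) 49498 (nd (nd (nd (nd lf 50205 lf) 50408 lf) 50499 (nd (nd lf 51731 lf) 51864 lf)) 51906
  (nd (nd (nd lf 53404 lf) 53474 lf) 54307 (nd (nd lf 54552 lf) 54804 lf)))) 54944 (nd (nd (nd
  (nd (nd lf 55042 lf) 55427 lf) 55504 (nd (nd lf 67173 lf) 67369 lf)) 67404 (nd (nd (nd lf
  67691 lf) 67789 lf) 68321 (nd (nd lf 68363 lf) 71212 lf))) 71429 (nd (nd (nd (nd lf 71520 lf)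
  71709 lf) 71912 (nd (nd lf 72388 lf) 72472 lf)) 77932 (nd (nd (nd lf 78093 lf) 78373 lf) 78632
  (nd (nd lf 80396 lf) 80480 lf)))))) 82013 (nd (nd (nd (nd (nd (nd (nd lf 82153 lf) 82251 lf)
  82475 (nd (nd lf 82629 lf) 82776 lf)) 84505 (nd (nd (nd lf 84547 lf) 84680 lf) 86220 (nd (nd
  lf 86297 lf) 86752 lf))) 86787 (nd (nd (nd (nd lf 87585 lf) 87620 lf) 87816 (nd (nd lf 88075
  lf) 88152 lf)) 98981 (nd (nd (nd lf 99114 lf) 99597 lf) 99681 (nd (nd lf 100521 lf) 100682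
  lf)))) 100948 (nd (nd (nd (nd (nd lf 101004 lf) 102572 lf) 102677 (nd (nd lf 103720 lf) 103748
  lf)) 104581 (nd (nd (nd lf 104784 lf) 104994 lf) 105120 (nd (nd lf 106597 lf) 106828 lf)))
  107052 (nd (nd (nd (nd lf 107360 lf) 108557 lf) 108648 (nd (nd lf 109313 lf) 109320 lf))
  114794 (nd (nd (nd lf 114829 lf) 115025 lf) 115221 (nd (nd lf 115368 lf) 115522 lf))))) 115753
  (nd (nd (nd (nd (nd (nd lf 115781 lf) 116040 lf) 118945 (nd (nd lf 119050 lf) 119428 lf))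
  119568 (nd (nd (nd lf 119820 lf) 119904 lf) 131755 (nd (nd lf 131797 lf) 132189 lf))) 132427
  (nd (nd (nd (nd lf 132714 lf) 132749 lf) 132945 (nd (nd lf 133785 lf) 133834 lf)) 135325 (nd
  (nd (nd lf 135402 lf) 136235 lf) 136536 (nd (nd lf 136725 lf) 136872 lf)))) 137026 (nd (nd (nd
  (nd (nd lf 137859 lf) 137936 lf) 139469 (nd (nd lf 139609 lf) 140008 lf)) 140099 (nd (nd (nd
  lf 140841 lf) 140869 lf) 141128 (nd (nd lf 141835 lf) 141912 lf))) 143529 (nd (nd (nd (nd lf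
  143690 lf) 144005 lf) 144208 (nd (nd lf 144397 lf) 144488 lf)) 151635 (nd (nd (nd lf 151691
  lf) 152090 lf) 152216 (nd (nd lf 152769 lf) 152776 lf)))))))

def trp : Tr :=
  (nd (nd (nd (nd (nd (nd (nd (nd (nd lf 5349 lf) 5797 lf) 5930 (nd lf 5972 lf)) 6315 (nd (nd
  (nd lf 6490 lf) 6812 lf) 6931 (nd lf 8989 lf))) 9836 (nd (nd (nd (nd lf 9997 lf) 10081 lf)
  10473 (nd lf 10571 lf)) 10851 (nd (nd lf 10956 lf) 12972 (nd lf 13154 lf)))) 13609 (nd (nd (nd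
  (nd (nd lf 13644 lf) 14421 lf) 14477 (nd lf 15009 lf)) 15114 (nd (nd (nd lf 17053 lf) 17130
  lf) 17235 (nd lf 17515 lf))) 17613 (nd (nd (nd (nd lf 17753 lf) 18005 lf) 18061 (nd lf 18089
  lf)) 18250 (nd (nd lf 19034 lf) 19083 (nd lf 19153 lf))))) 21155 (nd (nd (nd (nd (nd (nd lf
  21204 lf) 21596 lf) 21771 (nd lf 22114 lf)) 22156 (nd (nd (nd lf 22289 lf) 22681 lf) 22730 (nd
  lf 34028 lf))) 34476 (nd (nd (nd (nd lf 34581 lf) 34658 lf) 34973 (nd lf 35155 lf)) 35491 (nd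
  (nd lf 35610 lf) 41259 (nd lf 42533 lf)))) 42792 (nd (nd (nd (nd (nd lf 42820 lf) 43205 lf)
  43352 (nd lf 43548 lf)) 43744 (nd (nd lf 45221 lf) 45396 (nd lf 46341 lf))) 46432 (nd (nd (nd
  (nd lf 47146 lf) 47272 lf) 47748 (nd lf 47888 lf)) 49323 (nd (nd lf 49365 lf) 49498 (nd lf
  50205 lf)))))) 50408 (nd (nd (nd (nd (nd (nd (nd lf 50499 lf) 50730 lf) 50821 (nd lf 50856
  lf)) 51024 (nd (nd (nd lf 51731 lf) 51864 lf) 51906 (nd lf 53404 lf))) 53474 (nd (nd (nd (nd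
  lf 54307 lf) 54552 lf) 54804 (nd lf 54944 lf)) 55042 (nd (nd lf 55427 lf) 55504 (nd lf 66396
  lf)))) 67173 (nd (nd (nd (nd (nd lf 67369 lf) 67404 lf) 67691 (nd lf 67789 lf)) 68321 (nd (nd
  (nd lf 68363 lf) 69987 lf) 71212 (nd lf 71429 lf))) 71520 (nd (nd (nd (nd lf 71709 lf) 71912
  lf) 72388 (nd lf 72472 lf)) 77932 (nd (nd lf 78093 lf) 78373 (nd lf 78632 lf))))) 80193 (nd
  (nd (nd (nd (nd (nd lf 80200 lf) 80396 lf) 80480 (nd lf 82013 lf)) 82153 (nd (nd (nd lf 82251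
  lf) 82475 lf) 82629 (nd lf 82776 lf))) 83469 (nd (nd (nd (nd lf 83560 lf) 83777 lf) 83784 (nd
  lf 84505 lf)) 84547 (nd (nd lf 84680 lf) 86220 (nd lf 86297 lf)))) 86752 (nd (nd (nd (nd (nd
  lf 86787 lf) 87585 lf) 87620 (nd lf 87816 lf)) 88075 (nd (nd lf 88152 lf) 98981 (nd lf 99114
  lf))) 99597 (nd (nd (nd (nd lf 99681 lf) 100521 lf) 100682 (nd lf 100948 lf)) 101004 (nd (nd
  lf 102572 lf) 102677 (nd lf 103720 lf))))))) 103748 (nd (nd (nd (nd (nd (nd (nd (nd lf 104581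
  lf) 104784 lf) 104994 (nd lf 105120 lf)) 106597 (nd (nd (nd lf 106828 lf) 107052 lf) 107360
  (nd lf 108557 lf))) 108648 (nd (nd (nd (nd lf 109313 lf) 109320 lf) 114794 (nd lf 114829 lf))
  115025 (nd (nd lf 115221 lf) 115368 (nd lf 115522 lf)))) 115753 (nd (nd (nd (nd (nd lf 115781
  lf) 116040 lf) 117258 (nd lf 117328 lf)) 117377 (nd (nd (nd lf 117384 lf) 118945 lf) 119050
  (nd lf 119428 lf))) 119568 (nd (nd (nd (nd lf 119820 lf) 119904 lf) 120849 (nd lf 120898 lf))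
  120968 (nd (nd lf 131755 lf) 131797 (nd lf 132189 lf))))) 132427 (nd (nd (nd (nd (nd (nd lf
  132714 lf) 132749 lf) 132945 (nd lf 133785 lf)) 133834 (nd (nd (nd lf 135325 lf) 135402 lf)
  136235 (nd lf 136536 lf))) 136725 (nd (nd (nd (nd lf 136872 lf) 137026 lf) 137859 (nd lf
  137936 lf)) 139469 (nd (nd lf 139609 lf) 140008 (nd lf 140099 lf)))) 140841 (nd (nd (nd (nd
  (nd lf 140869 lf) 141128 lf) 141835 (nd lf 141912 lf)) 143529 (nd (nd lf 143690 lf) 144005 (nd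
  lf 144208 lf))) 144397 (nd (nd (nd (nd lf 144488 lf) 145937 lf) 145986 (nd lf 146056 lf))
  151635 (nd (nd lf 151691 lf) 152090 (nd lf 152216 lf)))))) 152769 (nd (nd (nd (nd (nd (nd (nd
  lf 152776 lf) 153098 lf) 153168 (nd lf 153217 lf)) 153224 (nd (nd (nd lf 164508 lf) 164578 lf)
  164627 (nd lf 164963 lf))) 165068 (nd (nd (nd (nd lf 165145 lf) 165460 lf) 165516 (nd lf
  165537 lf)) 165642 (nd (nd lf 165978 lf) 166027 (nd lf 166097 lf)))) 168099 (nd (nd (nd (nd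
  (nd lf 168148 lf) 168218 lf) 168988 (nd lf 169184 lf)) 169219 (nd (nd (nd lf 169506 lf) 169604
  lf) 169632 (nd lf 169744 lf))) 170003 (nd (nd (nd (nd lf 170136 lf) 170178 lf) 172124 (nd lf
  172257 lf)) 172299 (nd (nd lf 172579 lf) 172740 (nd lf 172824 lf))))) 173580 (nd (nd (nd (nd
  (nd (nd lf 173664 lf) 173825 lf) 173832 (nd lf 174105 lf)) 174147 (nd (nd (nd lf 174280 lf)
  176226 lf) 176268 (nd lf 176401 lf))) 176660 (nd (nd (nd (nd lf 176800 lf) 176898 lf) 177185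
  (nd lf 177220 lf)) 177416 (nd (nd lf 178186 lf) 178256 (nd lf 178305 lf)))) 178312 (nd (nd (nd
  (nd (nd lf 180307 lf) 180363 lf) 180377 (nd lf 180426 lf)) 180762 (nd (nd lf 180867 lf) 180888
  (nd lf 180944 lf))) 181259 (nd (nd (nd (nd lf 181336 lf) 181441 lf) 181448 (nd lf 181770 lf))
  181777 (nd (nd lf 181826 lf) 181840 (nd lf 181889 lf))))))))

/-- Search in a tree. -/
def tmem (n : ℕ) : Tr → Bool
  | lf => false
  | nd l a r => bif Nat.beq n a then true else bif Nat.ble n a then tmem n l else tmem n r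

/-- All entries of a tree are in a list. -/
def tsub (L : List ℕ) : Tr → Bool
  | lf => true
  | nd l a r => tsub L l && mem a L && tsub L r

lemma tmem_sound {L : List ℕ} {n : ℕ} : ∀ {t : Tr}, tsub L t = true → tmem n t = true → n ∈ L
  | lf, _, h => by simp [tmem] at h
  | nd l a r, hs, h => by
    simp only [tsub, Bool.and_eq_true, mem_iff] at hs
    rw [tmem] at h
    cases h1 : Nat.beq n a
    · rw [h1, cond_false] at h
      cases h2 : Nat.ble n a
      · rw [h2, cond_false] at h
        exact tmem_sound hs.2 h
      · rw [h2, cond_true] at h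
        exact tmem_sound hs.1.1 h
    · rw [Nat.beq_eq] at h1
      exact h1 ▸ hs.1.2

def gg0 : List ℕ := tz0 :: gd0
def gg1 : List ℕ := tz1 :: gd1
def gg2 : List ℕ := tz2 :: gd2

lemma good_of (s si t ti : ℕ) (T G : List ℕ) (ws : List (List Bool))
    (hs : okPair s si) (ht : okPair t ti)
    (hc : chain (ctest s si t ti) [t, ti] T = true)
    (hT : allCodes (fun n => !(Nat.beq (cnt n) 3) || mem n (t :: ti :: T)) = true)
    (hG : chain (gtest s ws) [t] G = true) : ∀ n ∈ t :: G, Good s n := by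
  have hb := base_good s si t ti T hs ht hc hT
  have key := chain_sound (gtest s ws) (Good s) (gtest_sound s ws) G [t]
    (by intro a ha; rw [List.mem_singleton] at ha; exact ha ▸ hb) hG
  intro n hn
  rcases List.mem_cons.1 hn with rfl | hn
  · exact hb
  · exact key n hn

lemma good0 : ∀ n ∈ gg0, Good sc0 n :=
  good_of sc0 si0 tz0 ti0 tc0 gd0 wd0 (by decide +kernel) (by decide +kernel) (by decide +kernel)
    (by decide +kernel) (by decide +kernel)

lemma good1 : ∀ n ∈ gg1, Good sc1 n :=
  good_of sc1 si1 tz1 ti1 tc1 gd1 wd1 (by decide +kernel) (by decide +kernel) (by decide +kernel)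
    (by decide +kernel) (by decide +kernel)

lemma good2 : ∀ n ∈ gg2, Good sc2 n :=
  good_of sc2 si2 tz2 ti2 tc2 gd2 wd2 (by decide +kernel) (by decide +kernel) (by decide +kernel)
    (by decide +kernel) (by decide +kernel)

def gl : ℕ → List ℕ
  | 0 => gg0
  | 1 => gg1
  | _ => gg2

lemma gl_good (k : ℕ) : ∃ s : Perm (Fin 6), ∀ x, enc x ∈ gl k →
    alternatingGroup (Fin 6) ≤ Subgroup.closure {x, s} := by
  match k with
  | 0 =>
    obtain ⟨s, hs, -⟩ := (by decide +kernel : okPair sc0 si0).exists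
    exact ⟨s, fun x hx => good0 _ hx x s rfl hs⟩
  | 1 =>
    obtain ⟨s, hs, -⟩ := (by decide +kernel : okPair sc1 si1).exists
    exact ⟨s, fun x hx => good1 _ hx x s rfl hs⟩
  | k + 2 =>
    obtain ⟨s, hs, -⟩ := (by decide +kernel : okPair sc2 si2).exists
    exact ⟨s, fun x hx => good2 _ hx x s rfl hs⟩

def gt : ℕ → Tr
  | 0 => tr0
  | 1 => tr1
  | _ => tr2

lemma gt_sound {k n : ℕ} (h : tmem n (gt k) = true) : n ∈ gl k := by
  match k with
  | 0 => exact tmem_sound (t := tr0) (by decide +kernel : tsub gg0 tr0 = true) h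
  | 1 => exact tmem_sound (t := tr1) (by decide +kernel : tsub gg1 tr1 = true) h
  | k + 2 => exact tmem_sound (t := tr2) (by decide +kernel : tsub gg2 tr2 = true) h

/-- The elements of prime order. -/
def primes : List ℕ := rp ++ ch

lemma trp_sound {n : ℕ} (h : tmem n trp = true) : n ∈ primes :=
  tmem_sound (by decide +kernel) h

def candOk (x : ℕ) (z : ℕ × ℕ × ℕ) : Prop :=
  okPair z.2.1 z.2.2 ∧ mem (mu (mu z.2.1 x) z.2.2) (gl z.1) = true

instance (x : ℕ) (z : ℕ × ℕ × ℕ) : Decidable (candOk x z) := by unfold candOk; infer_instance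

def QQ (n : ℕ) : Prop := ∀ x y : Perm (Fin 6), enc x = n → enc y ∈ primes → Pr x y

def covers (L : List (ℕ × ℕ × ℕ)) (y : ℕ) : Bool :=
  L.any fun z => tmem (mu (mu z.2.1 y) z.2.2) (gt z.1)

lemma rep_sound (x : ℕ) (L : List (ℕ × ℕ × ℕ)) (h1 : ∀ z ∈ L, candOk x z)
    (h2 : (primes.all (covers L)) = true) : QQ x := by
  rintro x y rfl hy
  rw [List.all_eq_true] at h2
  have h3 := h2 _ hy
  simp only [covers, List.any_eq_true] at h3
  obtain ⟨⟨k, g, gi⟩, hz, hm⟩ := h3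
  replace hm := gt_sound hm
  obtain ⟨ho, hx⟩ := h1 _ hz
  rw [mem_iff] at hx
  obtain ⟨γ, rfl, rfl⟩ := ho.exists
  simp only [mu_enc] at hx hm
  obtain ⟨s, hs⟩ := gl_good k
  exact Pr.conj ⟨s, hs _ hx, hs _ hm⟩

lemma rep_all : ∀ n ∈ rp, QQ n := by
  intro n hn
  simp only [rp, List.mem_cons, List.not_mem_nil, or_false] at hn
  rcases hn with rfl | rfl | rfl | rfl | rfl | rfl
  · exact rep_sound _ cd0 (by decide +kernel) (by decide +kernel)
  · exact rep_sound _ cd1 (by decide +kernel) (by decide +kernel)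
  · exact rep_sound _ cd2 (by decide +kernel) (by decide +kernel)
  · exact rep_sound _ cd3 (by decide +kernel) (by decide +kernel)
  · exact rep_sound _ cd4 (by decide +kernel) (by decide +kernel)
  · exact rep_sound _ cd5 (by decide +kernel) (by decide +kernel)

def cc : ℕ := 22737
def cci : ℕ := 144453
def tt : ℕ := 181889

/-- Whether some power of the code is in the list of elements of prime order. -/
def hasPow (n : ℕ) : Bool :=
  Nat.beq n idc || tmem n trp || tmem (mu n n) trp || tmem (mu n (mu n n)) trp

lemma hasPow_sound (x : Perm (Fin 6)) (hx : x ≠ 1) : ∃ k : ℕ, enc (x ^ k) ∈ primes := by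
  have h := allCodes_sound (f := hasPow) (by decide +kernel) x
  simp only [hasPow, Bool.or_eq_true, mu_enc, Nat.beq_eq, ← enc_one] at h
  rcases h with ((h | h) | h) | h
  · exact absurd (enc_inj h) hx
  · exact ⟨1, by simpa using trp_sound h⟩
  · exact ⟨2, by simpa [pow_two] using trp_sound h⟩
  · exact ⟨3, by rw [pow_succ', pow_two]; exact trp_sound h⟩

/-- The list of elements of prime order is stable under conjugation. -/
lemma primes_conj {c ci : ℕ} (h : (primes.all fun n => tmem (mu (mu ci n) c) trp) = true)
    {γ : Perm (Fin 6)} (e1 : enc γ = c) (e2 : enc γ⁻¹ = ci) {y : Perm (Fin 6)}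
    (hy : enc y ∈ primes) : enc (γ⁻¹ * y * γ) ∈ primes := by
  rw [List.all_eq_true] at h
  have := trp_sound (h _ hy)
  rwa [← e1, ← e2, mu_enc, mu_enc] at this

lemma all_QQ : ∀ n ∈ primes, QQ n := by
  obtain ⟨γ, e1, e2⟩ := (by decide +kernel : okPair cc cci).exists
  obtain ⟨δ, e3, e4⟩ := (by decide +kernel : okPair tt tt).exists
  have key := chain_sound (ctest cc cci tt tt) QQ (by
    rintro acc n ha hx x y rfl hy
    simp only [ctest, Bool.or_eq_true, mem_iff] at hx
    rcases hx with hx | hx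
    · rw [← e1, ← e2, mu_enc, mu_enc] at hx
      have := ha _ hx _ (γ⁻¹ * y * γ) rfl (primes_conj (by decide +kernel) e1 e2 hy)
      exact Pr.conj (g := γ⁻¹) (by simpa using this)
    · have hx' : mu (mu (enc δ⁻¹) (enc x)) (enc δ) ∈ acc := by rw [e3, e4]; exact hx
      rw [mu_enc, mu_enc] at hx'
      have := ha _ hx' _ (δ⁻¹ * y * δ) rfl (primes_conj (by decide +kernel) e3 e4 hy)
      exact Pr.conj (g := δ⁻¹) (by simpa using this)) ch rp rep_all (by decide +kernel)
  intro n hn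
  rcases List.mem_append.1 hn with hn | hn
  · exact rep_all n hn
  · exact key n hn

end S6

/-- For any two nonidentity elements `x, y` of `S₆`, there is `s ∈ S₆` such that
`A₆` is contained in both `⟨x, s⟩` and `⟨y, s⟩`. -/
theorem stmt_12 :
    ∀ x y : Equiv.Perm (Fin 6), x ≠ 1 → y ≠ 1 →
      ∃ s : Equiv.Perm (Fin 6),
        alternatingGroup (Fin 6) ≤ Subgroup.closure {x, s} ∧
        alternatingGroup (Fin 6) ≤ Subgroup.closure {y, s} := by
  intro x y hx hy
  obtain ⟨k, hk⟩ := S6.hasPow_sound x hx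
  obtain ⟨l, hl⟩ := S6.hasPow_sound y hy
  obtain ⟨s, h1, h2⟩ := S6.all_QQ _ hk _ _ rfl hl
  exact ⟨s, h1.trans (S6.closure_pow_le x s k), h2.trans (S6.closure_pow_le y s l)⟩
end

section
/- In the symmetric group S₆ on six points: (i) every element s ∈ S₆ satisfying ⟨(1,2), s⟩ = S₆ and ⟨(3,4), s⟩ = S₆ is a 6-cycle; (ii) every element s ∈ S₆ satisfying ⟨(1,2)(3,4)(5,6), s⟩ = S₆ and ⟨(1,3)(2,4)(5,6), s⟩ = S₆ has cycle type consisting of one 2-cycle and one 3-cycle. In particular, no element s of the alternating group A₆ satisfies ⟨(1,2), s⟩ = S₆ and ⟨(3,4), s⟩ = S₆, and no single conjugacy class of S₆ contains common generating partners for both pairs; hence the uniform spread of S₆ is 1, not 2. -/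
/-! ## Systems of representatives preserved by permutations

A map `r : α → α` is regarded as choosing representatives of the classes of an equivalence
relation on `α`.  The elements `g` with `r (g • u) = r (g • r u)` form a submonoid. -/

theorem preserved_of_closure {G α : Type*} [Group G] [Finite G] [MulAction G α] (r : α → α)
    (x s : G) (hx : ∀ u, r (x • u) = r (x • r u)) (hs : ∀ u, r (s • u) = r (s • r u))
    (h : Subgroup.closure {x, s} = ⊤) (g : G) : ∀ u, r (g • u) = r (g • r u) := by
  by_cases hr : ∀ u, r u = r (r u)
  · have hg : g ∈ Submonoid.closure ({x, s} : Set G) := by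
      rw [← Subgroup.closure_toSubmonoid_of_finite, h]
      trivial
    induction hg using Submonoid.closure_induction with
    | mem y hy =>
      rcases hy with rfl | rfl
      · exact hx
      · exact hs
    | one => intro u; simpa using hr u
    | mul a b _ _ ha hb =>
      intro u
      rw [mul_smul, mul_smul, ha (b • u), hb u, ← ha]
  · exfalso
    apply hr
    have key : ∀ n : ℕ, ∀ u, r (x ^ (n + 1) • u) = r (x ^ (n + 1) • r u) := by
      intro n
      induction n with
      | zero => simpa using hx
      | succ n ih =>
        intro u
        rw [pow_succ, mul_smul, mul_smul, ih (x • u), hx u, ← ih]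
    intro u
    have h1 := key (orderOf x - 1) u
    have h2 : orderOf x - 1 + 1 = orderOf x := Nat.succ_pred_eq_of_pos (orderOf_pos x)
    rw [h2, pow_orderOf_eq_one] at h1
    simpa using h1

/-- The map `Fin 6 → Fin 6` whose values are the decimal digits of `n` (units first). -/
def tab (n : ℕ) (i : Fin 6) : Fin 6 := Fin.ofNat 6 (n / 10 ^ i.val % 10)

/-- The map `Fin 6 → Fin 6 → Fin 6` whose values are the decimal digits of `n`. -/
def tabTwo (n : ℕ) (i j : Fin 6) : Fin 6 := Fin.ofNat 6 (n / 10 ^ (6 * i.val + j.val) % 10)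

/-- `f` preserves the partition of the six points encoded by `n`. -/
def PresP (f : Fin 6 → Fin 6) (n : ℕ) : Prop := ∀ u, tab n (f u) = tab n (f (tab n u))

/-- `f` preserves the 1-factorization of `K₆` encoded by `n`; the colour of an edge `ab`
is the `c` for which the edge `0c` has the same colour. -/
def PresT (f : Fin 6 → Fin 6) (n : ℕ) : Prop :=
  ∀ a b, tabTwo n (f a) (f b) = tabTwo n (f 0) (f (tabTwo n a b))

instance (f : Fin 6 → Fin 6) (n : ℕ) : Decidable (PresP f n) := by
  unfold PresP; infer_instance

instance (f : Fin 6 → Fin 6) (n : ℕ) : Decidable (PresT f n) := by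
  unfold PresT; infer_instance

theorem not_closure_P (x s : Equiv.Perm (Fin 6)) (n : ℕ) (hx : PresP x n) (hs : PresP s n)
    (hn : ∃ i j, ¬ PresP (Equiv.swap i j) n) : Subgroup.closure {x, s} ≠ ⊤ := by
  intro h
  obtain ⟨i, j, hij⟩ := hn
  exact hij (preserved_of_closure (tab n) x s hx hs h (Equiv.swap i j))

theorem pairs_preserved (c : Fin 6 → Fin 6 → Fin 6) (x s g : Equiv.Perm (Fin 6))
    (hx : ∀ a b, c (x a) (x b) = c (x 0) (x (c a b)))
    (hs : ∀ a b, c (s a) (s b) = c (s 0) (s (c a b)))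
    (h : Subgroup.closure {x, s} = ⊤) (a b : Fin 6) :
    c (g a) (g b) = c (g 0) (g (c a b)) := by
  have := preserved_of_closure (α := Fin 6 × Fin 6) (fun p => (0, c p.1 p.2)) x s
    (fun u => Prod.ext rfl (hx u.1 u.2)) (fun u => Prod.ext rfl (hs u.1 u.2)) h g
  exact congrArg Prod.snd (this (a, b))

theorem not_closure_T (x s : Equiv.Perm (Fin 6)) (n : ℕ) (hx : PresT x n) (hs : PresT s n)
    (hn : ∃ i j, ¬ PresT (Equiv.swap i j) n) : Subgroup.closure {x, s} ≠ ⊤ := by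
  intro h
  obtain ⟨i, j, hij⟩ := hn
  exact hij (pairs_preserved (tabTwo n) x s (Equiv.swap i j) hx hs h)

theorem cycleType_of_semiconj (s t : Equiv.Perm (Fin 6)) (v : Fin 6 → Fin 6)
    (hv : Function.Injective v) (h : ∀ i, s (v i) = v (t i)) : s.cycleType = t.cycleType := by
  let g : Equiv.Perm (Fin 6) := Equiv.ofBijective v (Finite.injective_iff_bijective.mp hv)
  have : s = g * t * g⁻¹ := by
    rw [eq_mul_inv_iff_mul_eq]
    ext i
    exact congrArg Fin.val (h i)
  rw [this, Equiv.Perm.cycleType_conj]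

/-- `f` is a 6-cycle. -/
def IsSix (f : Fin 6 → Fin 6) : Prop :=
  let v : Fin 6 → Fin 6 := ![0, f 0, f (f 0), f (f (f 0)), f (f (f (f 0))), f (f (f (f (f 0))))]
  Function.Injective v ∧ ∀ i, f (v i) = v (i + 1)

/-- The permutation `(0 1)(2 3 4)`. -/
def perm23 : Equiv.Perm (Fin 6) := Equiv.swap 0 1 * (Equiv.swap 2 3 * Equiv.swap 3 4)

/-- `f` is a product of a 2-cycle and a disjoint 3-cycle. -/
def IsTwoThree (f : Fin 6 → Fin 6) : Prop :=
  ∃ i j, f i = i ∧ f j ≠ j ∧ f (f j) = j ∧ ∃ k, f (f k) ≠ k ∧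
    let v : Fin 6 → Fin 6 := ![j, f j, k, f k, f (f k), i]
    Function.Injective v ∧ ∀ i, f (v i) = v (perm23 i)

instance (f : Fin 6 → Fin 6) : Decidable (IsSix f) := by
  unfold IsSix; infer_instance

instance (f : Fin 6 → Fin 6) : Decidable (IsTwoThree f) := by
  unfold IsTwoThree; infer_instance

theorem cycleType_perm23 : perm23.cycleType = {2, 3} := by
  have h : Equiv.Perm.Disjoint (Equiv.swap (0 : Fin 6) 1) (Equiv.swap 2 3 * Equiv.swap 3 4) := by
    intro x; revert x; decide
  have h3 : (Equiv.swap (2 : Fin 6) 3 * Equiv.swap 3 4).IsThreeCycle := by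
    rw [Equiv.swap_comm 2 3]
    exact Equiv.Perm.isThreeCycle_swap_mul_swap_same (by decide) (by decide) (by decide)
  rw [perm23, h.cycleType_mul, h3.cycleType,
    (Equiv.Perm.isSwap_iff_cycleType.mp ⟨0, 1, by decide, rfl⟩)]
  rfl

theorem IsSix.cycleType {s : Equiv.Perm (Fin 6)} (h : IsSix s) : s.cycleType = {6} := by
  rw [cycleType_of_semiconj s (finRotate 6) _ h.1 (fun i => by rw [h.2, finRotate_apply]),
    cycleType_finRotate]

theorem IsTwoThree.cycleType {s : Equiv.Perm (Fin 6)} (h : IsTwoThree s) :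
    s.cycleType = {2, 3} := by
  obtain ⟨i, j, -, -, -, k, -, hv, h⟩ := h
  rw [cycleType_of_semiconj s perm23 _ hv h, cycleType_perm23]

/-- To check a property of all permutations of six points it suffices to check it on all
lists of values without repetition. -/
theorem forall_perm_of_values (Q : (Fin 6 → Fin 6) → Prop)
    (h : ∀ a b : Fin 6, b ≠ a → ∀ c, c ≠ a ∧ c ≠ b → ∀ d, d ≠ a ∧ d ≠ b ∧ d ≠ c →
      ∀ e, e ≠ a ∧ e ≠ b ∧ e ≠ c ∧ e ≠ d → ∀ f, f ≠ a ∧ f ≠ b ∧ f ≠ c ∧ f ≠ d ∧ f ≠ e →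
        Q (tab (a + 10 * b + 100 * c + 1000 * d + 10000 * e + 100000 * f)))
    (s : Equiv.Perm (Fin 6)) : Q s := by
  have key := h (s 0) (s 1) (by simp) (s 2) (by simp) (s 3) (by simp) (s 4) (by simp)
    (s 5) (by simp)
  convert key using 1
  funext i
  have := fun i => (s i).isLt
  apply Fin.ext
  have h0 := this 0
  have h1 := this 1
  have h2 := this 2
  have h3 := this 3
  have h4 := this 4
  have h5 := this 5
  fin_cases i <;> simp [tab, Fin.ofNat] <;> omega

def listA : List ℕ :=
  [200, 3000, 40000, 500000, 333000, 220200, 202200, 22200, 442200, 323200, 233200, 2200, 440000]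

def listB : List ℕ := [111110, 10, 110010, 1110]

def listC : List ℕ := [101010, 11010, 100110, 10110, 440000, 222200, 2200, 441010, 440110]

def listCT : List ℕ :=
  [21345205134150423314052432501543210, 31425302154120543415032254301543210,
   24135201354410523135042352401543210, 32145301524210453154032425301543210]

def listD : List ℕ := [202200, 22200]

def listDT : List ℕ :=
  [12435105324250143431052324501543210, 14325102534420153351042235401543210]

theorem proper_P : ∀ n ∈ listA ++ listB ++ listC ++ listD,
    ∃ i j, ¬ PresP (Equiv.swap i j) n := by
  decide +kernel

theorem proper_T : ∀ n ∈ listCT ++ listDT, ∃ i j, ¬ PresT (Equiv.swap i j) n := by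
  decide +kernel

theorem pres_A : ∀ n ∈ listA, PresP (Equiv.swap (0 : Fin 6) 1) n := by decide +kernel

theorem pres_B : ∀ n ∈ listB, PresP (Equiv.swap (2 : Fin 6) 3) n := by decide +kernel

theorem pres_C : ∀ n ∈ listC,
    PresP (Equiv.swap (0 : Fin 6) 1 * Equiv.swap 2 3 * Equiv.swap 4 5 : Equiv.Perm (Fin 6)) n := by
  decide +kernel

theorem pres_CT : ∀ n ∈ listCT,
    PresT (Equiv.swap (0 : Fin 6) 1 * Equiv.swap 2 3 * Equiv.swap 4 5 : Equiv.Perm (Fin 6)) n := by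
  decide +kernel

theorem pres_D : ∀ n ∈ listD,
    PresP (Equiv.swap (0 : Fin 6) 2 * Equiv.swap 1 3 * Equiv.swap 4 5 : Equiv.Perm (Fin 6)) n := by
  decide +kernel

theorem pres_DT : ∀ n ∈ listDT,
    PresT (Equiv.swap (0 : Fin 6) 2 * Equiv.swap 1 3 * Equiv.swap 4 5 : Equiv.Perm (Fin 6)) n := by
  decide +kernel

theorem cases_one (s : Equiv.Perm (Fin 6)) :
    (∃ n ∈ listA, PresP s n) ∨ (∃ n ∈ listB, PresP s n) ∨ IsSix s := by
  refine forall_perm_of_values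
    (fun f => (∃ n ∈ listA, PresP f n) ∨ (∃ n ∈ listB, PresP f n) ∨ IsSix f) ?_ s
  decide +kernel

theorem cases_two (s : Equiv.Perm (Fin 6)) :
    (∃ n ∈ listC, PresP s n) ∨ (∃ n ∈ listD, PresP s n) ∨
    (∃ n ∈ listCT, PresT s n) ∨ (∃ n ∈ listDT, PresT s n) ∨ IsTwoThree s := by
  refine forall_perm_of_values
    (fun f => (∃ n ∈ listC, PresP f n) ∨ (∃ n ∈ listD, PresP f n) ∨
      (∃ n ∈ listCT, PresT f n) ∨ (∃ n ∈ listDT, PresT f n) ∨ IsTwoThree f) ?_ s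
  decide +kernel

theorem part_one (s : Equiv.Perm (Fin 6))
    (h1 : Subgroup.closure {Equiv.swap (0 : Fin 6) 1, s} = ⊤)
    (h2 : Subgroup.closure {Equiv.swap (2 : Fin 6) 3, s} = ⊤) : s.cycleType = {6} := by
  rcases cases_one s with ⟨n, hn, h⟩ | ⟨n, hn, h⟩ | h
  · exact absurd h1 (not_closure_P _ s n (pres_A n hn) h (proper_P n (by simp [hn])))
  · exact absurd h2 (not_closure_P _ s n (pres_B n hn) h (proper_P n (by simp [hn])))
  · exact h.cycleType

theorem part_two (s : Equiv.Perm (Fin 6))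
    (h1 : Subgroup.closure
      {Equiv.swap (0 : Fin 6) 1 * Equiv.swap 2 3 * Equiv.swap 4 5, s} = ⊤)
    (h2 : Subgroup.closure
      {Equiv.swap (0 : Fin 6) 2 * Equiv.swap 1 3 * Equiv.swap 4 5, s} = ⊤) :
    s.cycleType = {2, 3} := by
  rcases cases_two s with ⟨n, hn, h⟩ | ⟨n, hn, h⟩ | ⟨n, hn, h⟩ | ⟨n, hn, h⟩ | h
  · exact absurd h1 (not_closure_P _ s n (pres_C n hn) h (proper_P n (by simp [hn])))
  · exact absurd h2 (not_closure_P _ s n (pres_D n hn) h (proper_P n (by simp [hn])))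
  · exact absurd h1 (not_closure_T _ s n (pres_CT n hn) h (proper_T n (by simp [hn])))
  · exact absurd h2 (not_closure_T _ s n (pres_DT n hn) h (proper_T n (by simp [hn])))
  · exact h.cycleType

/-- In `S₆`: (i) every `s` with `⟨(1,2), s⟩ = S₆` and `⟨(3,4), s⟩ = S₆` is a 6-cycle;
(ii) every `s` with `⟨(1,2)(3,4)(5,6), s⟩ = S₆` and `⟨(1,3)(2,4)(5,6), s⟩ = S₆` has
cycle type `{2, 3}`. In particular, no element of `A₆` satisfies the hypotheses of (i),
and no single conjugacy class of `S₆` contains common generating partners for both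
pairs; hence the uniform spread of `S₆` is 1, not 2. -/
theorem stmt_13 :
    (∀ s : Equiv.Perm (Fin 6),
       Subgroup.closure {Equiv.swap (0 : Fin 6) 1, s} = ⊤ →
       Subgroup.closure {Equiv.swap (2 : Fin 6) 3, s} = ⊤ →
       s.cycleType = {6}) ∧
    (∀ s : Equiv.Perm (Fin 6),
       Subgroup.closure {Equiv.swap (0 : Fin 6) 1 * Equiv.swap 2 3 * Equiv.swap 4 5, s} = ⊤ →
       Subgroup.closure {Equiv.swap (0 : Fin 6) 2 * Equiv.swap 1 3 * Equiv.swap 4 5, s} = ⊤ →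
       s.cycleType = {2, 3}) ∧
    (∀ s : Equiv.Perm (Fin 6), s ∈ alternatingGroup (Fin 6) →
       ¬ (Subgroup.closure {Equiv.swap (0 : Fin 6) 1, s} = ⊤ ∧
          Subgroup.closure {Equiv.swap (2 : Fin 6) 3, s} = ⊤)) ∧
    (¬ ∃ s₁ s₂ : Equiv.Perm (Fin 6), IsConj s₁ s₂ ∧
        Subgroup.closure {Equiv.swap (0 : Fin 6) 1, s₁} = ⊤ ∧
        Subgroup.closure {Equiv.swap (2 : Fin 6) 3, s₁} = ⊤ ∧
        Subgroup.closure {Equiv.swap (0 : Fin 6) 1 * Equiv.swap 2 3 * Equiv.swap 4 5, s₂} = ⊤ ∧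
        Subgroup.closure {Equiv.swap (0 : Fin 6) 2 * Equiv.swap 1 3 * Equiv.swap 4 5, s₂} = ⊤) := by
  refine ⟨part_one, part_two, ?_, ?_⟩
  · rintro s hs ⟨h1, h2⟩
    have h6 := part_one s h1 h2
    rw [Equiv.Perm.mem_alternatingGroup, Equiv.Perm.sign_of_cycleType, h6] at hs
    revert hs
    decide
  · rintro ⟨s₁, s₂, hc, h1, h2, h3, h4⟩
    have h := Equiv.Perm.isConj_iff_cycleType_eq.mp hc
    rw [part_one s₁ h1 h2, part_two s₂ h3 h4] at h
    revert h
    decide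
end

section
/- For the alternating group A₇ (of order 2520), P(A₇) = 2/5, and this value is attained exactly for s of order 7. Precisely: (i) for every s ∈ A₇ of order 7 and every nonidentity g ∈ A₇, the number of h ∈ A₇ with ⟨h⁻¹sh, g⟩ ≠ A₇ is at most 1008 = (2/5)·|A₇|, and there is a nonidentity g for which this number equals 1008; (ii) for every nonidentity s ∈ A₇ of order different from 7, there exists a nonidentity g ∈ A₇ such that the number of h ∈ A₇ with ⟨h⁻¹sh, g⟩ ≠ A₇ is strictly greater than 1008. -/
/-- `A₇` viewed as a group in its own right. -/
abbrev A7 : Type := alternatingGroup (Fin 7)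

namespace A7P

open Equiv Equiv.Perm

def ap (c i : ℕ) : ℕ := Nat.land (Nat.shiftRight c (Nat.mul 3 i)) 7
/-- sum of `f` over a list -/
def sm (f : ℕ → ℕ) (l : List ℕ) : ℕ := List.rec 0 (fun d _ ih => Nat.add (f d) ih) l
/-- remove an element from a list -/
def rm (d : ℕ) (l : List ℕ) : List ℕ :=
  List.rec [] (fun e l ih => Bool.rec (e :: ih) l (Nat.beq e d)) l
/-- all codes with given leading digits `c`, and `n` further digits taken from `l` -/
def gen : ℕ → List ℕ → ℕ → List ℕ
  | 0, _, c => [c]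
  | n + 1, l, c => l.flatMap fun d => gen n (rm d l) (Nat.add (Nat.mul 8 c) d)
/-- a version of `countP p (gen n l c)` that the kernel evaluates quickly -/
def cnt (p : ℕ → Bool) (n : ℕ) : List ℕ → ℕ → ℕ :=
  Nat.rec (fun _ c => Bool.rec 0 1 (p c))
    (fun _ ih l c => sm (fun d => ih (rm d l) (Nat.add (Nat.mul 8 c) d)) l) n
def allCodes : List ℕ := gen 7 [0, 1, 2, 3, 4, 5, 6] 0
def T1 : ℕ := 137815226640313105803225825897450671975322520
def T2 : ℕ := 142392216300128223952251696506132148939449576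
def isQ1 (b : ℕ) : Bool :=
  Nat.beq (ap b 3) (ap T1 (Nat.add (Nat.mul 7 (ap b 0)) (ap b 1))) &&
  Nat.beq (ap b 4) (ap T1 (Nat.add (Nat.mul 7 (ap b 1)) (ap b 2))) &&
  Nat.beq (ap b 5) (ap T1 (Nat.add (Nat.mul 7 (ap b 2)) (ap b 3))) &&
  Nat.beq (ap b 6) (ap T1 (Nat.add (Nat.mul 7 (ap b 3)) (ap b 4))) &&
  Nat.beq (ap b 0) (ap T1 (Nat.add (Nat.mul 7 (ap b 4)) (ap b 5))) &&
  Nat.beq (ap b 1) (ap T1 (Nat.add (Nat.mul 7 (ap b 5)) (ap b 6))) &&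
  Nat.beq (ap b 2) (ap T1 (Nat.add (Nat.mul 7 (ap b 6)) (ap b 0)))
def isQ2 (b : ℕ) : Bool :=
  Nat.beq (ap b 3) (ap T2 (Nat.add (Nat.mul 7 (ap b 0)) (ap b 2))) &&
  Nat.beq (ap b 4) (ap T2 (Nat.add (Nat.mul 7 (ap b 1)) (ap b 3))) &&
  Nat.beq (ap b 5) (ap T2 (Nat.add (Nat.mul 7 (ap b 2)) (ap b 4))) &&
  Nat.beq (ap b 6) (ap T2 (Nat.add (Nat.mul 7 (ap b 3)) (ap b 5))) &&
  Nat.beq (ap b 0) (ap T2 (Nat.add (Nat.mul 7 (ap b 4)) (ap b 6))) &&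
  Nat.beq (ap b 1) (ap T2 (Nat.add (Nat.mul 7 (ap b 5)) (ap b 0))) &&
  Nat.beq (ap b 2) (ap T2 (Nat.add (Nat.mul 7 (ap b 6)) (ap b 1)))
def cj (r c : ℕ) : ℕ :=
  Nat.add (Nat.mul (ap c (ap r 0)) (Nat.pow 8 (ap c 0))) (
  Nat.add (Nat.mul (ap c (ap r 1)) (Nat.pow 8 (ap c 1))) (
  Nat.add (Nat.mul (ap c (ap r 2)) (Nat.pow 8 (ap c 2))) (
  Nat.add (Nat.mul (ap c (ap r 3)) (Nat.pow 8 (ap c 3))) (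
  Nat.add (Nat.mul (ap c (ap r 4)) (Nat.pow 8 (ap c 4))) (
  Nat.add (Nat.mul (ap c (ap r 5)) (Nat.pow 8 (ap c 5))) (Nat.mul (ap c (ap r 6)) (Nat.pow 8 (ap c 6))))))))
def inB (b : ℕ) : Bool := isQ1 b || isQ2 b
/-- code of the inverse permutation -/
def ic (c : ℕ) : ℕ :=
  Nat.add (Nat.pow 8 (ap c 1)) (Nat.add (Nat.mul 2 (Nat.pow 8 (ap c 2)))
  (Nat.add (Nat.mul 3 (Nat.pow 8 (ap c 3))) (Nat.add (Nat.mul 4 (Nat.pow 8 (ap c 4)))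
  (Nat.add (Nat.mul 5 (Nat.pow 8 (ap c 5))) (Nat.mul 6 (Nat.pow 8 (ap c 6)))))))
def nx (b j k : ℕ) (c i : ℕ) : ℕ := Nat.mod (Nat.add (ap b (Nat.mod (Nat.add (ap c k) j) 7)) i) 7
def mv (w : ℕ → ℕ) : ℕ := [0, 1, 2, 3, 4, 5, 6].countP fun k => !(Nat.beq (w k) k)
def tst (b c i j : ℕ) : Bool :=
  (Nat.beq (mv fun k => nx b j k c i) 3) || (Nat.beq (mv fun k => nx b j (nx b j k c i) c i) 3)
def tsts (b c : ℕ) : Bool :=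
  [0, 1, 2, 3, 4, 5, 6].any fun i => [0, 1, 2, 3, 4, 5, 6].any fun j => tst b c i j
/-- for a permutation fixing `0`: it lies in one of the two copies of `L₂(7)`, or some short word
is a 3-cycle, or it is one of three odd elements of the normalizer -/
def chk (c : ℕ) : Bool :=
  !(Nat.beq (ap c 0) 0) || (inB c || (tsts (ic c) c || (tsts c c ||
    (Nat.beq c 1103256 || (Nat.beq c 680680 || Nat.beq c 342384)))))
def hasP (r c : ℕ) : Bool := [0, 1, 2, 3, 4, 5, 6].any fun x =>
  Nat.beq (ap r (ap r x)) x && (Nat.blt 2 (ap c x) && Nat.blt 2 (ap c (ap r x)))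

theorem ap_eq (c i : ℕ) : ap c i = c / 8 ^ i % 8 := by
  have h1 : Nat.land (Nat.shiftRight c (Nat.mul 3 i)) 7 = (c >>> (3 * i)) &&& (2 ^ 3 - 1) := rfl
  rw [ap, h1, Nat.and_two_pow_sub_one_eq_mod, Nat.shiftRight_eq_div_pow, pow_mul]
  rfl

/-- the code of a permutation: its values are octal digits -/
def code (x : Perm (Fin 7)) : ℕ := ∑ i : Fin 7, (x i).val * 8 ^ i.val

theorem ap_code (x : Perm (Fin 7)) (k : Fin 7) : ap (code x) k.val = (x k).val := by
  rw [ap_eq, code, Fin.sum_univ_seven]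
  have h : ∀ i, (x i).val < 7 := fun i => (x i).isLt
  have h0 := h 0
  have h1 := h 1
  have h2 := h 2
  have h3 := h 3
  have h4 := h 4
  have h5 := h 5
  have h6 := h 6
  fin_cases k <;> simp <;> omega

theorem code_inj : Function.Injective code := by
  intro x y h
  ext k
  rw [← ap_code, h, ap_code]

theorem sm_eq (f : ℕ → ℕ) (l : List ℕ) : sm f l = (l.map f).sum := by
  induction l with
  | nil => rfl
  | cons d l ih => rw [List.map_cons, List.sum_cons, ← ih]; rfl

theorem cnt_eq (p : ℕ → Bool) (n : ℕ) : ∀ l c, cnt p n l c = (gen n l c).countP p := by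
  induction n with
  | zero =>
    intro l c
    have h : cnt p 0 l c = Bool.rec 0 1 (p c) := rfl
    rw [h, gen]
    cases hp : p c <;> simp [hp]
  | succ n ih =>
    intro l c
    have h : cnt p (n + 1) l c = sm (fun d => cnt p n (rm d l) (Nat.add (Nat.mul 8 c) d)) l := rfl
    rw [h, sm_eq, gen, List.countP_flatMap]
    congr 1
    apply List.map_congr_left
    intro d _
    exact ih _ _

theorem countP_cnt (p : ℕ → Bool) : allCodes.countP p = cnt p 7 [0, 1, 2, 3, 4, 5, 6] 0 :=
  (cnt_eq p 7 _ _).symm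

theorem mem_rm {d e : ℕ} (hne : e ≠ d) (l : List ℕ) (h : e ∈ l) : e ∈ rm d l := by
  induction l with
  | nil => simp at h
  | cons a l ih =>
    have hr : rm d (a :: l) = Bool.rec (a :: rm d l) l (Nat.beq a d) := rfl
    rw [hr]
    cases hb : Nat.beq a d with
    | false =>
      rcases List.mem_cons.1 h with h | h
      · exact List.mem_cons.2 (Or.inl h)
      · exact List.mem_cons.2 (Or.inr (ih h))
    | true =>
      have had : a = d := Nat.eq_of_beq_eq_true hb
      rcases List.mem_cons.1 h with h | h
      · exact absurd (h.trans had) hne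
      · exact h

theorem gen_mem : ∀ (l avail : List ℕ) (c : ℕ), l.Nodup → (∀ d ∈ l, d ∈ avail) →
    l.foldl (fun c d => 8 * c + d) c ∈ gen l.length avail c
  | [], _, _, _, _ => by simp [gen]
  | d :: l, avail, c, hn, hs => by
    rw [List.nodup_cons] at hn
    rw [List.length_cons, gen, List.mem_flatMap]
    refine ⟨d, hs d (by simp), gen_mem l _ _ hn.2 ?_⟩
    intro e he
    have hne : e ≠ d := by rintro rfl; exact hn.1 he
    exact mem_rm hne _ (hs e (by simp [he]))

theorem code_mem (x : Perm (Fin 7)) : code x ∈ allCodes := by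
  have h := gen_mem (List.ofFn fun i : Fin 7 => (x i.rev).val) [0, 1, 2, 3, 4, 5, 6] 0
    (List.nodup_ofFn.2 (Fin.val_injective.comp (x.injective.comp Fin.rev_injective))) (by
      intro d hd
      obtain ⟨i, rfl⟩ := (List.mem_ofFn' _ _).1 hd
      have := (x i.rev).isLt
      simp only [List.mem_cons, List.not_mem_nil, or_false]
      omega)
  rw [List.length_ofFn] at h
  have e : (List.ofFn fun i : Fin 7 => (x i.rev).val).foldl (fun c d => 8 * c + d) 0 = code x := by
    simp [code, Fin.sum_univ_seven, Fin.rev]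
    ring
  rw [e] at h
  exact h

theorem allCodes_length : allCodes.length = 5040 := by
  rw [← List.countP_true, countP_cnt]
  decide +kernel

theorem toFinset_allCodes : allCodes.toFinset = Finset.univ.image code ∧ allCodes.Nodup := by
  have h1 : Finset.univ.image code ⊆ allCodes.toFinset := by
    intro c hc
    obtain ⟨x, -, rfl⟩ := Finset.mem_image.1 hc
    exact List.mem_toFinset.2 (code_mem x)
  have h2 : (Finset.univ.image code).card = 5040 := by
    rw [Finset.card_image_of_injective _ code_inj, Finset.card_univ, Fintype.card_perm,
      Fintype.card_fin]
    rfl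
  have h3 := allCodes.toFinset_card_le
  have h4 := Finset.card_le_card h1
  rw [allCodes_length] at h3
  refine ⟨(Finset.eq_of_subset_of_card_le h1 (by omega)).symm, ?_⟩
  rw [← Multiset.coe_nodup]
  apply Multiset.toFinset_card_eq_card_iff_nodup.1
  change allCodes.toFinset.card = allCodes.length
  rw [allCodes_length]
  omega

theorem card_code (p : ℕ → Bool) :
    Nat.card {x : Perm (Fin 7) // p (code x) = true} = allCodes.countP p := by
  rw [Nat.card_eq_fintype_card, Fintype.card_subtype, List.countP_eq_length_filter,
    ← List.toFinset_card_of_nodup (toFinset_allCodes.2.filter _), List.toFinset_filter,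
    toFinset_allCodes.1, Finset.filter_image, Finset.card_image_of_injective _ code_inj]

theorem cj_code (r x : Perm (Fin 7)) : cj (code r) (code x) = code (x * r * x⁻¹) := by
  have h : code (x * r * x⁻¹) = ∑ i : Fin 7, (x (r i)).val * 8 ^ (x i).val := by
    rw [code, ← Equiv.sum_comp x]
    simp
  have e : ∀ k : Fin 7, ap (code x) (ap (code r) k.val) = (x (r k)).val := by
    intro k
    rw [ap_code, ap_code]
  rw [h, Fin.sum_univ_seven, ← e, ← e, ← e, ← e, ← e, ← e, ← e, ← ap_code, ← ap_code, ← ap_code,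
    ← ap_code, ← ap_code, ← ap_code, ← ap_code]
  simp only [cj, Nat.add_eq, Nat.mul_eq, Nat.pow_eq]
  simp [add_assoc]

theorem ic_code (x : Perm (Fin 7)) : ic (code x) = code x⁻¹ := by
  have h : code x⁻¹ = ∑ i : Fin 7, i.val * 8 ^ (x i).val := by
    rw [code, ← Equiv.sum_comp x]
    simp
  rw [h, Fin.sum_univ_seven, ← ap_code, ← ap_code, ← ap_code,
    ← ap_code, ← ap_code, ← ap_code, ← ap_code]
  simp only [ic, Nat.add_eq, Nat.mul_eq, Nat.pow_eq]
  simp [add_assoc]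

/-! ### the two Fano planes -/

theorem tab1_lt : ∀ a b : Fin 7, ap T1 (7 * a.val + b.val) < 7 := by decide +kernel
theorem tab2_lt : ∀ a b : Fin 7, ap T2 (7 * a.val + b.val) < 7 := by decide +kernel

def t1 (a b : Fin 7) : Fin 7 := ⟨ap T1 (7 * a.val + b.val), tab1_lt a b⟩
def t2 (a b : Fin 7) : Fin 7 := ⟨ap T2 (7 * a.val + b.val), tab2_lt a b⟩

/-- permutations respecting a binary operation -/
def Hom (t : Fin 7 → Fin 7 → Fin 7) : Subgroup (Perm (Fin 7)) where
  carrier := {x | ∀ a b, x (t a b) = t (x a) (x b)}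
  mul_mem' := by
    intro x y hx hy a b
    change (x * y) (t a b) = t ((x * y) a) ((x * y) b)
    rw [Perm.mul_apply, hy a b, hx (y a) (y b)]; rfl
  one_mem' := fun a b => rfl
  inv_mem' := by
    intro x hx a b
    apply x.injective
    rw [hx (x⁻¹ a) (x⁻¹ b)]
    simp

theorem mem_Hom {t x} : x ∈ Hom t ↔ ∀ a b, x (t a b) = t (x a) (x b) := Iff.rfl

/-- it suffices to check one product per line -/
theorem hom_of (t : Fin 7 → Fin 7 → Fin 7) (d : Fin 7) (hc : ∀ a b, t a b = t b a)
    (hi : ∀ a, t a a = a) (h2 : ∀ a b, t a (t a b) = b) (h3 : ∀ i, t i (i + d) = i + 3)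
    (hcov : ∀ a b : Fin 7, a = b ∨ ∃ i, (a = i ∧ b = i + d) ∨ (a = i ∧ b = i + 3) ∨
      (a = i + d ∧ b = i + 3) ∨ (b = i ∧ a = i + d) ∨ (b = i ∧ a = i + 3) ∨
      (b = i + d ∧ a = i + 3))
    (x : Perm (Fin 7)) (hx : ∀ i, x (i + 3) = t (x i) (x (i + d))) : x ∈ Hom t := by
  have k1 : ∀ i, x (t i (i + d)) = t (x i) (x (i + d)) := fun i => by rw [h3, hx]
  have k2 : ∀ i, x (t i (i + 3)) = t (x i) (x (i + 3)) := fun i => by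
    rw [hx, h2, ← h3, h2]
  have k3 : ∀ i, x (t (i + d) (i + 3)) = t (x (i + d)) (x (i + 3)) := fun i => by
    rw [hx, hc (x i), h2, ← h3, hc i, h2]
  intro a b
  rcases hcov a b with rfl | ⟨i, ⟨rfl, rfl⟩ | ⟨rfl, rfl⟩ | ⟨rfl, rfl⟩ | ⟨rfl, rfl⟩ | ⟨rfl, rfl⟩ |
    ⟨rfl, rfl⟩⟩
  · rw [hi, hi]
  · exact k1 _
  · exact k2 _
  · exact k3 _
  · rw [hc, k1, hc]
  · rw [hc, k2, hc]
  · rw [hc, k3, hc]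

theorem isQ1_iff (x : Perm (Fin 7)) : isQ1 (code x) = true ↔ x ∈ Hom t1 := by
  have h : isQ1 (code x) = true ↔ ∀ i, x (i + 3) = t1 (x i) (x (i + 1)) := by
    have e : ∀ i : Fin 7, x (i + 3) = t1 (x i) (x (i + 1)) ↔ Nat.beq (ap (code x) (i + 3).val)
        (ap T1 (Nat.add (Nat.mul 7 (ap (code x) i.val)) (ap (code x) (i + 1).val))) = true := by
      intro i
      rw [ap_code, ap_code, ap_code, Nat.beq_eq, Fin.ext_iff]
      rfl
    simp only [e, Fin.forall_fin_succ, isQ1, Bool.and_eq_true]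
    simp
    tauto
  rw [h]
  refine ⟨hom_of t1 1 (by decide +kernel) (by decide +kernel) (by decide +kernel)
    (by decide +kernel) (by decide +kernel) x, fun hx i => ?_⟩
  rw [← hx]
  congr 1
  revert i
  decide +kernel

theorem isQ2_iff (x : Perm (Fin 7)) : isQ2 (code x) = true ↔ x ∈ Hom t2 := by
  have h : isQ2 (code x) = true ↔ ∀ i, x (i + 3) = t2 (x i) (x (i + 2)) := by
    have e : ∀ i : Fin 7, x (i + 3) = t2 (x i) (x (i + 2)) ↔ Nat.beq (ap (code x) (i + 3).val)
        (ap T2 (Nat.add (Nat.mul 7 (ap (code x) i.val)) (ap (code x) (i + 2).val))) = true := by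
      intro i
      rw [ap_code, ap_code, ap_code, Nat.beq_eq, Fin.ext_iff]
      rfl
    simp only [e, Fin.forall_fin_succ, isQ2, Bool.and_eq_true]
    simp
    tauto
  rw [h]
  refine ⟨hom_of t2 2 (by decide +kernel) (by decide +kernel) (by decide +kernel)
    (by decide +kernel) (by decide +kernel) x, fun hx i => ?_⟩
  rw [← hx]
  congr 1
  revert i
  decide +kernel

theorem inB_iff (x : Perm (Fin 7)) : inB (code x) = true ↔ x ∈ Hom t1 ∨ x ∈ Hom t2 := by
  rw [inB, Bool.or_eq_true, isQ1_iff, isQ2_iff]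

/-! ### generation -/

/-- the 7-cycle `x ↦ x + 1` -/
def r7 : Perm (Fin 7) := ⟨![1, 2, 3, 4, 5, 6, 0], ![6, 0, 1, 2, 3, 4, 5], by decide, by decide⟩

theorem r7_apply : ∀ k : Fin 7, (r7 k).val = (k.val + 1) % 7 := by decide +kernel

theorem r7_pow_apply (j : ℕ) (k : Fin 7) : ((r7 ^ j) k).val = (k.val + j) % 7 := by
  induction j with
  | zero => simp; omega
  | succ n ih => rw [pow_succ', Perm.mul_apply, r7_apply, ih]; omega

theorem r7_hom1 : r7 ∈ Hom t1 := by
  rw [mem_Hom]; decide +kernel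

theorem r7_hom2 : r7 ∈ Hom t2 := by
  rw [mem_Hom]; decide +kernel

theorem r7_sign : sign r7 = 1 := by decide +kernel

theorem nx_code (y x : Perm (Fin 7)) (i j : ℕ) (k : Fin 7) :
    nx (code y) j k.val (code x) i = ((r7 ^ i * y * r7 ^ j * x) k).val := by
  rw [nx, ap_code]
  have e : Nat.mod (Nat.add (x k).val j) 7 = ((r7 ^ j) (x k)).val := (r7_pow_apply j (x k)).symm
  rw [e, ap_code]
  exact (r7_pow_apply i _).symm

theorem mv_eq (w : ℕ → ℕ) (W : Perm (Fin 7)) (h : ∀ k : Fin 7, w k.val = (W k).val) :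
    mv w = W.support.card := by
  have e : ∀ k : Fin 7, (!(Nat.beq (w k.val) k.val)) = decide (W k ≠ k) := by
    intro k
    rw [h, decide_not]
    congr 1
    rw [Bool.eq_iff_iff, Nat.beq_eq, decide_eq_true_iff, Fin.ext_iff]
  have e2 : mv w = ((List.finRange 7).map Fin.val).countP fun k => !(Nat.beq (w k) k) := rfl
  have e3 : W.support = Finset.univ.filter fun k => W k ≠ k := by ext; simp
  rw [e2, List.countP_map, e3, List.countP_eq_length_filter]
  have e4 : ((fun k => !(Nat.beq (w k) k)) ∘ Fin.val) = fun k : Fin 7 => decide (W k ≠ k) :=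
    funext e
  rw [e4]
  rfl

theorem tst_spec (y x : Perm (Fin 7)) (i j : ℕ) (h : tst (code y) (code x) i j = true) :
    ((r7 ^ i * y * r7 ^ j * x)).IsThreeCycle ∨
      ((r7 ^ i * y * r7 ^ j * x) * (r7 ^ i * y * r7 ^ j * x)).IsThreeCycle := by
  rw [tst, Bool.or_eq_true, Nat.beq_eq, Nat.beq_eq,
    mv_eq _ (r7 ^ i * y * r7 ^ j * x) (fun k => nx_code y x i j k),
    mv_eq _ ((r7 ^ i * y * r7 ^ j * x) * (r7 ^ i * y * r7 ^ j * x)) (fun k => by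
      rw [nx_code, nx_code]; rfl)] at h
  rwa [card_support_eq_three_iff, card_support_eq_three_iff] at h

theorem tsts_spec (y x : Perm (Fin 7)) (K : Subgroup (Perm (Fin 7))) (h7 : r7 ∈ K) (hy : y ∈ K)
    (hx : x ∈ K) (h : tsts (code y) (code x) = true) : ∃ w ∈ K, w.IsThreeCycle := by
  rw [tsts, List.any_eq_true] at h
  obtain ⟨i, -, h⟩ := h
  rw [List.any_eq_true] at h
  obtain ⟨j, -, h⟩ := h
  have hw : r7 ^ i * y * r7 ^ j * x ∈ K :=
    K.mul_mem (K.mul_mem (K.mul_mem (K.pow_mem h7 i) hy) (K.pow_mem h7 j)) hx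
  rcases tst_spec y x i j h with h | h
  · exact ⟨_, hw, h⟩
  · exact ⟨_, K.mul_mem hw hw, h⟩

theorem alt_le (K : Subgroup (Perm (Fin 7))) (h7 : r7 ∈ K) (h : ∃ w ∈ K, w.IsThreeCycle) :
    alternatingGroup (Fin 7) ≤ K := by
  obtain ⟨w, hw, h3⟩ := h
  have ht : MulAction.IsPretransitive K (Fin 7) := by
    refine ⟨fun a b => ⟨⟨r7 ^ (7 - a.val + b.val), K.pow_mem h7 _⟩, ?_⟩⟩
    apply Fin.ext
    change ((r7 ^ (7 - a.val + b.val)) a).val = b.val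
    rw [r7_pow_apply]
    omega
  have hp : MulAction.IsPreprimitive K (Fin 7) :=
    MulAction.IsPreprimitive.of_prime_card (by rw [Nat.card_eq_fintype_card, Fintype.card_fin]; norm_num)
  exact alternatingGroup_le_of_isPreprimitive_of_isThreeCycle_mem hp h3 hw

theorem all_chk (c : ℕ) (hc : c ∈ allCodes) : chk c = true := by
  have h : (allCodes.countP fun c => !(chk c)) = 0 := by
    rw [countP_cnt]
    decide +kernel
  rw [List.countP_eq_zero] at h
  simpa using h c hc

def m3 : Perm (Fin 7) := ⟨![0, 3, 6, 2, 5, 1, 4], ![0, 5, 3, 1, 6, 4, 2], by decide, by decide⟩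
def m5 : Perm (Fin 7) := ⟨![0, 5, 3, 1, 6, 4, 2], ![0, 3, 6, 2, 5, 1, 4], by decide, by decide⟩
def m6 : Perm (Fin 7) := ⟨![0, 6, 5, 4, 3, 2, 1], ![0, 6, 5, 4, 3, 2, 1], by decide, by decide⟩

theorem generates (x : Perm (Fin 7)) (hs : sign x = 1) (h1 : x ∉ Hom t1) (h2 : x ∉ Hom t2) :
    alternatingGroup (Fin 7) ≤ Subgroup.closure {r7, x} := by
  set K := Subgroup.closure {r7, x} with hK
  have h7 : r7 ∈ K := Subgroup.subset_closure (by simp)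
  have hx : x ∈ K := Subgroup.subset_closure (by simp)
  obtain ⟨z, hz⟩ : ∃ z, z = r7 ^ (7 - (x 0).val) * x := ⟨_, rfl⟩
  have hzK : z ∈ K := hz ▸ K.mul_mem (K.pow_mem h7 _) hx
  have hz0 : (z 0).val = 0 := by
    rw [hz, Perm.mul_apply, r7_pow_apply]
    omega
  have hzs : sign z = 1 := by rw [hz, Perm.sign_mul, map_pow, r7_sign, hs]; simp
  have hz1 : z ∉ Hom t1 := by
    rw [hz, Subgroup.mul_mem_cancel_left _ (Subgroup.pow_mem _ r7_hom1 _)]; exact h1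
  have hz2 : z ∉ Hom t2 := by
    rw [hz, Subgroup.mul_mem_cancel_left _ (Subgroup.pow_mem _ r7_hom2 _)]; exact h2
  have hc := all_chk _ (code_mem z)
  rw [chk] at hc
  simp only [Bool.or_eq_true, Nat.beq_eq] at hc
  have e0 : ap (code z) 0 = 0 := (ap_code z 0).trans hz0
  rcases hc with h | h | h | h | h | h | h
  · rw [e0] at h; exact absurd h (by decide)
  · rcases (inB_iff z).1 h with h | h
    · exact absurd h hz1
    · exact absurd h hz2
  · rw [ic_code] at h
    exact alt_le K h7 (tsts_spec _ _ K h7 (K.inv_mem hzK) hzK h)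
  · exact alt_le K h7 (tsts_spec _ _ K h7 hzK hzK h)
  · have : z = m3 := code_inj (h.trans (by decide +kernel))
    rw [this] at hzs; exact absurd hzs (by decide +kernel)
  · have : z = m5 := code_inj (h.trans (by decide +kernel))
    rw [this] at hzs; exact absurd hzs (by decide +kernel)
  · have : z = m6 := code_inj (h.trans (by decide +kernel))
    rw [this] at hzs; exact absurd hzs (by decide +kernel)

/-- the 3-cycle `(0 1 2)` -/
def r3 : Perm (Fin 7) := ⟨![1, 2, 0, 3, 4, 5, 6], ![2, 0, 1, 3, 4, 5, 6], by decide, by decide⟩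

theorem closure_le_of_top {u v : A7} (h : Subgroup.closure {u, v} = ⊤)
    (K : Subgroup (Perm (Fin 7))) (hu : (u : Perm (Fin 7)) ∈ K) (hv : (v : Perm (Fin 7)) ∈ K)
    (w : Perm (Fin 7)) (hw : sign w = 1) : w ∈ K := by
  have h1 : Subgroup.closure {u, v} ≤ K.comap (alternatingGroup (Fin 7)).subtype := by
    rw [Subgroup.closure_le]
    rintro a (rfl | rfl)
    · exact hu
    · exact hv
  rw [h] at h1
  exact h1 (Subgroup.mem_top (⟨w, mem_alternatingGroup.2 hw⟩ : A7))

def s0 : A7 := ⟨r7, mem_alternatingGroup.2 r7_sign⟩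

theorem bad_iff (g : A7) : Subgroup.closure {s0, g} ≠ ⊤ ↔ inB (code g) = true := by
  rw [inB_iff]
  constructor
  · intro h
    by_contra hc
    rw [not_or] at hc
    apply h
    have hg := generates g (mem_alternatingGroup.1 g.2) hc.1 hc.2
    rw [eq_top_iff]
    intro w _
    have hw := hg w.2
    have e : Subgroup.closure {r7, (g : Perm (Fin 7))} =
        (Subgroup.closure {s0, g}).map (alternatingGroup (Fin 7)).subtype := by
      rw [MonoidHom.map_closure, Set.image_pair]
      rfl
    rw [e] at hw
    obtain ⟨w', hw', he⟩ := hw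
    rwa [← Subtype.ext (show (w' : Perm (Fin 7)) = w from he)]
  · rintro (h | h) ht
    · have := closure_le_of_top ht _ r7_hom1 h r3 (by decide +kernel)
      rw [mem_Hom] at this
      revert this
      decide +kernel
    · have := closure_le_of_top ht _ r7_hom2 h r3 (by decide +kernel)
      rw [mem_Hom] at this
      revert this
      decide +kernel

/-! ### counting -/

theorem halve (P : Perm (Fin 7) → Prop) (c : Perm (Fin 7)) (hc : sign c = -1)
    (hP : ∀ x, P (x * c) ↔ P x) :
    2 * Nat.card {h : A7 // P h} = Nat.card {x : Perm (Fin 7) // P x} := by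
  have hc' : sign c⁻¹ = -1 := by rw [Perm.sign_inv, hc]
  let f : {h : A7 // P h} ⊕ {h : A7 // P h} → {x : Perm (Fin 7) // P x} :=
    Sum.elim (fun h => ⟨h.1.1, h.2⟩) (fun h => ⟨h.1.1 * c, (hP _).2 h.2⟩)
  have hsgn : ∀ h : A7, sign (h : Perm (Fin 7)) = 1 := fun h => mem_alternatingGroup.1 h.2
  have hf : Function.Bijective f := by
    constructor
    · rintro (a | a) (b | b) hab
      · have := congrArg Subtype.val hab
        exact congrArg Sum.inl (Subtype.ext (Subtype.ext this))
      · have := congrArg (fun z => sign z.1) hab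
        simp [f, hsgn, hc] at this
      · have := congrArg (fun z => sign z.1) hab
        simp [f, hsgn, hc] at this
      · have := congrArg Subtype.val hab
        exact congrArg Sum.inr (Subtype.ext (Subtype.ext (mul_right_cancel this)))
    · rintro ⟨x, hx⟩
      rcases Int.units_eq_one_or (sign x) with h | h
      · exact ⟨Sum.inl ⟨⟨x, mem_alternatingGroup.2 h⟩, hx⟩, rfl⟩
      · refine ⟨Sum.inr ⟨⟨x * c⁻¹, mem_alternatingGroup.2 ?_⟩, ?_⟩, ?_⟩
        · rw [Perm.sign_mul, h, hc']; rfl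
        · rw [← hP]; simpa using hx
        · exact Subtype.ext (by simp [f])
  rw [← Nat.card_eq_of_bijective f hf, Nat.card_sum, two_mul]

/-- the number of `h` such that `⟨h⁻¹sh, g⟩` is a proper subgroup -/
noncomputable def F (s g : A7) : ℕ := Nat.card {h : A7 // Subgroup.closure {h⁻¹ * s * h, g} ≠ ⊤}

theorem F_map (φ : A7 ≃* A7) (s g : A7) : F (φ s) (φ g) = F s g := by
  symm
  refine Nat.card_congr (φ.toEquiv.subtypeEquiv fun h => ?_)
  have e : Subgroup.closure {(φ h)⁻¹ * φ s * φ h, φ g} =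
      (Subgroup.closure {h⁻¹ * s * h, g}).map φ.toMonoidHom := by
    rw [MonoidHom.map_closure, Set.image_pair]
    simp
  change _ ↔ Subgroup.closure {(φ h)⁻¹ * φ s * φ h, φ g} ≠ ⊤
  rw [e, not_iff_not]
  constructor
  · intro h; rw [h]; exact Subgroup.map_top_of_surjective _ φ.surjective
  · intro h
    apply Subgroup.map_injective (f := φ.toMonoidHom) φ.injective
    rw [h]; exact (Subgroup.map_top_of_surjective _ φ.surjective).symm

/-- conjugation by an arbitrary permutation -/
def cn (τ : Perm (Fin 7)) : A7 ≃* A7 := MulAut.conjNormal τ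

theorem cn_val (τ : Perm (Fin 7)) (g : A7) : (cn τ g : Perm (Fin 7)) = τ * g * τ⁻¹ :=
  MulAut.conjNormal_apply τ g

theorem bad_conj_iff (h g : A7) : Subgroup.closure {h⁻¹ * s0 * h, g} ≠ ⊤ ↔
    inB (code (h * g * (h : Perm (Fin 7))⁻¹)) = true := by
  have h2 := bad_iff (h * g * h⁻¹)
  rw [show ((h * g * h⁻¹ : A7) : Perm (Fin 7)) = h * g * (h : Perm (Fin 7))⁻¹ from rfl] at h2
  rw [← h2]
  have e : Subgroup.closure {s0, h * g * h⁻¹} =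
      (Subgroup.closure {h⁻¹ * s0 * h, g}).map (MulAut.conj h).toMonoidHom := by
    rw [MonoidHom.map_closure, Set.image_pair]
    simp [mul_assoc]
  rw [e, not_iff_not]
  constructor
  · intro h'; rw [h']; exact Subgroup.map_top_of_surjective _ (MulAut.conj h).surjective
  · intro h'
    apply Subgroup.map_injective (f := (MulAut.conj h).toMonoidHom) (MulAut.conj h).injective
    rw [h']; exact (Subgroup.map_top_of_surjective _ (MulAut.conj h).surjective).symm

theorem F_s0 (g : A7) :
    F s0 g = Nat.card {h : A7 // inB (code (h * g * (h : Perm (Fin 7))⁻¹)) = true} := by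
  unfold F
  exact Nat.card_congr (Equiv.subtypeEquivRight fun h => bad_conj_iff h g)

theorem card_conj (r g ρ : Perm (Fin 7)) (hg : ρ * r * ρ⁻¹ = g) :
    Nat.card {x : Perm (Fin 7) // inB (code (x * g * x⁻¹)) = true} =
      allCodes.countP fun c => inB (cj (code r) c) := by
  rw [← card_code]
  refine Nat.card_congr ((Equiv.mulRight ρ).subtypeEquiv fun x => ?_)
  rw [cj_code, ← hg]
  simp [mul_assoc]

theorem F_s0_rep (r : Perm (Fin 7)) (g : A7) (hg : IsConj r g)
    (hr : ∃ c, sign c = -1 ∧ c * r = r * c) :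
    2 * F s0 g = allCodes.countP fun c => inB (cj (code r) c) := by
  obtain ⟨ρ, hρ⟩ := isConj_iff.1 hg
  obtain ⟨c, hc, hcr⟩ := hr
  rw [F_s0, ← card_conj r g ρ hρ]
  refine halve (fun x => inB (code (x * g * x⁻¹)) = true) (ρ * c * ρ⁻¹) (by simp [hc]) fun x => ?_
  have e : x * (ρ * c * ρ⁻¹) * g * (x * (ρ * c * ρ⁻¹))⁻¹ = x * g * x⁻¹ := by
    rw [← hρ]
    calc x * (ρ * c * ρ⁻¹) * (ρ * r * ρ⁻¹) * (x * (ρ * c * ρ⁻¹))⁻¹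
        = x * ρ * (c * r) * c⁻¹ * ρ⁻¹ * x⁻¹ := by group
      _ = x * (ρ * r * ρ⁻¹) * x⁻¹ := by rw [hcr]; group
  simp only [e]

theorem F_s0_le (r : Perm (Fin 7)) (g : A7) (hg : IsConj r g) :
    F s0 g ≤ allCodes.countP fun c => inB (cj (code r) c) := by
  obtain ⟨ρ, hρ⟩ := isConj_iff.1 hg
  rw [F_s0, ← card_conj r g ρ hρ]
  exact Nat.card_le_card_of_injective
    (fun h : {h : A7 // inB (code (h * g * (h : Perm (Fin 7))⁻¹)) = true} =>
      (⟨h.1.1, h.2⟩ : {x : Perm (Fin 7) // inB (code (x * g * x⁻¹)) = true}))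
    (fun a b hab => by
      have h := congrArg Subtype.val hab
      exact Subtype.ext (Subtype.ext h))

/-! ### lower bounds from intransitive subgroups -/

theorem r3_sign : sign r3 = 1 := by decide +kernel

def t0 : A7 := ⟨r3, mem_alternatingGroup.2 r3_sign⟩

theorem hasP_iff (r y : Perm (Fin 7)) : hasP (code r) (code y) = true ↔
    ∃ a, r (r a) = a ∧ 2 < (y a).val ∧ 2 < (y (r a)).val := by
  have e2 : hasP (code r) (code y) = ((List.finRange 7).map Fin.val).any fun x =>
      Nat.beq (ap (code r) (ap (code r) x)) x && (Nat.blt 2 (ap (code y) x) &&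
        Nat.blt 2 (ap (code y) (ap (code r) x))) := rfl
  rw [e2, List.any_map, List.any_eq_true]
  refine exists_congr fun a => ?_
  simp only [List.mem_finRange, true_and, Function.comp, ap_code, Bool.and_eq_true, Nat.beq_eq,
    Nat.blt_eq, Fin.ext_iff]

theorem r3_fix : ∀ a : Fin 7, 2 < a.val → r3 a = a := by decide +kernel

theorem hasP_bad (r h : A7) (hp : hasP (code r) (code (h : Perm (Fin 7))⁻¹) = true) :
    Subgroup.closure {h⁻¹ * r * h, t0} ≠ ⊤ := by
  obtain ⟨a, ha, h1, h2⟩ := (hasP_iff _ _).1 hp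
  obtain ⟨p, hpd⟩ : ∃ p, p = (h : Perm (Fin 7))⁻¹ a := ⟨_, rfl⟩
  obtain ⟨q, hqd⟩ : ∃ q, q = (h : Perm (Fin 7))⁻¹ ((r : Perm (Fin 7)) a) := ⟨_, rfl⟩
  rw [← hpd] at h1
  rw [← hqd] at h2
  intro ht
  have hu1 : ((h⁻¹ * r * h : A7) : Perm (Fin 7)) p = q := by
    rw [hpd, hqd]; simp
  have hu2 : ((h⁻¹ * r * h : A7) : Perm (Fin 7)) q = p := by
    rw [hpd, hqd]; simp [ha]
  let K : Subgroup (Perm (Fin 7)) :=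
    { carrier := {x | ∀ z, (x z = p ∨ x z = q) ↔ (z = p ∨ z = q)}
      mul_mem' := fun {x y} hx hy z => (hx (y z)).trans (hy z)
      one_mem' := fun z => Iff.rfl
      inv_mem' := fun {x} hx z => by
        have := hx (x⁻¹ z)
        simpa using this.symm }
  have hK : r7 ∈ K := by
    refine closure_le_of_top ht K ?_ ?_ r7 r7_sign
    · intro z
      constructor
      · rintro (hz | hz)
        · right; rw [← hu2] at hz; exact Equiv.injective _ hz
        · left; rw [← hu1] at hz; exact Equiv.injective _ hz
      · rintro (rfl | rfl)
        · right; exact hu1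
        · left; exact hu2
    · have f1 : (t0 : Perm (Fin 7)) p = p := r3_fix p h1
      have f2 : (t0 : Perm (Fin 7)) q = q := r3_fix q h2
      intro z
      constructor
      · rintro (hz | hz)
        · left; rw [← f1] at hz; exact Equiv.injective _ hz
        · right; rw [← f2] at hz; exact Equiv.injective _ hz
      · rintro (rfl | rfl)
        · left; exact f1
        · right; exact f2
  have k1 : r7 p = p ∨ r7 p = q := (hK p).2 (Or.inl rfl)
  have k2 : r7 q = p ∨ r7 q = q := (hK q).2 (Or.inr rfl)
  clear hu1 hu2 hpd hqd h1 h2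
  clear hK K
  revert p q
  decide +kernel

/-- the transposition `(3 4)` -/
def sw : Perm (Fin 7) := ⟨![0, 1, 2, 4, 3, 5, 6], ![0, 1, 2, 4, 3, 5, 6], by decide, by decide⟩

theorem sw_gt : ∀ a : Fin 7, 2 < (sw⁻¹ a).val ↔ 2 < a.val := by decide +kernel

theorem F_t0 (r : A7) : allCodes.countP (hasP (code r)) ≤ 2 * F r t0 := by
  have h1 := halve (fun x => hasP (code r) (code x⁻¹) = true) sw (by decide +kernel) (fun x => by
    simp only [hasP_iff, mul_inv_rev, Perm.mul_apply, sw_gt])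
  have h2 : Nat.card {x : Perm (Fin 7) // hasP (code r) (code x⁻¹) = true} =
      allCodes.countP (hasP (code r)) := by
    rw [← card_code]
    exact Nat.card_congr ((Equiv.inv (Perm (Fin 7))).subtypeEquiv fun x => Iff.rfl)
  rw [← h2, ← h1]
  refine Nat.mul_le_mul_left 2 ?_
  exact Nat.card_le_card_of_injective
    (fun h : {h : A7 // hasP (code r) (code (h : Perm (Fin 7))⁻¹) = true} =>
      (⟨h.1, hasP_bad r h.1 h.2⟩ : {h : A7 // Subgroup.closure {h⁻¹ * r * h, t0} ≠ ⊤}))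
    (fun a b hab => by
      have h := congrArg Subtype.val hab
      exact Subtype.ext h)

/-! ### conjugacy classes -/

def r22 : Perm (Fin 7) := ⟨![1, 0, 3, 2, 4, 5, 6], ![1, 0, 3, 2, 4, 5, 6], by decide, by decide⟩
def r33 : Perm (Fin 7) := ⟨![1, 2, 0, 4, 5, 3, 6], ![2, 0, 1, 5, 3, 4, 6], by decide, by decide⟩
def r42 : Perm (Fin 7) := ⟨![1, 2, 3, 0, 5, 4, 6], ![3, 0, 1, 2, 5, 4, 6], by decide, by decide⟩
def r5 : Perm (Fin 7) := ⟨![1, 2, 3, 4, 0, 5, 6], ![4, 0, 1, 2, 3, 5, 6], by decide, by decide⟩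
def r322 : Perm (Fin 7) := ⟨![1, 2, 0, 4, 3, 6, 5], ![2, 0, 1, 4, 3, 6, 5], by decide, by decide⟩

theorem types (m : Multiset ℕ) (h2 : ∀ a ∈ m, 2 ≤ a) (hs : m.sum ≤ 7)
    (he : Even (m.sum + m.card)) :
    m = 0 ∨ m = {7} ∨ m = {2, 2} ∨ m = {3} ∨ m = {3, 3} ∨ m = {4, 2} ∨ m = {5} ∨
      m = {3, 2, 2} := by
  have hc : m.card * 2 ≤ m.sum := by
    simpa using Multiset.card_nsmul_le_sum h2
  have hc3 : m.card ≤ 3 := by omega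
  rw [Nat.even_iff] at he
  have hcases : m.card = 0 ∨ m.card = 1 ∨ m.card = 2 ∨ m.card = 3 := by omega
  rcases hcases with h | h | h | h
  · left; exact Multiset.card_eq_zero.1 h
  · obtain ⟨a, rfl⟩ := Multiset.card_eq_one.1 h
    simp only [Multiset.sum_singleton, Multiset.card_singleton] at hs he
    have := h2 a (by simp)
    interval_cases a <;> first | omega | decide
  · obtain ⟨a, b, rfl⟩ := Multiset.card_eq_two.1 h
    simp only [Multiset.insert_eq_cons, Multiset.sum_cons, Multiset.sum_singleton,
      Multiset.card_cons, Multiset.card_singleton] at hs he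
    have ha := h2 a (by simp)
    have hb := h2 b (by simp)
    have ha' : a ≤ 5 := by omega
    have hb' : b ≤ 5 := by omega
    interval_cases a <;> interval_cases b <;> first | omega | decide
  · obtain ⟨a, b, c, rfl⟩ := Multiset.card_eq_three.1 h
    simp only [Multiset.insert_eq_cons, Multiset.sum_cons, Multiset.sum_singleton,
      Multiset.card_cons, Multiset.card_singleton] at hs he
    have ha := h2 a (by simp)
    have hb := h2 b (by simp)
    have hc := h2 c (by simp)
    have ha' : a ≤ 3 := by omega
    have hb' : b ≤ 3 := by omega
    have hc' : c ≤ 3 := by omega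
    interval_cases a <;> interval_cases b <;> interval_cases c <;> first | omega | decide

/-- the facts needed about a class of elements of order different from 7 -/
structure Good (r : Perm (Fin 7)) : Prop where
  sgn : sign r = 1
  pow : r ^ 60 = 1
  cen : ∃ c, sign c = -1 ∧ c * r = r * c
  up : (allCodes.countP fun c => inB (cj (code r) c)) ≤ 2016
  low : 2016 < allCodes.countP (hasP (code r))

theorem code_r22 : code r22 = 1754305 := by decide +kernel
theorem code_r3 : code r3 = 1754641 := by decide +kernel
theorem code_r33 : code r33 = 1693713 := by decide +kernel
theorem code_r42 : code r42 = 1724625 := by decide +kernel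
theorem code_r5 : code r5 = 1738961 := by decide +kernel
theorem code_r322 : code r322 = 1521681 := by decide +kernel
theorem code_r7 : code r7 = 219345 := by decide +kernel

theorem count_r22 : (allCodes.countP fun c => inB (cj (code r22) c)) = 2016 := by
  rw [code_r22, countP_cnt]; decide +kernel

theorem count_r7 : (allCodes.countP fun c => inB (cj (code r7) c)) = 630 := by
  rw [code_r7, countP_cnt]; decide +kernel

theorem good_r22 : Good r22 where
  sgn := by decide +kernel
  pow := by decide +kernel
  cen := ⟨swap 0 1, by decide +kernel, by decide +kernel⟩
  up := count_r22.le
  low := by rw [code_r22, countP_cnt]; decide +kernel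

theorem good_r3 : Good r3 where
  sgn := by decide +kernel
  pow := by decide +kernel
  cen := ⟨swap 3 4, by decide +kernel, by decide +kernel⟩
  up := by rw [code_r3, countP_cnt]; decide +kernel
  low := by rw [code_r3, countP_cnt]; decide +kernel

theorem good_r33 : Good r33 where
  sgn := by decide +kernel
  pow := by decide +kernel
  cen := ⟨swap 0 3 * swap 1 4 * swap 2 5, by decide +kernel, by decide +kernel⟩
  up := by rw [code_r33, countP_cnt]; decide +kernel
  low := by rw [code_r33, countP_cnt]; decide +kernel

theorem good_r42 : Good r42 where
  sgn := by decide +kernel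
  pow := by decide +kernel
  cen := ⟨swap 4 5, by decide +kernel, by decide +kernel⟩
  up := by rw [code_r42, countP_cnt]; decide +kernel
  low := by rw [code_r42, countP_cnt]; decide +kernel

theorem good_r5 : Good r5 where
  sgn := by decide +kernel
  pow := by decide +kernel
  cen := ⟨swap 5 6, by decide +kernel, by decide +kernel⟩
  up := by rw [code_r5, countP_cnt]; decide +kernel
  low := by rw [code_r5, countP_cnt]; decide +kernel

theorem good_r322 : Good r322 where
  sgn := by decide +kernel
  pow := by decide +kernel
  cen := ⟨swap 3 4, by decide +kernel, by decide +kernel⟩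
  up := by rw [code_r322, countP_cnt]; decide +kernel
  low := by rw [code_r322, countP_cnt]; decide +kernel

theorem classify (g : Perm (Fin 7)) (hg : sign g = 1) (h1 : g ≠ 1) :
    IsConj r7 g ∨ ∃ r, Good r ∧ IsConj r g := by
  have h := types g.cycleType (fun a ha => two_le_of_mem_cycleType ha)
    (by rw [sum_cycleType]; exact (Finset.card_le_univ _).trans (by simp))
    (by
      rw [sign_of_cycleType] at hg
      by_contra hc
      rw [Nat.not_even_iff_odd] at hc
      rw [hc.neg_one_pow] at hg
      exact absurd hg (by decide))
  rcases h with h | h | h | h | h | h | h | h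
  · exact absurd (cycleType_eq_zero.1 h) h1
  · left
    exact isConj_iff_cycleType_eq.2 (Eq.trans (by decide +kernel) h.symm)
  · exact Or.inr ⟨r22, good_r22, isConj_iff_cycleType_eq.2 (Eq.trans (by decide +kernel) h.symm)⟩
  · exact Or.inr ⟨r3, good_r3, isConj_iff_cycleType_eq.2 (Eq.trans (by decide +kernel) h.symm)⟩
  · exact Or.inr ⟨r33, good_r33, isConj_iff_cycleType_eq.2 (Eq.trans (by decide +kernel) h.symm)⟩
  · exact Or.inr ⟨r42, good_r42, isConj_iff_cycleType_eq.2 (Eq.trans (by decide +kernel) h.symm)⟩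
  · exact Or.inr ⟨r5, good_r5, isConj_iff_cycleType_eq.2 (Eq.trans (by decide +kernel) h.symm)⟩
  · exact Or.inr ⟨r322, good_r322, isConj_iff_cycleType_eq.2 (Eq.trans (by decide +kernel) h.symm)⟩

theorem coe_ne_one {g : A7} (h : g ≠ 1) : (g : Perm (Fin 7)) ≠ 1 :=
  fun e => h (Subtype.ext e)

theorem F_s0_bound (g : A7) (hg : g ≠ 1) : F s0 g ≤ 1008 := by
  rcases classify g (mem_alternatingGroup.1 g.2) (coe_ne_one hg) with h | ⟨r, hr, h⟩
  · have := F_s0_le r7 g h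
    rw [count_r7] at this
    omega
  · have h1 := F_s0_rep r g h hr.cen
    have h2 := hr.up
    omega

theorem F_s0_eq : F s0 ⟨r22, mem_alternatingGroup.2 good_r22.sgn⟩ = 1008 := by
  have h1 := F_s0_rep r22 ⟨r22, mem_alternatingGroup.2 good_r22.sgn⟩ (IsConj.refl _) good_r22.cen
  rw [count_r22] at h1
  omega

theorem cn_eq {r : Perm (Fin 7)} (hr : r ∈ alternatingGroup (Fin 7)) {s : A7} {τ : Perm (Fin 7)}
    (h : τ * r * τ⁻¹ = s) : cn τ ⟨r, hr⟩ = s :=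
  Subtype.ext ((cn_val τ _).trans h)

theorem part1 (s : A7) (hs : orderOf s = 7) :
    (∀ g : A7, g ≠ 1 → F s g ≤ 1008) ∧ ∃ g : A7, g ≠ 1 ∧ F s g = 1008 := by
  have hs1 : s ≠ 1 := by rintro rfl; simp at hs
  rcases classify s (mem_alternatingGroup.1 s.2) (coe_ne_one hs1) with h | ⟨r, hr, h⟩
  · obtain ⟨τ, hτ⟩ := isConj_iff.1 h
    have e : cn τ s0 = s := cn_eq _ hτ
    constructor
    · intro g hg
      have := F_s0_bound ((cn τ).symm g) (by simpa using hg)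
      rwa [← F_map (cn τ), e, MulEquiv.apply_symm_apply] at this
    · refine ⟨cn τ ⟨r22, mem_alternatingGroup.2 good_r22.sgn⟩, ?_, ?_⟩
      · rw [Ne, EmbeddingLike.map_eq_one_iff]
        intro h
        have := congrArg Subtype.val h
        revert this
        change r22 ≠ 1
        decide +kernel
      · rw [← e, F_map, F_s0_eq]
  · exfalso
    obtain ⟨τ, hτ⟩ := isConj_iff.1 h
    have h60 : s ^ 60 = 1 := by
      apply Subtype.ext
      change (s : Perm (Fin 7)) ^ 60 = 1
      rw [← hτ, conj_pow, hr.pow]; simp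
    have := orderOf_dvd_of_pow_eq_one h60
    rw [hs] at this
    revert this
    decide

theorem part2 (s : A7) (hs1 : s ≠ 1) (hs : orderOf s ≠ 7) : ∃ g : A7, g ≠ 1 ∧ 1008 < F s g := by
  rcases classify s (mem_alternatingGroup.1 s.2) (coe_ne_one hs1) with h | ⟨r, hr, h⟩
  · exfalso
    obtain ⟨τ, hτ⟩ := isConj_iff.1 h
    have h7 : s ^ 7 = 1 := by
      apply Subtype.ext
      change (s : Perm (Fin 7)) ^ 7 = 1
      rw [← hτ, conj_pow, show r7 ^ 7 = 1 by decide +kernel]; simp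
    have : Fact (Nat.Prime 7) := ⟨by norm_num⟩
    exact hs (orderOf_eq_prime h7 hs1)
  · obtain ⟨τ, hτ⟩ := isConj_iff.1 h
    have hrm : r ∈ alternatingGroup (Fin 7) := mem_alternatingGroup.2 hr.sgn
    have e : cn τ ⟨r, hrm⟩ = s := cn_eq _ hτ
    refine ⟨cn τ t0, ?_, ?_⟩
    · rw [Ne, EmbeddingLike.map_eq_one_iff]
      intro h
      have := congrArg Subtype.val h
      revert this
      change r3 ≠ 1
      decide +kernel
    · rw [← e, F_map]
      have h1 := F_t0 ⟨r, hrm⟩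
      have h2 := hr.low
      change allCodes.countP (hasP (code r)) ≤ _ at h1
      omega

end A7P

/-- `P(A₇) = 2/5` (`= 1008/2520`), attained exactly for `s` of order 7:
(i) for every `s` of order 7 and nonidentity `g`, at most `1008 = (2/5)·|A₇|` elements
`h ∈ A₇` satisfy `⟨h⁻¹sh, g⟩ ≠ A₇`, with equality for some nonidentity `g`;
(ii) for every nonidentity `s` of order different from 7, some nonidentity `g`
gives strictly more than `1008` such elements `h`. -/
theorem stmt_14 :
    (∀ s : A7, orderOf s = 7 →
      (∀ g : A7, g ≠ 1 →
        Nat.card {h : A7 // Subgroup.closure {h⁻¹ * s * h, g} ≠ ⊤} ≤ 1008) ∧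
      (∃ g : A7, g ≠ 1 ∧
        Nat.card {h : A7 // Subgroup.closure {h⁻¹ * s * h, g} ≠ ⊤} = 1008)) ∧
    (∀ s : A7, s ≠ 1 → orderOf s ≠ 7 →
      ∃ g : A7, g ≠ 1 ∧
        1008 < Nat.card {h : A7 // Subgroup.closure {h⁻¹ * s * h, g} ≠ ⊤}) := by
  exact ⟨fun s hs => A7P.part1 s hs, fun s h1 hs => A7P.part2 s h1 hs⟩
end

section
/- The uniform spread of the alternating group A₇ is at least three, with s of order 7: for all nonidentity elements x₁, x₂, x₃ ∈ A₇ there exists s ∈ A₇ of order 7 such that ⟨x_i, s⟩ = A₇ for each i ∈ {1, 2, 3}. -/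
/-! The 7-cycles of `A₇` are parametrised by disjoint pairs of Fano planes, one from each
`A₇`-class.  A pair `(x, s)` generates unless `x` fixes one of the two planes attached to `s`,
and a nontrivial `x` fixes at most three planes in each class. -/

namespace Spread7

open Equiv

/-- The fifteen Fano planes in the orbit of `P0` under `A₇`. -/
def psList : List Nat :=
  [134569177603419679700057730798950904245991504,
   136699270911306107246321404937553026034559568,
   139758334645882885402074287221614037055724624,
   134259521017521904823733638455241143527875352,
   142392216124928143707773533943355671659504472,
   137815226640313105803225825897450671975322520,
   135031281205360017853684826863814300822607072,
   137314416598923339744744993044281462553910624,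
   146742907669188338870200142757996239912541088,
   139452846710649281011652881987087417461499112,
   146704200595951573965442353797913003034455336,
   142736411914273814313087255032606517344385448,
   143103831460635798617675859283040206747751664,
   140626565250760736392137808788082529533274928,
   146800670619430138981591625690330403768187248]

/-- The fifteen Fano planes in the orbit of `Q0` under `A₇`. -/
def qsList : List Nat :=
  [134259520797173129754708023083502243786733648,
   139452846296643441759541533800766990338615888,
   137314416066792100834203866073848733210926160,
   135031281057703436717460497855851189786583832,
   136699271150111866253954590561096975877497688,
   142736411574947851363317909879099321498620824,
   134569177971425035905307675178652915023156448,
   146704200568408074857188520243099636790533472,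
   137815226933638585706133767244339451475368864,
   142392216300128223952251696506132148939449576,
   139758335205557623420869247746860132642630952,
   146742907715188821917061546564614656258259368,
   140626565105091837625454196449156861069251824,
   146800670600973155042984055438525353666390832,
   143103831624761681322967041873770925313571184]

/-- Permutations carrying `(P0, Q0)` to each of the 120 disjoint pairs of planes. -/
def gsList : List Nat :=
  [1754760, 1267336, 1468040, 1521800, 1693832, 977032, 1718920, 1002120, 1174152, 1227912,
   1428616, 941192, 1524936, 1725640, 1238216, 1747144, 743624, 1403080, 1256136, 1657544,
   682696, 1453256, 707784, 1137864, 1750280, 1004808, 1434888, 1517320, 1660680, 714504,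
   1682184, 736008, 879368, 961800, 1391880, 646408, 1258824, 1688904, 943432, 1713992, 739144,
   1140552, 993608, 1653064, 649544, 1158472, 671048, 871752, 1455496, 968072, 1168776,
   1222536, 1394568, 677768, 1419656, 702856, 874888, 928648, 1129352, 641928, 1753808,
   1266384, 1467088, 1628368, 452816, 477904, 1108688, 1363152, 416976, 1520400, 1692432,
   975632, 481040, 1369872, 1620752, 387856, 441616, 843024, 1717072, 1000272, 1172304,
   1623888, 419664, 473424, 846160, 1097040, 380240, 1225616, 1426320, 938896, 444304, 1103760,
   1358224, 383376, 408464, 838544, 742168, 1401624, 1627416, 451864, 584472, 351512, 1655640,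
   680792, 476504, 1107288, 354648, 576856, 705432, 1135512, 1361304, 415128, 579992, 347032,
   877408, 386400, 583520, 644000, 841120, 350112]

/-- Words in `x` and the 7-cycle used to reach a 3-cycle. -/
def wordList : List (List Nat) :=
  [[0, 0], [1, 1, 1, 1], [3, 3, 3, 3], [2, 2, 2, 2], [0, 3, 0, 3], [0, 1, 0, 1], [0, 2, 0, 2],
   [1, 3, 1, 3], [3, 4, 3, 4], [1, 5, 1, 5], [0, 5, 0, 5], [4, 6, 4, 6], [5, 6, 5, 6], [1, 4,
   1, 4], [5, 5], [2, 5, 2, 5], [1, 3, 1, 6], [3, 5], [4]]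

/-- A Fano plane is coded by the octal digits of its table `a, b ↦ third point on the line ab`. -/
def P0 : Nat := 137815226640313105803225825897450671975322520

/-- The opposite cyclic Fano plane. -/
def Q0 : Nat := 142392216300128223952251696506132148939449576

/-- Octal digit. -/
def dig (n i : Nat) : Nat := Nat.mod (Nat.div n (Nat.pow 8 i)) 8

/-- Table lookup. -/
def mopN (M a b : Nat) : Nat := Nat.mod (dig M (Nat.add (Nat.mul 7 a) b)) 7

/-- Table lookup in `Fin 7`. -/
def mop (M : Nat) (a b : Fin 7) : Fin 7 := ⟨mopN M a b, Nat.mod_lt _ (by norm_num)⟩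

/-- Octal number from digits. -/
def encL : List Nat → Nat
  | [] => 0
  | v :: l => v + 8 * encL l

/-- Code of a permutation. -/
def enc (x : Perm (Fin 7)) : Nat :=
  encL [(x 0).val, (x 1).val, (x 2).val, (x 3).val, (x 4).val, (x 5).val, (x 6).val]

theorem dig_enc (x : Perm (Fin 7)) (i : Fin 7) : dig (enc x) i.val = (x i).val := by
  have h0 := (x 0).isLt
  have h1 := (x 1).isLt
  have h2 := (x 2).isLt
  have h3 := (x 3).isLt
  have h4 := (x 4).isLt
  have h5 := (x 5).isLt
  have h6 := (x 6).isLt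
  have key : ∀ n k : Nat, dig n k = n / 8 ^ k % 8 := fun _ _ => rfl
  rw [key]
  fin_cases i <;> simp [enc, encL] <;> omega

theorem enc_inj {x y : Perm (Fin 7)} (h : enc x = enc y) : x = y := by
  ext i
  rw [← dig_enc, ← dig_enc, h]

/-- `x` carries the plane `M` to the plane `N`. -/
def Maps (x : Perm (Fin 7)) (M N : Nat) : Prop := ∀ a b, x (mop M a b) = mop N (x a) (x b)

/-- Boolean version of `Maps`. -/
def mapB (E M N : Nat) : Bool :=
  Nat.beq (dig E (mopN M 0 1)) (mopN N (dig E 0) (dig E 1)) &&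
  [0, 1, 2, 3, 4, 5, 6].all fun a => [1, 2, 3, 4, 5, 6, 0].all fun b =>
    Nat.beq (dig E (mopN M a b)) (mopN N (dig E a) (dig E b))

theorem mapB_iff (x : Perm (Fin 7)) (M N : Nat) : mapB (enc x) M N = true ↔ Maps x M N := by
  have key : ∀ a b : Fin 7, Nat.beq (dig (enc x) (mopN M a b))
      (mopN N (dig (enc x) a) (dig (enc x) b)) = true ↔ x (mop M a b) = mop N (x a) (x b) := by
    intro a b
    rw [Nat.beq_eq, Fin.ext_iff, dig_enc, dig_enc, ← dig_enc x (mop M a b)]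
    rfl
  simp only [mapB, List.all_eq_true, Bool.and_eq_true]
  constructor
  · intro h a b
    rw [← key]
    apply h.2
    · fin_cases a <;> simp
    · fin_cases b <;> simp
  · intro h
    refine ⟨(key 0 1).2 (h _ _), ?_⟩
    intro a ha b hb
    have ha' : a < 7 := by simp at ha; omega
    have hb' : b < 7 := by simp at hb; omega
    exact (key ⟨a, ha'⟩ ⟨b, hb'⟩).2 (h _ _)

theorem Maps.mul {x y : Perm (Fin 7)} {L M N : Nat} (hy : Maps y M N) (hx : Maps x L M) :
    Maps (y * x) L N := by
  intro a b
  rw [Perm.mul_apply, hx a b, hy]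
  rfl

theorem Maps.inv {x : Perm (Fin 7)} {M N : Nat} (hx : Maps x M N) : Maps x⁻¹ N M := by
  intro a b
  rw [Perm.inv_eq_iff_eq, hx]
  simp

theorem Maps.pow {x : Perm (Fin 7)} {M : Nat} (hx : Maps x M M) (k : Nat) :
    Maps (x ^ k) M M := by
  induction k with
  | zero => intro a b; simp
  | succ k ih => rw [pow_succ]; exact ih.mul hx

/-- Check `f` on the codes of all injective digit strings. -/
def enumB (f : Nat → Bool) : Nat → List Nat → Nat → Nat → Bool
  | 0, _, acc, _ => f acc
  | n + 1, rest, acc, w =>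
    rest.all fun v => enumB f n (rest.filter fun u => !(Nat.beq u v))
      (Nat.add acc (Nat.mul v w)) (Nat.mul w 8)

theorem enumB_spec (f : Nat → Bool) (n : Nat) : ∀ (rest : List Nat) (acc w : Nat),
    enumB f n rest acc w = true → ∀ l : List Nat, l.length = n → l.Nodup → (∀ v ∈ l, v ∈ rest) →
      f (acc + w * encL l) = true := by
  induction n with
  | zero =>
    intro rest acc w h l hl _ _
    rw [List.length_eq_zero_iff] at hl
    subst hl
    simpa [encL, enumB] using h
  | succ n ih =>
    intro rest acc w h l hl hn hm
    cases l with
    | nil => simp at hl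
    | cons v l =>
      simp only [enumB, List.all_eq_true] at h
      rw [List.nodup_cons] at hn
      have := ih _ _ _ (h v (hm v (by simp))) l (by simpa using hl) hn.2 (by
        intro u hu
        rw [List.mem_filter]
        refine ⟨hm u (by simp [hu]), ?_⟩
        have huv : u ≠ v := fun e => hn.1 (e ▸ hu)
        rw [Bool.not_eq_true', Bool.eq_false_iff, Ne, Nat.beq_eq]
        exact huv)
      convert this using 2
      simp only [encL, Nat.add_eq, Nat.mul_eq]
      ring

theorem enum_all (f : Nat → Bool) (h : enumB f 7 [0, 1, 2, 3, 4, 5, 6] 0 1 = true)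
    (x : Perm (Fin 7)) : f (enc x) = true := by
  have := enumB_spec f 7 _ _ _ h (l := [(x 0).val, (x 1).val, (x 2).val, (x 3).val, (x 4).val,
    (x 5).val, (x 6).val]) rfl (by simp [← Fin.ext_iff]) (by
      simp only [List.mem_cons, List.not_mem_nil, or_false]
      rintro v (rfl | rfl | rfl | rfl | rfl | rfl | rfl) <;> omega)
  simpa [enc] using this

theorem enum_stab (f : Nat → Bool) (h : enumB f 6 [1, 2, 3, 4, 5, 6] 0 8 = true)
    (x : Perm (Fin 7)) (hx : x 0 = 0) : f (enc x) = true := by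
  have ne : ∀ i : Fin 7, i ≠ 0 → (x i).val ≠ 0 := by
    intro i hi h
    apply hi
    apply x.injective
    rw [hx]
    exact Fin.ext h
  have := enumB_spec f 6 _ _ _ h (l := [(x 1).val, (x 2).val, (x 3).val, (x 4).val,
    (x 5).val, (x 6).val]) rfl (by simp [← Fin.ext_iff]) (by
      have h1 := ne 1 (by decide)
      have h2 := ne 2 (by decide)
      have h3 := ne 3 (by decide)
      have h4 := ne 4 (by decide)
      have h5 := ne 5 (by decide)
      have h6 := ne 6 (by decide)
      simp only [List.mem_cons, List.not_mem_nil, or_false]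
      rintro v (rfl | rfl | rfl | rfl | rfl | rfl) <;> omega)
  simpa [enc, encL, hx] using this

/-! ### Disjoint pairs of planes -/

/-- The planes share no line. -/
def disjB (M N : Nat) : Bool :=
  [1, 2, 3, 4, 5, 6].all fun a => (List.range a).all fun b => !(Nat.beq (mopN M a b) (mopN N a b))

theorem common_le : ∀ N ∈ qsList, ∀ K ∈ qsList, N = K ∨
    (psList.filter fun M => !(disjB M N) && !(disjB M K)).length ≤ 3 := by
  decide +kernel

theorem disj_gs : ∀ M ∈ psList, ∀ N ∈ qsList, disjB M N = true →
    (gsList.any fun g => mapB g P0 M && mapB g Q0 N) = true := by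
  decide +kernel

theorem gs_perm : ∀ g ∈ gsList, (∀ i j : Fin 7, dig g i % 7 = dig g j % 7 → i = j) ∧
    encL [dig g 0 % 7, dig g 1 % 7, dig g 2 % 7, dig g 3 % 7, dig g 4 % 7, dig g 5 % 7,
      dig g 6 % 7] = g := by
  decide +kernel

theorem exists_perm {g : Nat} (hg : g ∈ gsList) : ∃ x : Perm (Fin 7), enc x = g := by
  obtain ⟨h1, h2⟩ := gs_perm g hg
  let f : Fin 7 → Fin 7 := fun i => ⟨dig g i % 7, Nat.mod_lt _ (by norm_num)⟩
  have hf : Function.Injective f := fun i j h => h1 i j (Fin.ext_iff.1 h)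
  refine ⟨Equiv.ofBijective f (Finite.injective_iff_bijective.1 hf), ?_⟩
  exact h2

theorem exists_conj {M N : Nat} (hM : M ∈ psList) (hN : N ∈ qsList) (h : disjB M N = true) :
    ∃ g : Perm (Fin 7), Maps g P0 M ∧ Maps g Q0 N := by
  have := disj_gs M hM N hN h
  simp only [List.any_eq_true, Bool.and_eq_true] at this
  obtain ⟨g, hg, h1, h2⟩ := this
  obtain ⟨x, rfl⟩ := exists_perm hg
  exact ⟨x, (mapB_iff _ _ _).1 h1, (mapB_iff _ _ _).1 h2⟩

/-! ### A nontrivial permutation fixes at most three planes of each class -/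

/-- A nontrivial permutation fixing `B` fixes at most three planes of `L`. -/
def fewB (B : Nat) (L : List Nat) (E : Nat) : Bool :=
  !(mapB E B B) || Nat.beq E 1754760 || Nat.ble ((L.filter fun M => mapB E M M).length) 3

theorem few_ps : enumB (fewB P0 psList) 7 [0, 1, 2, 3, 4, 5, 6] 0 1 = true := by decide +kernel

theorem few_qs : enumB (fewB Q0 qsList) 7 [0, 1, 2, 3, 4, 5, 6] 0 1 = true := by decide +kernel

/-- `L` is a single orbit containing `B`, without repeated tables. -/
def Orbit (B : Nat) (L : List Nat) : Prop :=
  (∀ M ∈ L, (gsList.any fun g => mapB g B M && L.all fun K => L.any fun J => mapB g J K) = true) ∧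
  (∀ K ∈ L, ∀ J ∈ L, (∀ a b, mop K a b = mop J a b) → K = J)

theorem orbit_ps : Orbit P0 psList := ⟨by decide +kernel, by decide +kernel⟩

theorem orbit_qs : Orbit Q0 qsList := ⟨by decide +kernel, by decide +kernel⟩

open Classical in
theorem few_of {B : Nat} {L : List Nat} (hO : Orbit B L)
    (h : enumB (fewB B L) 7 [0, 1, 2, 3, 4, 5, 6] 0 1 = true)
    (x : Perm (Fin 7)) (hx : x ≠ 1) : (L.toFinset.filter fun M => Maps x M M).card ≤ 3 := by
  rcases Finset.eq_empty_or_nonempty (L.toFinset.filter fun M => Maps x M M) with h0 | ⟨M, hM⟩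
  · simp [h0]
  rw [Finset.mem_filter, List.mem_toFinset] at hM
  have hg := hO.1 M hM.1
  simp only [List.any_eq_true, Bool.and_eq_true, List.all_eq_true] at hg
  obtain ⟨g, hg, hgM, hgL⟩ := hg
  obtain ⟨g, rfl⟩ := exists_perm hg
  simp only [mapB_iff] at hgM hgL
  have h1 := enum_all _ h (g⁻¹ * x * g)
  have e1 : enc 1 = 1754760 := by decide
  have hB : Maps (g⁻¹ * x * g) B B := (hgM.inv.mul hM.2).mul hgM
  have hB' : mapB (enc (g⁻¹ * x * g)) B B = true := (mapB_iff _ _ _).2 hB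
  simp only [fewB, hB', Bool.or_eq_true, Nat.beq_eq, Nat.ble_eq, Bool.not_true] at h1
  rcases h1 with (h1 | h1) | h1
  · simp at h1
  · exfalso
    apply hx
    have h2 : g⁻¹ * x * g = 1 := enc_inj (h1.trans e1.symm)
    have h3 : x = g * (g⁻¹ * x * g) * g⁻¹ := by group
    rw [h3, h2]
    simp
  · refine le_trans ?_ h1
    refine le_trans ?_ (List.toFinset_card_le _)
    choose! f hfL hf using hgL
    refine Finset.card_le_card_of_injOn f ?_ ?_
    · intro K hK
      rw [Finset.mem_coe, Finset.mem_filter, List.mem_toFinset] at hK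
      rw [Finset.mem_coe, List.mem_toFinset, List.mem_filter, mapB_iff]
      exact ⟨hfL K hK.1, ((hf K hK.1).inv.mul hK.2).mul (hf K hK.1)⟩
    · intro K hK J hJ hKJ
      rw [Finset.mem_coe, Finset.mem_filter, List.mem_toFinset] at hK hJ
      apply hO.2 K hK.1 J hJ.1
      intro a b
      have e2 := hf K hK.1 (g⁻¹ a) (g⁻¹ b)
      have e3 := hf J hJ.1 (g⁻¹ a) (g⁻¹ b)
      rw [← hKJ, e2] at e3
      simpa using e3

/-! ### Generation with the standard 7-cycle -/

/-- The standard 7-cycle. -/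
abbrev c : Perm (Fin 7) := finRotate 7

theorem c_pow_val (k : Nat) (p : Fin 7) : ((c ^ k) p).val = (p.val + k) % 7 := by
  induction k with
  | zero => simp; omega
  | succ k ih =>
    rw [pow_succ', Perm.mul_apply, finRotate_apply, Fin.val_add, ih]
    simp
    omega

/-- Evaluate a word at a point. -/
def evW (E : Nat) : List Nat → Nat → Nat
  | [], p => p
  | k :: w, p => evW E w (dig E (Nat.mod (Nat.add p k) 7))

/-- The permutation given by a word. -/
def wperm (x : Perm (Fin 7)) : List Nat → Perm (Fin 7)
  | [] => 1
  | k :: w => wperm x w * (x * c ^ k)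

theorem evW_eq (x : Perm (Fin 7)) (w : List Nat) (p : Fin 7) :
    evW (enc x) w p.val = (wperm x w p).val := by
  induction w generalizing p with
  | nil => rfl
  | cons k w ih =>
    have h : Nat.mod (Nat.add p.val k) 7 = ((c ^ k) p).val := (c_pow_val k p).symm
    rw [evW, h, dig_enc, ih]
    rfl

/-- `0` if the word fixes the point, otherwise `1`. -/
def mv (E : Nat) (w : List Nat) (p : Nat) : Nat := if evW E w p = p then 0 else 1

/-- The word gives a 3-cycle. -/
def threeB (E : Nat) (w : List Nat) : Bool :=
  Nat.beq (mv E w 0 + mv E w 1 + mv E w 2 + mv E w 3 + mv E w 4 + mv E w 5 + mv E w 6) 3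

theorem three_of (x : Perm (Fin 7)) (w : List Nat) (h : threeB (enc x) w = true) :
    (wperm x w).IsThreeCycle := by
  rw [← card_support_eq_three_iff]
  have hs : (wperm x w).support.card = ∑ p : Fin 7, mv (enc x) w p.val := by
    have : (wperm x w).support = Finset.univ.filter fun p => wperm x w p ≠ p := by
      ext p; simp
    rw [this, Finset.card_filter]
    refine Finset.sum_congr rfl fun p _ => ?_
    simp only [mv, evW_eq, ← Fin.ext_iff]
    split_ifs <;> simp_all
  rw [hs, Fin.sum_univ_seven]
  exact Nat.eq_of_beq_eq_true h

/-- Either some word gives a 3-cycle, or a plane is fixed, or the map is odd and affine. -/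
def genB (E : Nat) : Bool :=
  (wordList.any fun w => threeB E w) || mapB E P0 P0 || mapB E Q0 Q0 ||
    Nat.beq E 1103256 || Nat.beq E 680680 || Nat.beq E 342384

theorem gen_check : enumB genB 6 [1, 2, 3, 4, 5, 6] 0 8 = true := by decide +kernel

/-- Multiplication by 3, 5 and 6 modulo 7. -/
def o3 : Perm (Fin 7) := ⟨fun i => 3 * i, fun i => 5 * i, by decide, by decide⟩

/-- Multiplication by 5. -/
def o5 : Perm (Fin 7) := ⟨fun i => 5 * i, fun i => 3 * i, by decide, by decide⟩

/-- Multiplication by 6. -/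
def o6 : Perm (Fin 7) := ⟨fun i => 6 * i, fun i => 6 * i, by decide, by decide⟩

theorem maps_c_P0 : Maps c P0 P0 := by unfold Maps; decide +kernel

theorem maps_c_Q0 : Maps c Q0 Q0 := by unfold Maps; decide +kernel

theorem sign_c : Perm.sign c = 1 := by rw [sign_finRotate]; rfl

theorem alt_le_stab (y : Perm (Fin 7)) (hy : y 0 = 0) (hs : Perm.sign y = 1)
    (hP : ¬ Maps y P0 P0) (hQ : ¬ Maps y Q0 Q0) (G : Subgroup (Perm (Fin 7)))
    (hyG : y ∈ G) (hc : c ∈ G) : alternatingGroup (Fin 7) ≤ G := by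
  have h := enum_stab _ gen_check y hy
  simp only [genB, Bool.or_eq_true, mapB_iff, Nat.beq_eq, hP, hQ, or_false] at h
  have odd : ∀ (n : Nat) (o : Perm (Fin 7)), enc o = n → Perm.sign o = -1 → enc y ≠ n := by
    intro n o h1 h2 h3
    rw [enc_inj (h3.trans h1.symm), h2] at hs
    exact absurd hs (by decide)
  rcases h with ((h | h) | h) | h
  · simp only [List.any_eq_true] at h
    obtain ⟨w, -, hw⟩ := h
    have hmem : ∀ w, wperm y w ∈ G := by
      intro w
      induction w with
      | nil => exact G.one_mem
      | cons k w ih => exact G.mul_mem ih (G.mul_mem hyG (G.pow_mem hc k))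
    have htr : MulAction.IsPretransitive G (Fin 7) := by
      have key : ∀ b : Fin 7, ∃ g : G, g • (0 : Fin 7) = b := by
        intro b
        refine ⟨⟨c ^ b.val, G.pow_mem hc _⟩, ?_⟩
        change (c ^ b.val) 0 = b
        apply Fin.ext
        rw [c_pow_val]
        have := b.isLt
        simp
      exact MulAction.isPretransitive_iff_base (0 : Fin 7) |>.2 key
    have hprim : MulAction.IsPreprimitive G (Fin 7) :=
      MulAction.IsPreprimitive.of_prime_card (by rw [Nat.card_fin]; norm_num)
    exact Perm.alternatingGroup_le_of_isPreprimitive_of_isThreeCycle_mem hprim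
      (three_of y w hw) (hmem w)
  · exact absurd h (odd _ o3 (by decide +kernel) (by decide +kernel))
  · exact absurd h (odd _ o5 (by decide +kernel) (by decide +kernel))
  · exact absurd h (odd _ o6 (by decide +kernel) (by decide +kernel))

theorem alt_le (x : Perm (Fin 7)) (hs : Perm.sign x = 1)
    (hP : ¬ Maps x P0 P0) (hQ : ¬ Maps x Q0 Q0) (G : Subgroup (Perm (Fin 7)))
    (hxG : x ∈ G) (hc : c ∈ G) : alternatingGroup (Fin 7) ≤ G := by
  have hd : c ^ (x 0).val ∈ G := G.pow_mem hc _
  have hx : x = c ^ (x 0).val * ((c ^ (x 0).val)⁻¹ * x) := by group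
  refine alt_le_stab ((c ^ (x 0).val)⁻¹ * x) ?_ ?_ ?_ ?_ G (G.mul_mem (G.inv_mem hd) hxG) hc
  · rw [Perm.mul_apply, Perm.inv_eq_iff_eq]
    apply Fin.ext
    rw [c_pow_val]
    have := (x 0).isLt
    simp
    omega
  · rw [map_mul, map_inv, map_pow, sign_c, hs]
    simp
  · intro h
    rw [hx] at hP
    exact hP ((maps_c_P0.pow _).mul h)
  · intro h
    rw [hx] at hQ
    exact hQ ((maps_c_Q0.pow _).mul h)

/-- Generation with a conjugate of the standard 7-cycle. -/
theorem closure_conj {M N : Nat} (g : Perm (Fin 7)) (hM : Maps g P0 M) (hN : Maps g Q0 N)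
    (s x : A7) (hs : (s : Perm (Fin 7)) = g * c * g⁻¹) (hx1 : ¬ Maps (x : Perm (Fin 7)) M M)
    (hx2 : ¬ Maps (x : Perm (Fin 7)) N N) : Subgroup.closure {x, s} = ⊤ := by
  have hconj : (x : Perm (Fin 7)) = g * (g⁻¹ * x * g) * g⁻¹ := by group
  set H : Subgroup (Perm (Fin 7)) :=
    (Subgroup.closure {x, s}).map (alternatingGroup (Fin 7)).subtype with hH
  have hxH : (x : Perm (Fin 7)) ∈ H := ⟨x, Subgroup.subset_closure (by simp), rfl⟩
  have hsH : (s : Perm (Fin 7)) ∈ H := ⟨s, Subgroup.subset_closure (by simp), rfl⟩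
  have hxs : Perm.sign (x : Perm (Fin 7)) = 1 := Perm.mem_alternatingGroup.1 x.2
  have hle := alt_le (g⁻¹ * x * g) (by simp [hxs])
    (fun h => hx1 (by rw [hconj]; exact (hM.mul h).mul hM.inv))
    (fun h => hx2 (by rw [hconj]; exact (hN.mul h).mul hN.inv))
    (H.comap (MulAut.conj g).toMonoidHom)
    (by
      change g * (g⁻¹ * x * g) * g⁻¹ ∈ H
      rwa [← hconj])
    (by
      change g * c * g⁻¹ ∈ H
      rwa [← hs])
  rw [eq_top_iff]
  rintro y -
  have hy : g⁻¹ * (y : Perm (Fin 7)) * g ∈ alternatingGroup (Fin 7) := by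
    have := Perm.mem_alternatingGroup.1 y.2
    rw [Perm.mem_alternatingGroup]
    simp [this]
  have h2 : g * (g⁻¹ * (y : Perm (Fin 7)) * g) * g⁻¹ ∈ H := hle hy
  have h3 : g * (g⁻¹ * (y : Perm (Fin 7)) * g) * g⁻¹ = y := by group
  rw [h3] at h2
  obtain ⟨z, hz, hzy⟩ := h2
  have : z = y := Subtype.ext hzy
  exact this ▸ hz

open Classical in
theorem many_good {B : Nat} {L : List Nat} (hO : Orbit B L)
    (h : enumB (fewB B L) 7 [0, 1, 2, 3, 4, 5, 6] 0 1 = true)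
    (hL : L.toFinset.card = 15) (x₁ x₂ x₃ : Perm (Fin 7)) (h₁ : x₁ ≠ 1) (h₂ : x₂ ≠ 1)
    (h₃ : x₃ ≠ 1) :
    6 ≤ (L.toFinset.filter fun M => ¬ Maps x₁ M M ∧ ¬ Maps x₂ M M ∧ ¬ Maps x₃ M M).card := by
  have b₁ := few_of hO h x₁ h₁
  have b₂ := few_of hO h x₂ h₂
  have b₃ := few_of hO h x₃ h₃
  have hsub : L.toFinset ⊆
      (L.toFinset.filter fun M => ¬ Maps x₁ M M ∧ ¬ Maps x₂ M M ∧ ¬ Maps x₃ M M) ∪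
      ((L.toFinset.filter fun M => Maps x₁ M M) ∪ ((L.toFinset.filter fun M => Maps x₂ M M) ∪
      (L.toFinset.filter fun M => Maps x₃ M M))) := by
    intro M hM
    simp only [Finset.mem_union, Finset.mem_filter]
    tauto
  have := Finset.card_le_card hsub
  have u1 := this.trans (Finset.card_union_le _ _)
  have u2 := Finset.card_union_le (L.toFinset.filter fun M => Maps x₁ M M)
    ((L.toFinset.filter fun M => Maps x₂ M M) ∪ (L.toFinset.filter fun M => Maps x₃ M M))
  have u3 := Finset.card_union_le (L.toFinset.filter fun M => Maps x₂ M M)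
    (L.toFinset.filter fun M => Maps x₃ M M)
  omega

open Classical in
theorem exists_pair (x₁ x₂ x₃ : Perm (Fin 7)) (h₁ : x₁ ≠ 1) (h₂ : x₂ ≠ 1) (h₃ : x₃ ≠ 1) :
    ∃ M ∈ psList, ∃ N ∈ qsList, disjB M N = true ∧
      (¬ Maps x₁ M M ∧ ¬ Maps x₂ M M ∧ ¬ Maps x₃ M M) ∧
      (¬ Maps x₁ N N ∧ ¬ Maps x₂ N N ∧ ¬ Maps x₃ N N) := by
  have gp := many_good orbit_ps few_ps (by decide +kernel) x₁ x₂ x₃ h₁ h₂ h₃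
  have gq := many_good orbit_qs few_qs (by decide +kernel) x₁ x₂ x₃ h₁ h₂ h₃
  obtain ⟨N, hN, K, hK, hNK⟩ := Finset.one_lt_card.1 (lt_of_lt_of_le (by norm_num : 1 < 6) gq)
  rw [Finset.mem_filter, List.mem_toFinset] at hN hK
  by_contra hcon
  have hsub : (psList.toFinset.filter fun M => ¬ Maps x₁ M M ∧ ¬ Maps x₂ M M ∧ ¬ Maps x₃ M M) ⊆
      (psList.filter fun M => !(disjB M N) && !(disjB M K)).toFinset := by
    intro M hM
    rw [Finset.mem_filter, List.mem_toFinset] at hM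
    rw [List.mem_toFinset, List.mem_filter]
    refine ⟨hM.1, ?_⟩
    have e1 : disjB M N ≠ true := fun e => hcon ⟨M, hM.1, N, hN.1, e, hM.2, hN.2⟩
    have e2 : disjB M K ≠ true := fun e => hcon ⟨M, hM.1, K, hK.1, e, hM.2, hK.2⟩
    simp [e1, e2]
  have hc := (Finset.card_le_card hsub).trans (List.toFinset_card_le _)
  rcases common_le N hN.1 K hK.1 with h | h
  · exact hNK h
  · omega

end Spread7

open Spread7 in
/-- The uniform spread of `A₇` is at least three, with `s` of order 7: for all
nonidentity `x₁, x₂, x₃ ∈ A₇` there is `s ∈ A₇` of order 7 generating `A₇` with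
each `x i`. -/
theorem stmt_15 :
    ∀ x₁ x₂ x₃ : A7, x₁ ≠ 1 → x₂ ≠ 1 → x₃ ≠ 1 →
      ∃ s : A7, orderOf s = 7 ∧
        Subgroup.closure {x₁, s} = ⊤ ∧
        Subgroup.closure {x₂, s} = ⊤ ∧
        Subgroup.closure {x₃, s} = ⊤ := by
  intro x₁ x₂ x₃ h₁ h₂ h₃
  have ne : ∀ x : A7, x ≠ 1 → (x : Equiv.Perm (Fin 7)) ≠ 1 :=
    fun x hx h => hx (Subtype.ext h)
  obtain ⟨M, hM, N, hN, hd, hxM, hxN⟩ := exists_pair x₁ x₂ x₃ (ne _ h₁) (ne _ h₂) (ne _ h₃)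
  obtain ⟨g, hgM, hgN⟩ := exists_conj hM hN hd
  have hs : g * c * g⁻¹ ∈ alternatingGroup (Fin 7) := by
    rw [Equiv.Perm.mem_alternatingGroup, map_mul, map_mul, sign_c, map_inv]
    simp
  refine ⟨⟨g * c * g⁻¹, hs⟩, ?_, closure_conj g hgM hgN _ _ rfl hxM.1 hxN.1,
    closure_conj g hgM hgN _ _ rfl hxM.2.1 hxN.2.1,
    closure_conj g hgM hgN _ _ rfl hxM.2.2 hxN.2.2⟩
  rw [← Subgroup.orderOf_coe]
  have hc7 : orderOf c = 7 := by
    apply orderOf_eq_prime (hp := ⟨by norm_num⟩)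
    · ext p
      rw [c_pow_val]
      have := p.isLt
      simp
    · intro h
      exact absurd (congrArg (fun e : Equiv.Perm (Fin 7) => e 0) h) (by decide)
  have := orderOf_injective (MulAut.conj g).toMonoidHom (MulAut.conj g).injective c
  rw [hc7] at this
  exact this
end
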